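/- For every integer p and every integer q ≥ 1, |5^(1/3) − p/q| > 10⁻¹²⁹⁰⁰ / q^2.9999999999998. -/

import Mathlib

namespace CbrtFive

section ZeroEstimate

open MvPolynomial

/-- The automorphism of `ℂ[x, y, g]` given by `x ↦ x + v₁`, `y ↦ y + v₂`, `g ↦ v₃ g`. -/
noncomputable def shift (v : ℂ × ℂ × ℂ) :
    MvPolynomial (Fin 3) ℂ →ₐ[ℂ] MvPolynomial (Fin 3) ℂ :=
  aeval ![X 0 + C v.1, X 1 + C v.2.1, C v.2.2 * X 2]

lemma shift_shift (v w : ℂ × ℂ × ℂ) (p : MvPolynomial (Fin 3) ℂ) :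
    shift v (shift w p) = shift (v.1 + w.1, v.2.1 + w.2.1, v.2.2 * w.2.2) p := by
  have : (shift v).comp (shift w) = shift (v.1 + w.1, v.2.1 + w.2.1, v.2.2 * w.2.2) := by
    apply MvPolynomial.algHom_ext
    intro i
    fin_cases i <;> simp [shift, MvPolynomial.algebraMap_eq] <;> ring
  rw [← this]; rfl

lemma shift_id (p : MvPolynomial (Fin 3) ℂ) : shift (0, 0, 1) p = p := by
  have : shift (0, 0, 1) = AlgHom.id ℂ _ := by
    apply MvPolynomial.algHom_ext
    intro i
    fin_cases i <;> simp [shift]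
  rw [this]; rfl

lemma eval_shift (v : ℂ × ℂ × ℂ) (x y g : ℂ) (p : MvPolynomial (Fin 3) ℂ) :
    eval ![x, y, g] (shift v p) = eval ![x + v.1, y + v.2.1, v.2.2 * g] p := by
  have : (aeval ![x, y, g]).comp (shift v) =
      (aeval ![x + v.1, y + v.2.1, v.2.2 * g] : MvPolynomial (Fin 3) ℂ →ₐ[ℂ] ℂ) := by
    apply MvPolynomial.algHom_ext
    intro i
    fin_cases i <;> simp [shift, ← MvPolynomial.algebraMap_eq]
  simpa [MvPolynomial.coe_aeval_eq_eval] using DFunLike.congr_fun this p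

lemma degreeOf_shift_le (v : ℂ × ℂ × ℂ) (p : MvPolynomial (Fin 3) ℂ) (j : Fin 3) :
    degreeOf j (shift v p) ≤ degreeOf j p := by
  rw [shift, aeval_def, eval₂_eq']
  refine (degreeOf_sum_le _ _ _).trans (Finset.sup_le fun d hd => ?_)
  have hF : ∀ i, degreeOf j ((![X 0 + C v.1, X 1 + C v.2.1, C v.2.2 * X 2] :
      Fin 3 → MvPolynomial (Fin 3) ℂ) i) ≤ if i = j then 1 else 0 := by
    intro i
    fin_cases i
    · refine (degreeOf_add_le _ _ _).trans ?_
      simp [degreeOf_C, degreeOf_X, eq_comm]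
    · refine (degreeOf_add_le _ _ _).trans ?_
      simp [degreeOf_C, degreeOf_X, eq_comm]
    · refine (degreeOf_C_mul_le _ _ _).trans ?_
      simp [degreeOf_X, eq_comm]
  rw [MvPolynomial.algebraMap_eq]
  refine (degreeOf_C_mul_le _ _ _).trans ((degreeOf_prod_le _ _ _).trans ?_)
  calc _ ≤ ∑ i, d i * (if i = j then 1 else 0) :=
        Finset.sum_le_sum fun i _ => (degreeOf_pow_le _ _ _).trans (Nat.mul_le_mul_left _ (hF i))
    _ = d j := by simp
    _ ≤ _ := by
        rw [degreeOf_eq_sup]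
        exact Finset.le_sup (f := fun m : Fin 3 →₀ ℕ => m j) hd

/-- `p` has leading term `a X^h`, all other monomials being divisors of `X^h` having the same
degree in the last variable. -/
def HasLead (p : MvPolynomial (Fin 3) ℂ) (h : Fin 3 →₀ ℕ) (a : ℂ) : Prop :=
  ∀ k ∈ (p - monomial h a).support, k < h ∧ k 2 = h 2

lemma HasLead.mul {p q : MvPolynomial (Fin 3) ℂ} {h k : Fin 3 →₀ ℕ} {a b : ℂ}
    (hp : HasLead p h a) (hq : HasLead q k b) : HasLead (p * q) (h + k) (a * b) := by
  classical
  intro m hm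
  have key : p * q - monomial (h + k) (a * b) = (p - monomial h a) * (q - monomial k b)
      + (p - monomial h a) * monomial k b + monomial h a * (q - monomial k b) := by
    have : monomial (h + k) (a * b) = monomial h a * monomial k b := by rw [monomial_mul]
    rw [this]; ring
  rw [key] at hm
  rcases Finset.mem_union.1 (support_add hm) with hm | hm
  · rcases Finset.mem_union.1 (support_add hm) with hm | hm
    · obtain ⟨i, hi, j, hj, rfl⟩ := Finset.mem_add.1 (support_mul _ _ hm)
      have := hp i hi; have h2 := hq j hj
      exact ⟨add_lt_add this.1 h2.1, by simp [this.2, h2.2]⟩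
    · obtain ⟨i, hi, j, hj, rfl⟩ := Finset.mem_add.1 (support_mul _ _ hm)
      have := hp i hi
      obtain rfl := Finset.mem_singleton.1 (support_monomial_subset hj)
      exact ⟨add_lt_add_of_lt_of_le this.1 le_rfl, by simp [this.2]⟩
  · obtain ⟨i, hi, j, hj, rfl⟩ := Finset.mem_add.1 (support_mul _ _ hm)
    have := hq j hj
    obtain rfl := Finset.mem_singleton.1 (support_monomial_subset hi)
    exact ⟨add_lt_add_of_le_of_lt le_rfl this.1, by simp [this.2]⟩

lemma HasLead.pow {p : MvPolynomial (Fin 3) ℂ} {h : Fin 3 →₀ ℕ} {a : ℂ}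
    (hp : HasLead p h a) (n : ℕ) : HasLead (p ^ n) (n • h) (a ^ n) := by
  induction n with
  | zero => intro k hk; simp [← C_apply] at hk
  | succ n ih => rw [pow_succ, pow_succ, succ_nsmul]; exact ih.mul hp

lemma hasLead_X_add_C {i : Fin 3} (hi : i ≠ 2) (v : ℂ) :
    HasLead (X i + C v) (Finsupp.single i 1) 1 := by
  intro k hk
  have : (X i + C v : MvPolynomial (Fin 3) ℂ) - monomial (Finsupp.single i 1) 1 =
    monomial 0 v := by
    rw [← C_apply, X]; ring
  rw [this] at hk
  obtain rfl := Finset.mem_singleton.1 (support_monomial_subset hk)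
  refine ⟨?_, by simp [hi.symm]⟩
  rw [pos_iff_ne_zero]; simp

lemma hasLead_shift_monomial (v : ℂ × ℂ × ℂ) (h : Fin 3 →₀ ℕ) (c : ℂ) :
    HasLead (shift v (monomial h c)) h (c * v.2.2 ^ h 2) := by
  have h2 : HasLead (C v.2.2 * X 2) (Finsupp.single 2 1) v.2.2 := by
    intro k hk
    rw [C_mul_X_eq_monomial, sub_self] at hk
    simp at hk
  have hc : HasLead (C c) 0 c := by
    intro k hk
    simp [← C_apply] at hk
  have := ((hc.mul ((hasLead_X_add_C (i := 0) (by decide) v.1).pow (h 0))).mul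
    ((hasLead_X_add_C (i := 1) (by decide) v.2.1).pow (h 1))).mul (h2.pow (h 2))
  have e1 : (0 + h 0 • Finsupp.single 0 1 + h 1 • Finsupp.single 1 1
      + h 2 • Finsupp.single 2 1 : Fin 3 →₀ ℕ) = h := by
    ext i; fin_cases i <;> simp
  rw [e1] at this
  convert this using 1
  · rw [shift, aeval_monomial, Finsupp.prod_fintype _ _ (by simp), Fin.prod_univ_three]
    simp [MvPolynomial.algebraMap_eq, mul_assoc]
  · simp

/-- For every `g`-degree occurring in `q` there is a monomial whose coefficient is scaled by
every shift. -/
lemma exists_coeff_shift {q : MvPolynomial (Fin 3) ℂ} {h : Fin 3 →₀ ℕ} (hh : h ∈ q.support) :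
    ∃ f : Fin 3 →₀ ℕ, coeff f q ≠ 0 ∧
      ∀ v, coeff f (shift v q) = coeff f q * v.2.2 ^ h 2 := by
  classical
  obtain ⟨f, hf⟩ := (q.support.filter fun k => k 2 = h 2).exists_maximal ⟨h, by simpa using hh⟩
  have hfm := Finset.mem_filter.1 hf.prop
  refine ⟨f, mem_support_iff.1 hfm.1, fun v => ?_⟩
  conv_lhs => rw [q.as_sum, map_sum, coeff_sum]
  rw [Finset.sum_eq_single f]
  · have := hasLead_shift_monomial v f (coeff f q)
    by_contra hne
    have hs : f ∈ (shift v (monomial f (coeff f q)) -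
        monomial f (coeff f q * v.2.2 ^ f 2)).support := by
      rw [mem_support_iff, coeff_sub, coeff_monomial, if_pos rfl, hfm.2]
      exact sub_ne_zero.2 hne
    exact lt_irrefl _ (this f hs).1
  · intro k hk hkf
    by_contra hne
    have := hasLead_shift_monomial v k (coeff k q)
    have hs : f ∈ (shift v (monomial k (coeff k q)) -
        monomial k (coeff k q * v.2.2 ^ k 2)).support := by
      rw [mem_support_iff, coeff_sub, coeff_monomial, if_neg hkf, sub_zero]
      exact hne
    have h1 := this f hs
    have h2 : k ∈ q.support.filter fun k => k 2 = h 2 :=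
      Finset.mem_filter.2 ⟨hk, h1.2 ▸ hfm.2⟩
    exact absurd (hf.le_of_ge h2 h1.1.le) (not_le_of_gt h1.1)
  · intro hn; exact absurd hfm.1 hn

lemma shift_neg_shift {v : ℂ × ℂ × ℂ} (hv : v.2.2 ≠ 0) (p : MvPolynomial (Fin 3) ℂ) :
    shift (-v.1, -v.2.1, v.2.2⁻¹) (shift v p) = p := by
  rw [shift_shift]; simp [hv, shift_id]

lemma shift_shift_neg {v : ℂ × ℂ × ℂ} (hv : v.2.2 ≠ 0) (p : MvPolynomial (Fin 3) ℂ) :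
    shift v (shift (-v.1, -v.2.1, v.2.2⁻¹) p) = p := by
  rw [shift_shift]; simp [hv, shift_id]

/-- `shift` as a multiplicative equivalence. -/
noncomputable def shiftEquiv (v : ℂ × ℂ × ℂ) (hv : v.2.2 ≠ 0) :
    MvPolynomial (Fin 3) ℂ ≃* MvPolynomial (Fin 3) ℂ where
  toFun := shift v
  invFun := shift (-v.1, -v.2.1, v.2.2⁻¹)
  left_inv := shift_neg_shift hv
  right_inv := shift_shift_neg hv
  map_mul' := map_mul _

lemma irreducible_shift {v : ℂ × ℂ × ℂ} (hv : v.2.2 ≠ 0) {q : MvPolynomial (Fin 3) ℂ}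
    (hq : Irreducible q) : Irreducible (shift v q) :=
  (MulEquiv.irreducible_iff (shiftEquiv v hv)).2 hq

lemma degreeOf_shift {v : ℂ × ℂ × ℂ} (hv : v.2.2 ≠ 0) (p : MvPolynomial (Fin 3) ℂ)
    (j : Fin 3) : degreeOf j (shift v p) = degreeOf j p := by
  refine le_antisymm (degreeOf_shift_le v p j) ?_
  conv_lhs => rw [← shift_neg_shift hv p]
  exact degreeOf_shift_le _ _ _

lemma shift_ne_zero {v : ℂ × ℂ × ℂ} (hv : v.2.2 ≠ 0) {p : MvPolynomial (Fin 3) ℂ}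
    (hp : p ≠ 0) : shift v p ≠ 0 := fun h => hp <| by
  rw [← shift_neg_shift hv p, h, map_zero]

lemma degreeOf_le_of_dvd {p q : MvPolynomial (Fin 3) ℂ} (hq : q ≠ 0) (h : p ∣ q) (j : Fin 3) :
    degreeOf j p ≤ degreeOf j q := by
  obtain ⟨r, rfl⟩ := h
  rw [degreeOf_mul_eq (left_ne_zero_of_mul hq) (right_ne_zero_of_mul hq)]
  exact Nat.le_add_right _ _

/-- If the shifts of an irreducible `q` by the elements of a finite set are pairwise
non-associated divisors of `p`, then this set is small. -/
lemma card_mul_degreeOf_le {ι : Type*} (s : Finset ι) (v : ι → ℂ × ℂ × ℂ)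
    (hv : ∀ i, (v i).2.2 ≠ 0) {p q : MvPolynomial (Fin 3) ℂ} (hp : p ≠ 0) (hq : Irreducible q)
    (hdvd : ∀ i ∈ s, shift (v i) q ∣ p)
    (hna : ∀ i ∈ s, ∀ j ∈ s, i ≠ j → ¬ Associated (shift (v i) q) (shift (v j) q))
    (j : Fin 3) : s.card * degreeOf j q ≤ degreeOf j p := by
  have hpair : (s : Set ι).Pairwise (Function.onFun IsRelPrime fun i => shift (v i) q) := by
    intro i hi j hj hij
    rw [Function.onFun, (irreducible_shift (hv i) hq).isRelPrime_iff_not_dvd]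
    intro hd
    exact hna i hi j hj hij
      ((irreducible_shift (hv i) hq).associated_of_dvd (irreducible_shift (hv j) hq) hd)
  have h : ∏ i ∈ s, shift (v i) q ∣ p := by
    apply Finset.prod_dvd_of_isRelPrime hpair
    intro i hi
    exact hdvd i hi
  have := degreeOf_le_of_dvd hp h j
  rw [degreeOf_prod_eq _ _ (fun i _ => shift_ne_zero (hv i) hq.ne_zero)] at this
  simpa [degreeOf_shift (hv _)] using this

lemma exists_eq_smul_of_associated {p q : MvPolynomial (Fin 3) ℂ} (h : Associated p q) :
    ∃ c : ℂ, c ≠ 0 ∧ p = C c * q := by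
  obtain ⟨u, rfl⟩ := h.symm
  obtain ⟨c, hc, hu⟩ := MvPolynomial.isUnit_iff_eq_C_of_isReduced.1 u.isUnit
  exact ⟨c, hc.ne_zero, by rw [hu, mul_comm]⟩

lemma X_dvd_of_forall_support {q : MvPolynomial (Fin 3) ℂ} (h : ∀ f ∈ q.support, f 2 ≠ 0) :
    X 2 ∣ q := by
  rw [q.as_sum]
  refine Finset.dvd_sum fun f hf => ?_
  rw [X_dvd_monomial]
  exact Or.inr (h f hf)

/-- Two associated shifts of a polynomial not divisible by `g`. -/
lemma pow_eq_pow_of_associated_shift {q : MvPolynomial (Fin 3) ℂ} (hX : ¬ X 2 ∣ q)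
    {v w : ℂ × ℂ × ℂ} (h : Associated (shift v q) (shift w q)) :
    shift v q = shift w q ∧ ∀ f ∈ q.support, v.2.2 ^ f 2 = w.2.2 ^ f 2 := by
  obtain ⟨c, -, hc⟩ := exists_eq_smul_of_associated h
  have key : ∀ f ∈ q.support, v.2.2 ^ f 2 = c * w.2.2 ^ f 2 := by
    intro f hf
    obtain ⟨k, hk, hkv⟩ := exists_coeff_shift hf
    have := congrArg (coeff k) hc
    rw [coeff_C_mul, hkv, hkv, mul_left_comm] at this
    exact mul_left_cancel₀ hk this
  obtain ⟨f, hf, hf2⟩ : ∃ f ∈ q.support, f 2 = 0 := by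
    by_contra! hcon
    exact hX (X_dvd_of_forall_support hcon)
  have h1 := key f hf
  rw [hf2, pow_zero, pow_zero, mul_one] at h1
  subst h1
  exact ⟨by rw [hc, C_1, one_mul], fun f hf => by rw [key f hf, one_mul]⟩

/-- A polynomial in `x, y` invariant under two linearly independent translations is constant. -/
lemma degreeOf_eq_zero_of_shift_eq {q : MvPolynomial (Fin 3) ℂ} (hq : degreeOf 2 q = 0)
    {v w : ℂ × ℂ × ℂ} (hv : shift v q = q) (hw : shift w q = q)
    (hdet : v.1 * w.2.1 - v.2.1 * w.1 ≠ 0) : ∀ j, degreeOf j q = 0 := by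
  set F : MvPolynomial (Fin 3) ℂ →ₐ[ℂ] MvPolynomial (Fin 3) ℂ :=
    aeval ![C v.1 * X 0 + C w.1 * X 1, C v.2.1 * X 0 + C w.2.1 * X 1, 0] with hF
  have h2 : ∀ x y g g' : ℂ, eval ![x, y, g] q = eval ![x, y, g'] q := by
    intro x y g g'
    rw [eval_eq', eval_eq']
    refine Finset.sum_congr rfl fun d hd => ?_
    have : d 2 = 0 := by
      have := (degreeOf_le_iff (n := (2 : Fin 3)) (f := q) (d := 0)).1 hq.le d hd
      omega
    simp [Fin.prod_univ_three, this]
  have hFe : ∀ x y g, eval ![x, y, g] (F q) =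
      eval ![v.1 * x + w.1 * y, v.2.1 * x + w.2.1 * y, 0] q := by
    intro x y g
    have : (aeval ![x, y, g]).comp F =
        (aeval ![v.1 * x + w.1 * y, v.2.1 * x + w.2.1 * y, 0] :
          MvPolynomial (Fin 3) ℂ →ₐ[ℂ] ℂ) := by
      apply MvPolynomial.algHom_ext
      intro i
      fin_cases i <;> simp [hF]
    simpa [MvPolynomial.coe_aeval_eq_eval] using DFunLike.congr_fun this q
  have step : ∀ v : ℂ × ℂ × ℂ, shift v q = q → ∀ x y : ℂ,
      eval ![x + v.1, y + v.2.1, 0] q = eval ![x, y, 0] q := by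
    intro v hv x y
    conv_rhs => rw [← hv, eval_shift]
    exact h2 _ _ _ _
  have hnat : ∀ m n : ℕ, eval ![v.1 * m + w.1 * n, v.2.1 * m + w.2.1 * n, 0] q =
      eval ![0, 0, 0] q := by
    intro m n
    induction m with
    | zero =>
      induction n with
      | zero => simp
      | succ n ih =>
        rw [← ih, ← step w hw (v.1 * (0 : ℕ) + w.1 * n)]
        push_cast
        ring_nf
    | succ m ih =>
      rw [← ih, ← step v hv (v.1 * m + w.1 * n)]
      push_cast
      ring_nf
  have hconst : F q = C (eval ![0, 0, 0] q) := by
    apply MvPolynomial.funext_set (fun _ => Set.range ((↑) : ℕ → ℂ))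
      (fun _ => Set.infinite_range_of_injective Nat.cast_injective)
    intro z hz
    have hz' : ∀ i, ∃ n : ℕ, (n : ℂ) = z i := fun i => by
      simpa using hz i (Set.mem_univ i)
    obtain ⟨m, hm⟩ := hz' 0
    obtain ⟨n, hn⟩ := hz' 1
    have e : z = ![z 0, z 1, z 2] := by ext i; fin_cases i <;> rfl
    rw [e, hFe, ← hm, ← hn, hnat, eval_C]
  have hall : q = C (eval ![0, 0, 0] q) := by
    apply MvPolynomial.funext
    intro z
    have e : z = ![z 0, z 1, z 2] := by ext i; fin_cases i <;> rfl
    set D := v.1 * w.2.1 - v.2.1 * w.1 with hD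
    have := hFe ((z 0 * w.2.1 - w.1 * z 1) / D) ((v.1 * z 1 - v.2.1 * z 0) / D) 0
    rw [hconst, eval_C] at this
    rw [eval_C, this, e]
    rw [h2 (z 0) (z 1) (z 2) 0]
    have a1 : v.1 * ((z 0 * w.2.1 - w.1 * z 1) / D) + w.1 * ((v.1 * z 1 - v.2.1 * z 0) / D)
        = z 0 := by field_simp; rw [hD]; ring
    have a2 : v.2.1 * ((z 0 * w.2.1 - w.1 * z 1) / D) + w.2.1 * ((v.1 * z 1 - v.2.1 * z 0) / D)
        = z 1 := by field_simp; rw [hD]; ring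
    simp [a1, a2]
  intro j
  rw [hall, degreeOf_C]

/-- The translation vector attached to `(r, s, t)`. -/
noncomputable def vec (b k : ℤ) (A u : ℂ) (i : ℤ × ℤ × ℤ) : ℂ × ℂ × ℂ :=
  (((i.2.1 - b * i.1 : ℤ) : ℂ), ((i.2.2 - k * i.1 : ℤ) : ℂ), A ^ i.1 * u ^ i.2.1)

lemma vec_ne_zero {b k : ℤ} {A u : ℂ} (hA : A ≠ 0) (hu : u ≠ 0) (i : ℤ × ℤ × ℤ) :
    (vec b k A u i).2.2 ≠ 0 := mul_ne_zero (zpow_ne_zero _ hA) (zpow_ne_zero _ hu)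

lemma shift_vec_shift_vec {b k : ℤ} {A u : ℂ} (hA : A ≠ 0) (hu : u ≠ 0) (i j : ℤ × ℤ × ℤ)
    (p : MvPolynomial (Fin 3) ℂ) :
    shift (vec b k A u i) (shift (vec b k A u j) p) = shift (vec b k A u (i + j)) p := by
  rw [shift_shift]
  congr 2
  simp only [vec, Prod.fst_add, Prod.snd_add, zpow_add₀ hA, zpow_add₀ hu, Prod.mk.injEq]
  push_cast
  refine ⟨by ring, by ring, by ring⟩

lemma shift_vec_zero {b k : ℤ} {A u : ℂ} (p : MvPolynomial (Fin 3) ℂ) :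
    shift (vec b k A u 0) p = p := by
  have : vec b k A u 0 = (0, 0, 1) := by simp [vec]
  rw [this, shift_id]

/-- The evaluation point attached to `(r, s, t)`. -/
noncomputable def point (b k : ℤ) (A u : ℂ) (i : ℤ × ℤ × ℤ) : Fin 3 → ℂ :=
  ![((i.2.1 - b * i.1 : ℤ) : ℂ), ((i.2.2 - k * i.1 : ℤ) : ℂ), A ^ i.1 * u ^ i.2.1]

lemma eval_point_shift {b k : ℤ} {A u : ℂ} (hA : A ≠ 0) (hu : u ≠ 0) (i j : ℤ × ℤ × ℤ)
    (p : MvPolynomial (Fin 3) ℂ) :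
    eval (point b k A u i) (shift (vec b k A u j) p) = eval (point b k A u (i + j)) p := by
  rw [point, eval_shift]
  congr 2
  ext n
  fin_cases n <;> simp [point, vec, zpow_add₀ hA, zpow_add₀ hu] <;> ring

/-- An irreducible polynomial other than `g` does not divide all shifts of `P`. -/
lemma not_forall_dvd_shift {b k : ℤ} {A u : ℂ} (hA : A ≠ 0) (hu : u ≠ 0)
    (hroot : ∀ j : ℕ, 0 < j → u ^ j ≠ 1) {K L R S T G : ℕ} (hLS : L < S) (hGS : G ≤ S)
    (hR : 0 < R) (hT : 0 < T)
    (hGT : K ≤ G * T) (hRS : K ≤ R * S) (hRT : K ≤ R * T)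
    (hD : ∀ s t : ℤ, |s| < G → t ≠ 0 → |t| * S ≤ |t * b - s * k|) (hk : (T : ℤ) ≤ |k|)
    {P q : MvPolynomial (Fin 3) ℂ} (hP : P ≠ 0) (hP0 : degreeOf 0 P < K)
    (hP1 : degreeOf 1 P < K) (hP2 : degreeOf 2 P ≤ L) (hq : Irreducible q) (hX : ¬ X 2 ∣ q)
    (hdvd : ∀ r s t : ℕ, r < R → s < S → t < T → q ∣ shift (vec b k A u (r, s, t)) P) :
    False := by
  have hv := vec_ne_zero (b := b) (k := k) hA hu
  set c : ℕ × ℕ × ℕ → ℤ × ℤ × ℤ := fun i => (-i.1, -i.2.1, -i.2.2) with hc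
  have hdvd' : ∀ i : ℕ × ℕ × ℕ, i.1 < R → i.2.1 < S → i.2.2 < T →
      shift (vec b k A u (c i)) q ∣ P := by
    intro i h1 h2 h3
    have := map_dvd (shift (vec b k A u (c i))) (hdvd _ _ _ h1 h2 h3)
    rw [shift_vec_shift_vec hA hu] at this
    have e : c i + ((i.1 : ℤ), (i.2.1 : ℤ), (i.2.2 : ℤ)) = 0 := by simp [hc]
    rwa [e, shift_vec_zero] at this
  have hcard := fun (s : Finset (ℕ × ℕ × ℕ))
      (hs : ∀ i ∈ s, i.1 < R ∧ i.2.1 < S ∧ i.2.2 < T) =>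
    card_mul_degreeOf_le s (fun i => vec b k A u (c i)) (fun i => hv _) hP hq
      (fun i hi => hdvd' i (hs i hi).1 (hs i hi).2.1 (hs i hi).2.2)
  rcases Nat.eq_zero_or_pos (degreeOf 2 q) with h2 | h2
  · obtain ⟨j, hj, hjK⟩ : ∃ j, 0 < degreeOf j q ∧ degreeOf j P < K := by
      by_contra! hcon
      have h0 : ∀ j, degreeOf j q = 0 := by
        intro j
        fin_cases j
        · by_contra h; exact absurd (hcon 0 (Nat.pos_of_ne_zero h)) (not_le_of_gt hP0)
        · by_contra h; exact absurd (hcon 1 (Nat.pos_of_ne_zero h)) (not_le_of_gt hP1)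
        · exact h2
      have hqC : q = C (coeff 0 q) := by
        ext f
        rw [coeff_C]
        split_ifs with hf
        · rw [hf]
        · by_contra hne
          apply hf
          ext i
          have := (degreeOf_le_iff (n := i) (f := q) (d := 0)).1 (h0 i).le f
            (mem_support_iff.2 hne)
          simp; omega
      apply hq.not_isUnit
      rw [hqC]
      refine (IsUnit.mk0 _ fun h => hq.ne_zero ?_).map C
      rw [hqC, h, C_0]
    have coll : ∀ s : Finset (ℕ × ℕ × ℕ), (∀ i ∈ s, i.1 < R ∧ i.2.1 < S ∧ i.2.2 < T) →
        K ≤ s.card → ∃ i ∈ s, ∃ i' ∈ s, i ≠ i' ∧ shift (vec b k A u (c i - c i')) q = q := by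
      intro s hs hK
      by_contra! hcon
      have := hcard s hs (fun i hi i' hi' hne hass => by
        have he := (pow_eq_pow_of_associated_shift hX hass).1
        apply hcon i hi i' hi' hne
        have := congrArg (shift (vec b k A u (-c i'))) he
        rw [shift_vec_shift_vec hA hu, shift_vec_shift_vec hA hu, neg_add_cancel,
          shift_vec_zero] at this
        rwa [neg_add_eq_sub] at this) j
      have h3 : s.card * 1 ≤ s.card * degreeOf j q := Nat.mul_le_mul_left _ hj
      omega
    have dep : ∀ i i' : ℤ × ℤ × ℤ, shift (vec b k A u i) q = q → shift (vec b k A u i') q = q →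
        (i.2.1 - b * i.1) * (i'.2.2 - k * i'.1) - (i.2.2 - k * i.1) * (i'.2.1 - b * i'.1) = 0 := by
      intro i i' hi hi'
      by_contra hne
      refine hj.ne' (degreeOf_eq_zero_of_shift_eq h2 hi hi' ?_ j)
      simp only [vec]
      exact_mod_cast hne
    obtain ⟨i, hi, i', hi', hne, hst⟩ := coll ({0} ×ˢ (Finset.range G ×ˢ Finset.range T))
      (by
        rintro ⟨r, s, t⟩ h
        simp only [Finset.mem_product, Finset.mem_singleton, Finset.mem_range] at h ⊢
        omega) (by simpa using hGT)
    obtain ⟨r, s, t⟩ := i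
    obtain ⟨r', s', t'⟩ := i'
    simp only [Finset.mem_product, Finset.mem_singleton, Finset.mem_range] at hi hi'
    simp only [hc, Prod.mk_sub_mk] at hst
    obtain ⟨rfl, hs, ht⟩ := hi
    obtain ⟨rfl, hs', ht'⟩ := hi'
    by_cases htt : t = t'
    · have hss : s ≠ s' := fun h => hne (by rw [h, htt])
      obtain ⟨j, hj, j', hj', hne', hst'⟩ := coll (Finset.range R ×ˢ ({0} ×ˢ Finset.range T))
        (by
          rintro ⟨r, s, t⟩ h
          simp only [Finset.mem_product, Finset.mem_singleton, Finset.mem_range] at h ⊢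
          omega) (by simpa using hRT)
      obtain ⟨r1, s1, t1⟩ := j
      obtain ⟨r1', s1', t1'⟩ := j'
      simp only [Finset.mem_product, Finset.mem_singleton, Finset.mem_range] at hj hj'
      simp only [hc, Prod.mk_sub_mk] at hst'
      obtain ⟨hr1, rfl, ht1⟩ := hj
      obtain ⟨hr1', rfl, ht1'⟩ := hj'
      have := dep _ _ hst hst'
      subst htt
      have h0 : ((s' : ℤ) - s) * ((t1' : ℤ) - t1 - k * (r1' - r1)) = 0 := by
        linear_combination this
      have h1 : (t1' : ℤ) - t1 = k * (r1' - r1) := by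
        rcases mul_eq_zero.1 h0 with h | h
        · omega
        · linarith
      have hrr : r1' = r1 := by
        by_contra hr
        have h3 : 1 ≤ |(r1' : ℤ) - r1| := Int.one_le_abs (by omega)
        have h4 : |(t1' : ℤ) - t1| < T := by rw [abs_lt]; omega
        rw [h1, abs_mul] at h4
        nlinarith [abs_nonneg k]
      subst hrr
      apply hne'
      simp only [sub_self, mul_zero] at h1
      simp only [Prod.mk.injEq, true_and]
      omega
    · obtain ⟨j, hj, j', hj', hne', hst'⟩ := coll (Finset.range R ×ˢ (Finset.range S ×ˢ {0}))
        (by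
          rintro ⟨r, s, t⟩ h
          simp only [Finset.mem_product, Finset.mem_singleton, Finset.mem_range] at h ⊢
          omega) (by simpa using hRS)
      obtain ⟨r1, s1, t1⟩ := j
      obtain ⟨r1', s1', t1'⟩ := j'
      simp only [Finset.mem_product, Finset.mem_singleton, Finset.mem_range] at hj hj'
      simp only [hc, Prod.mk_sub_mk] at hst'
      obtain ⟨hr1, hs1, rfl⟩ := hj
      obtain ⟨hr1', hs1', rfl⟩ := hj'
      have := dep _ _ hst hst'
      have h1 : ((t' : ℤ) - t) * (s1' - s1) =
          (r1' - r1) * (((t' : ℤ) - t) * b - ((s' : ℤ) - s) * k) := by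
        linear_combination -this
      have hDD := hD ((s' : ℤ) - s) ((t' : ℤ) - t) (by rw [abs_lt]; omega) (by omega)
      have hrr : r1' = r1 := by
        by_contra hr
        have h3 : 1 ≤ |(r1' : ℤ) - r1| := Int.one_le_abs (by omega)
        have h4 : |(s1' : ℤ) - s1| < S := by rw [abs_lt]; omega
        have h5 : 1 ≤ |(t' : ℤ) - t| := Int.one_le_abs (by omega)
        have h6 := congrArg abs h1
        rw [abs_mul, abs_mul] at h6
        nlinarith [abs_nonneg (((t' : ℤ) - t) * b - ((s' : ℤ) - s) * k)]
      subst hrr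
      rw [sub_self, zero_mul] at h1
      apply hne'
      simp only [Prod.mk.injEq, true_and, and_true]
      rcases mul_eq_zero.1 h1 with h | h <;> omega
  · obtain ⟨f, hf, hf2⟩ : ∃ f ∈ q.support, f 2 ≠ 0 := by
      by_contra! hcon
      have : degreeOf 2 q ≤ 0 := degreeOf_le_iff.2 fun f hf => (hcon f hf).le
      omega
    have := hcard ({0} ×ˢ (Finset.range S ×ˢ {0}))
      (by
        rintro ⟨r, s, t⟩ h
        simp only [Finset.mem_product, Finset.mem_singleton, Finset.mem_range] at h ⊢
        omega)
      (by
        rintro ⟨r, s, t⟩ h ⟨r', s', t'⟩ h' hne hass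
        simp only [Finset.mem_product, Finset.mem_singleton, Finset.mem_range] at h h'
        obtain ⟨rfl, hs, rfl⟩ := h
        obtain ⟨rfl, hs', rfl⟩ := h'
        have he := (pow_eq_pow_of_associated_shift hX hass).2 f hf
        simp only [vec, hc, Nat.cast_zero, neg_zero, zpow_zero, one_mul] at he
        have hinj : ∀ m n : ℕ, m < n → (u ^ (-(m : ℤ))) ^ f 2 ≠ (u ^ (-(n : ℤ))) ^ f 2 := by
          intro m n hmn h
          apply hroot ((n - m) * f 2) (Nat.mul_pos (by omega) (Nat.pos_of_ne_zero hf2))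
          rw [zpow_neg, zpow_neg, zpow_natCast, zpow_natCast, inv_pow, inv_pow, inv_inj,
            ← pow_mul, ← pow_mul] at h
          have e : n * f 2 = m * f 2 + (n - m) * f 2 := by
            rw [← add_mul]; congr 1; omega
          rw [e, pow_add] at h
          have h0 : u ^ (m * f 2) ≠ 0 := pow_ne_zero _ hu
          field_simp at h
          exact h.symm
        rcases lt_trichotomy s s' with h | h | h
        · exact hinj _ _ h he
        · exact hne (by rw [h])
        · exact hinj _ _ h he.symm) 2
    simp only [Finset.card_product, Finset.card_singleton, Finset.card_range, one_mul,
      mul_one] at this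
    nlinarith

lemma exists_isRelPrime_sum {ι : Type*} [Fintype ι] {P : MvPolynomial (Fin 3) ℂ} (hP : P ≠ 0)
    (Q : ι → MvPolynomial (Fin 3) ℂ)
    (h : ∀ q, Irreducible q → q ∣ P → ∃ i, ¬ q ∣ Q i) :
    ∃ c : ι → ℂ, IsRelPrime P (∑ i, c i • Q i) := by
  classical
  set f : (ι → ℂ) →ₗ[ℂ] MvPolynomial (Fin 3) ℂ := Fintype.linearCombination ℂ Q with hf
  let W : MvPolynomial (Fin 3) ℂ → Subspace ℂ (ι → ℂ) := fun q =>
    ((Ideal.span {q}).restrictScalars ℂ).comap f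
  have hW : ∀ q c, c ∈ W q ↔ q ∣ f c := fun q c => by
    simp [W, Ideal.mem_span_singleton]
  let s : Finset (Subspace ℂ (ι → ℂ)) :=
    (UniqueFactorizationMonoid.factors P).toFinset.image W
  have hs : ⊤ ∉ s := by
    intro hmem
    obtain ⟨q, hq, hqt⟩ := Finset.mem_image.1 hmem
    rw [Multiset.mem_toFinset] at hq
    obtain ⟨i, hi⟩ := h q (UniqueFactorizationMonoid.irreducible_of_factor q hq)
      (UniqueFactorizationMonoid.dvd_of_mem_factors hq)
    apply hi
    have := (hW q (Pi.single i 1)).1 (by rw [hqt]; trivial)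
    simpa [hf, Fintype.linearCombination_apply_single] using this
  have hne := Subspace.biUnion_ne_univ_of_top_notMem hs
  obtain ⟨c, hc⟩ := (Set.ne_univ_iff_exists_notMem _).1 hne
  refine ⟨c, WfDvdMonoid.isRelPrime_of_no_irreducible_factors (fun h0 => hP h0.1) ?_⟩
  intro q hq hqP hqc
  obtain ⟨q', hq', hass⟩ := UniqueFactorizationMonoid.exists_mem_factors_of_dvd hP hq hqP
  apply hc
  simp only [Set.mem_iUnion]
  refine ⟨W q', Finset.mem_image_of_mem _ (Multiset.mem_toFinset.2 hq'), ?_⟩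
  rw [SetLike.mem_coe, hW]
  exact hass.dvd_iff_dvd_left.1 (by simpa [hf, Fintype.linearCombination_apply] using hqc)

lemma coeff_prod_sum_of_natDegree_le {ι : Type*} (s : Finset ι) (g : ι → Polynomial ℂ) (d : ι → ℕ)
    (h : ∀ i ∈ s, (g i).natDegree ≤ d i) :
    (∏ i ∈ s, g i).coeff (∑ i ∈ s, d i) = ∏ i ∈ s, (g i).coeff (d i) := by
  classical
  induction s using Finset.induction_on with
  | empty => simp
  | insert a s ha ih =>
    rw [Finset.prod_insert ha, Finset.sum_insert ha, Finset.prod_insert ha,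
      Polynomial.coeff_mul_add_eq_of_natDegree_le (h a (Finset.mem_insert_self a s)), ih]
    · exact fun i hi => h i (Finset.mem_insert_of_mem hi)
    · exact (Polynomial.natDegree_prod_le _ _).trans
        (Finset.sum_le_sum fun i hi => h i (Finset.mem_insert_of_mem hi))

lemma natDegree_comp_X_add_C_le (f : Polynomial ℂ) (a : ℂ) :
    (f.comp (Polynomial.X + Polynomial.C a)).natDegree ≤ f.natDegree := by
  simp [Polynomial.natDegree_comp]

lemma coeff_comp_X_add_C (f : Polynomial ℂ) (a : ℂ) :
    (f.comp (Polynomial.X + Polynomial.C a)).coeff f.natDegree = f.leadingCoeff := by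
  have h : (f.comp (Polynomial.X + Polynomial.C a)).natDegree = f.natDegree := by
    simp [Polynomial.natDegree_comp]
  rw [← h]
  change Polynomial.leadingCoeff _ = _
  rw [Polynomial.leadingCoeff_comp (by simp)]
  simp

lemma forall_eq_zero_of_exponential_polynomial {l m b R S : ℕ} {A u : ℂ} (hA : A ≠ 0) (hu : u ≠ 0)
    (hroot : ∀ j : ℕ, 0 < j → u ^ j ≠ 1) (hSb : S ≤ b) (hRS : m * (l + 1) < R * S)
    (f : Fin (l + 1) → Polynomial ℂ) (hf : ∀ i, (f i).natDegree ≤ m)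
    (h0 : ∀ r s : ℕ, r < R → s < S + l →
      ∑ i, (f i).eval ((s : ℂ) - b * r) * (A ^ r * u ^ s) ^ (i : ℕ) = 0) (i : Fin (l + 1)) :
    f i = 0 := by
  classical
  let ι := {i : Fin (l + 1) // f i ≠ 0}
  set n := Fintype.card ι with hn
  let e : Fin n ≃ ι := (Fintype.equivFin ι).symm
  have hnl : n ≤ l + 1 := by
    exact (Fintype.card_subtype_le (fun i : Fin (l + 1) => f i ≠ 0)).trans (by simp)
  let M : Matrix (Fin n) (Fin n) (Polynomial ℂ) := fun j i =>
    Polynomial.C (u ^ ((e i : Fin (l + 1)) * j : ℕ)) *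
      (f (e i)).comp (Polynomial.X + Polynomial.C (j : ℂ))
  have hMdeg : ∀ j i, (M j i).natDegree ≤ (f (e i)).natDegree := fun j i =>
    (Polynomial.natDegree_C_mul_le _ _).trans (natDegree_comp_X_add_C_le _ _)
  by_contra hi
  have hnpos : 0 < n := Fintype.card_pos_iff.2 ⟨⟨i, hi⟩⟩
  have hcoeff : M.det.coeff (∑ i, (f (e i)).natDegree) =
      (∏ i, (f (e i)).leadingCoeff) * (Matrix.vandermonde fun i => u ^ ((e i : Fin (l + 1)) : ℕ)).det := by
    rw [Matrix.det_apply, ← Matrix.det_transpose (Matrix.vandermonde _), Matrix.det_apply,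
      Polynomial.finsetSum_coeff, Finset.mul_sum]
    refine Finset.sum_congr rfl fun σ _ => ?_
    rw [Polynomial.coeff_smul, coeff_prod_sum_of_natDegree_le _ _ _ fun i _ => hMdeg _ _,
      mul_smul_comm, ← Finset.prod_mul_distrib]
    congr 1
    refine Finset.prod_congr rfl fun i _ => ?_
    simp only [M, Polynomial.coeff_C_mul, coeff_comp_X_add_C, Matrix.transpose_apply,
      Matrix.vandermonde_apply]
    rw [← pow_mul, mul_comm]
  have hne : M.det ≠ 0 := by
    intro h
    rw [h, Polynomial.coeff_zero] at hcoeff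
    rcases mul_eq_zero.1 hcoeff.symm with h | h
    · obtain ⟨i, -, hi⟩ := Finset.prod_eq_zero_iff.1 h
      exact (e i).2 (Polynomial.leadingCoeff_eq_zero.1 hi)
    · refine Matrix.det_vandermonde_ne_zero_iff.2 ?_ h
      intro i j hij
      apply e.injective
      apply Subtype.ext
      apply Fin.ext
      have key : ∀ p q : ℕ, p < q → u ^ p ≠ u ^ q := by
        intro p q hpq h
        apply hroot (q - p) (by omega)
        have h2 : u ^ p * u ^ (q - p) = u ^ p * 1 := by
          rw [← pow_add, mul_one, h]; congr 1; omega
        exact mul_left_cancel₀ (pow_ne_zero _ hu) h2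
      rcases lt_trichotomy (((e i : Fin (l + 1)) : ℕ)) (((e j : Fin (l + 1)) : ℕ)) with h | h | h
      · exact absurd hij (key _ _ h)
      · exact h
      · exact absurd hij.symm (key _ _ h)
  have hdeg : M.det.natDegree ≤ m * (l + 1) := by
    rw [Matrix.det_apply]
    refine Polynomial.natDegree_sum_le_of_forall_le _ _ fun σ _ => ?_
    refine (Polynomial.natDegree_smul_le _ _).trans ?_
    refine (Polynomial.natDegree_prod_le _ _).trans ?_
    refine (Finset.sum_le_card_nsmul _ _ m fun i _ => (hMdeg _ _).trans (hf _)).trans ?_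
    simp only [Finset.card_univ, Fintype.card_fin, smul_eq_mul]
    nlinarith
  let pts : Finset ℂ := (Finset.range R ×ˢ Finset.range S).image fun p => (p.2 : ℂ) - b * p.1
  have hpts : pts.card = R * S := by
    rw [Finset.card_image_of_injOn, Finset.card_product, Finset.card_range, Finset.card_range]
    rintro ⟨r, s⟩ h1 ⟨r', s'⟩ h2 heq
    simp only [Finset.coe_product, Finset.coe_range, Set.mem_prod, Set.mem_Iio] at h1 h2
    have heq' : (s : ℤ) - b * r = s' - b * r' := by
      have : (((s : ℤ) - b * r : ℤ) : ℂ) = ((s' - b * r' : ℤ) : ℂ) := by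
        push_cast; exact heq
      exact_mod_cast this
    have hr : r = r' := by
      by_contra hne
      rcases Nat.lt_or_gt_of_ne hne with h | h
      · have : (b : ℤ) * (r + 1) ≤ b * r' := by gcongr; exact_mod_cast h
        nlinarith
      · have : (b : ℤ) * (r' + 1) ≤ b * r := by gcongr; exact_mod_cast h
        nlinarith
    subst hr
    have : s = s' := by omega
    rw [this]
  refine hne (Polynomial.eq_zero_of_natDegree_lt_card_of_eval_eq_zero' M.det pts ?_
    (by rw [hpts]; omega))
  intro x hx
  obtain ⟨⟨r, s⟩, hrs, rfl⟩ := Finset.mem_image.1 hx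
  simp only [Finset.mem_product, Finset.mem_range] at hrs
  rw [← Polynomial.coe_evalRingHom, RingHom.map_det]
  rw [← Matrix.exists_mulVec_eq_zero_iff]
  refine ⟨fun i => (A ^ r * u ^ s) ^ ((e i : Fin (l + 1)) : ℕ), ?_, ?_⟩
  · intro h
    exact pow_ne_zero _ (mul_ne_zero (pow_ne_zero _ hA) (pow_ne_zero _ hu)) (congrFun h ⟨0, hnpos⟩)
  · funext j
    have hj := h0 r (s + j) hrs.1 (by have := j.2; omega)
    rw [← Finset.sum_subset (Finset.subset_univ (Finset.univ.filter fun i => f i ≠ 0))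
      (by intro i _ hi; simp at hi; simp [hi]), ← Finset.sum_subtype_eq_sum_filter,
      Finset.subtype_univ, ← e.sum_comp] at hj
    rw [Matrix.mulVec, dotProduct, Pi.zero_apply, ← hj]
    refine Finset.sum_congr rfl fun i _ => ?_
    rw [RingHom.mapMatrix_apply, Matrix.map_apply]
    simp only [M, Polynomial.coe_evalRingHom, Polynomial.eval_mul, Polynomial.eval_C, Polynomial.eval_comp,
      Polynomial.eval_add,
      Polynomial.eval_X]
    have : (s : ℂ) - b * r + j = ((s + j : ℕ) : ℂ) - b * r := by push_cast; ring
    rw [this, pow_add, ← mul_assoc (A ^ r), mul_pow (A ^ r * u ^ s), ← pow_mul u j, mul_comm (j : ℕ)]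
    ring

lemma eval_three (Q : MvPolynomial (Fin 3) ℂ) (x y g : ℂ) :
    eval ![x, y, g] Q = ∑ h ∈ Q.support, coeff h Q * (x ^ h 0 * y ^ h 1 * g ^ h 2) := by
  rw [eval_eq']
  simp [Fin.prod_univ_three]

lemma eq_zero_of_forall_eval_point {l m b R S T : ℕ} {k : ℤ} {A u : ℂ} (hA : A ≠ 0) (hu : u ≠ 0)
    (hroot : ∀ j : ℕ, 0 < j → u ^ j ≠ 1) (hSb : S ≤ b) (hRS : m * (l + 1) < R * S)
    {Q : MvPolynomial (Fin 3) ℂ} (h0 : degreeOf 0 Q ≤ m) (h1 : degreeOf 1 Q < T)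
    (h2 : degreeOf 2 Q ≤ l)
    (hQ : ∀ r s t : ℕ, r < R → s < S + l → t < T → eval (point b k A u (r, s, t)) Q = 0) :
    Q = 0 := by
  classical
  have hy : ∀ (r s : ℕ) (y : ℂ), r < R → s < S + l →
      eval ![(s : ℂ) - b * r, y, A ^ r * u ^ s] Q = 0 := by
    intro r s y hr hs
    set x : ℂ := (s : ℂ) - b * r
    set g : ℂ := A ^ r * u ^ s
    let F : Polynomial ℂ := ∑ h ∈ Q.support, Polynomial.monomial (h 1)
      (coeff h Q * (x ^ h 0 * g ^ h 2))
    have hF : ∀ y, F.eval y = eval ![x, y, g] Q := by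
      intro y
      rw [eval_three, Polynomial.eval_finsetSum]
      refine Finset.sum_congr rfl fun h _ => ?_
      rw [Polynomial.eval_monomial]; ring
    rw [← hF]
    suffices F = 0 by simp [this]
    have hinj : Function.Injective fun t : ℕ => (t : ℂ) - k * r := by
      intro t t' h
      simpa using h
    refine Polynomial.eq_zero_of_natDegree_lt_card_of_eval_eq_zero' F
      ((Finset.range T).image fun t : ℕ => (t : ℂ) - k * r) ?_ ?_
    · intro y hy
      obtain ⟨t, ht, rfl⟩ := Finset.mem_image.1 hy
      rw [hF, ← hQ r s t hr hs (Finset.mem_range.1 ht)]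
      congr 1
      simp [point, x, g]
    · rw [Finset.card_image_of_injective _ hinj, Finset.card_range]
      refine lt_of_le_of_lt (Polynomial.natDegree_sum_le_of_forall_le _ _ fun h hh => ?_) h1
      exact (Polynomial.natDegree_monomial_le _).trans (monomial_le_degreeOf 1 hh)
  apply MvPolynomial.funext
  intro v
  obtain ⟨x, y, g, rfl⟩ : ∃ x y g, v = ![x, y, g] := ⟨v 0, v 1, v 2, by
    funext i; fin_cases i <;> rfl⟩
  let f : Fin (l + 1) → Polynomial ℂ := fun i => ∑ h ∈ Q.support with h 2 = (i : ℕ),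
    Polynomial.monomial (h 0) (coeff h Q * y ^ h 1)
  have hf : ∀ x g, eval ![x, y, g] Q = ∑ i, (f i).eval x * g ^ (i : ℕ) := by
    intro x g
    rw [eval_three]
    rw [← Finset.sum_fiberwise_of_maps_to (s := Q.support) (t := (Finset.univ : Finset (Fin (l + 1))))
      (g := fun h => Fin.ofNat (l + 1) (h 2)) (fun _ _ => Finset.mem_univ _)]
    refine Finset.sum_congr rfl fun i _ => ?_
    have hfil : {h ∈ Q.support | Fin.ofNat (l + 1) (h 2) = i} = {h ∈ Q.support | h 2 = (i : ℕ)} := by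
      refine Finset.filter_congr fun h hh => ?_
      have h3 : h 2 < l + 1 := Nat.lt_succ_of_le ((monomial_le_degreeOf 2 hh).trans h2)
      rw [Fin.ext_iff, Fin.val_ofNat, Nat.mod_eq_of_lt h3]
    rw [hfil, Polynomial.eval_finsetSum, Finset.sum_mul]
    refine Finset.sum_congr rfl fun h hh => ?_
    rw [Polynomial.eval_monomial, ← (Finset.mem_filter.1 hh).2]
    ring
  have hz := forall_eq_zero_of_exponential_polynomial hA hu hroot hSb hRS f
    (fun i => Polynomial.natDegree_sum_le_of_forall_le _ _ fun h hh =>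
      (Polynomial.natDegree_monomial_le _).trans
        ((monomial_le_degreeOf 0 (Finset.mem_filter.1 hh).1).trans h0))
    (fun r s hr hs => by rw [← hf]; exact hy r s y hr hs)
  rw [hf]
  simp [hz]

/-- The space of polynomials whose partial degrees are at most `m`. -/
noncomputable def box (m : Fin 3 →₀ ℕ) : Submodule ℂ (MvPolynomial (Fin 3) ℂ) :=
  restrictSupport ℂ (Set.Iic m)

lemma mem_box {m : Fin 3 →₀ ℕ} {Q : MvPolynomial (Fin 3) ℂ} :
    Q ∈ box m ↔ ∀ i, degreeOf i Q ≤ m i := by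
  rw [box, mem_restrictSupport_iff]
  constructor
  · intro h i
    rw [degreeOf_le_iff]
    exact fun e he => h he i
  · intro h e he i
    exact degreeOf_le_iff.1 (h i) e he

instance finite_box (m : Fin 3 →₀ ℕ) : Module.Finite ℂ (box m) :=
  Module.Finite.of_basis (basisRestrictSupport ℂ (Set.Iic m))

lemma finrank_box (m : Fin 3 →₀ ℕ) :
    Module.finrank ℂ (box m) = (m 0 + 1) * (m 1 + 1) * (m 2 + 1) := by
  classical
  have h := Module.finrank_eq_card_basis (basisRestrictSupport ℂ (Set.Iic m))
  rw [box, h, Fintype.card_ofFinset (s := Finset.Iic m) (H := by simp), Finsupp.card_Iic,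
    Finset.prod_subset (Finset.subset_univ m.support) (by
      intro i _ hi
      simp [Finsupp.notMem_support_iff.1 hi]), Fin.prod_univ_three]
  simp

lemma exists_eval_ne_zero_of_isRelPrime {P P' : MvPolynomial (Fin 3) ℂ} (hP : P ≠ 0)
    (hPP' : IsRelPrime P P') (hdeg : ∀ i, degreeOf i P' ≤ degreeOf i P)
    {m n : Fin 3 →₀ ℕ} (hm : ∀ i, 2 * degreeOf i P ≤ m i) (hn : n ≤ m) {Ω : Set (Fin 3 → ℂ)}
    (hΩ : ∀ Q ∈ box n, (∀ w ∈ Ω, eval w Q = 0) → Q = 0)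
    (hcount : 2 * ((m 0 + 1) * degreeOf 1 P * degreeOf 2 P + (m 1 + 1) * degreeOf 0 P * degreeOf 2 P
      + (m 2 + 1) * degreeOf 0 P * degreeOf 1 P) < (n 0 + 1) * (n 1 + 1) * (n 2 + 1)) :
    ∃ w ∈ Ω, eval w P ≠ 0 ∨ eval w P' ≠ 0 := by
  by_contra! hcon
  let d : Fin 3 →₀ ℕ := Finsupp.equivFunOnFinite.symm fun i => degreeOf i P
  have hd : ∀ i, d i = degreeOf i P := fun i => rfl
  let f : (box (m - d) × box (m - d)) →ₗ[ℂ] MvPolynomial (Fin 3) ℂ :=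
    ((LinearMap.mulRight ℂ P).comp (box (m - d)).subtype).coprod
      ((LinearMap.mulRight ℂ P').comp (box (m - d)).subtype)
  have hf : ∀ a c, f (a, c) = a * P + c * P' := fun a c => by simp [f]
  have hfm : ∀ x, f x ∈ box m := by
    rintro ⟨⟨a, ha⟩, ⟨c, hc⟩⟩
    rw [hf, mem_box]
    rw [mem_box] at ha hc
    intro i
    have h1 := ha i
    have h2 := hc i
    have h3 := hdeg i
    have h4 := hm i
    rw [Finsupp.tsub_apply, hd] at h1 h2
    refine (degreeOf_add_le _ _ _).trans (max_le ?_ ?_) <;>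
      refine (degreeOf_mul_le _ _ _).trans ?_ <;> dsimp only <;> omega
  have hrange : LinearMap.range f ≤ box m := by
    rintro _ ⟨x, rfl⟩
    exact hfm x
  have hdisj : Disjoint (LinearMap.range f) (box n) := by
    rw [Submodule.disjoint_def]
    rintro _ ⟨⟨a, c⟩, rfl⟩ hx
    refine hΩ _ hx fun w hw => ?_
    rw [hf]
    simp [(hcon w hw).1, (hcon w hw).2]
  have hnm : box n ≤ box m := fun Q hQ => mem_box.2 fun i => (mem_box.1 hQ i).trans (hn i)
  have hdim : Module.finrank ℂ (LinearMap.range f) + Module.finrank ℂ (box n) ≤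
      Module.finrank ℂ (box m) := by
    have h1 : Disjoint ((LinearMap.range f).comap (box m).subtype)
        ((box n).comap (box m).subtype) := by
      rw [Submodule.disjoint_def] at hdisj ⊢
      intro x h1 h2
      exact Subtype.ext (hdisj _ h1 h2)
    have h2 := Submodule.finrank_add_finrank_le_of_disjoint h1
    rwa [(Submodule.comapSubtypeEquivOfLe hrange).finrank_eq,
      (Submodule.comapSubtypeEquivOfLe hnm).finrank_eq] at h2
  have hker : Module.finrank ℂ (LinearMap.ker f) ≤ Module.finrank ℂ (box (m - d - d)) := by
    let g : box (m - d - d) →ₗ[ℂ] MvPolynomial (Fin 3) ℂ × MvPolynomial (Fin 3) ℂ :=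
      (LinearMap.prod (-LinearMap.mulRight ℂ P') (LinearMap.mulRight ℂ P)).comp
        (box (m - d - d)).subtype
    let e : box (m - d) × box (m - d) →ₗ[ℂ] MvPolynomial (Fin 3) ℂ × MvPolynomial (Fin 3) ℂ :=
      (box (m - d)).subtype.prodMap (box (m - d)).subtype
    have he : Function.Injective e :=
      Prod.map_injective.2 ⟨Subtype.val_injective, Subtype.val_injective⟩
    rw [(Submodule.equivMapOfInjective e he (LinearMap.ker f)).finrank_eq]
    refine le_trans (Submodule.finrank_mono (t := LinearMap.range g) ?_)
      (LinearMap.finrank_range_le g)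
    rintro _ ⟨⟨a, c⟩, hac, rfl⟩
    rw [SetLike.mem_coe, LinearMap.mem_ker, hf] at hac
    have hdvd : P ∣ (c : MvPolynomial (Fin 3) ℂ) := by
      refine hPP'.dvd_of_dvd_mul_right ⟨-a, ?_⟩
      linear_combination hac
    obtain ⟨h, hh⟩ := hdvd
    have ha : (a : MvPolynomial (Fin 3) ℂ) = -(h * P') := by
      apply mul_right_cancel₀ hP
      rw [hh] at hac
      linear_combination hac
    have hbox : h ∈ box (m - d - d) := by
      rw [mem_box]
      intro i
      by_cases h0 : h = 0
      · simp [h0]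
      have h1 := mem_box.1 c.2 i
      rw [hh, degreeOf_mul_eq hP h0, Finsupp.tsub_apply, hd] at h1
      rw [Finsupp.tsub_apply, Finsupp.tsub_apply, hd]
      omega
    refine ⟨⟨h, hbox⟩, ?_⟩
    simp [g, e, ha, hh, mul_comm]
  have hrn := LinearMap.finrank_range_add_finrank_ker f
  rw [Module.finrank_prod] at hrn
  simp only [finrank_box, Finsupp.tsub_apply, hd] at hdim hker hrn
  have h0 := hm 0
  have h1 := hm 1
  have h2 := hm 2
  generalize degreeOf 0 P = d0 at *
  generalize degreeOf 1 P = d1 at *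
  generalize degreeOf 2 P = d2 at *
  obtain ⟨e0, he0⟩ := Nat.exists_eq_add_of_le h0
  obtain ⟨e1, he1⟩ := Nat.exists_eq_add_of_le h1
  obtain ⟨e2, he2⟩ := Nat.exists_eq_add_of_le h2
  rw [he0, he1, he2] at hdim hrn hker hcount
  have a0 : 2 * d0 + e0 - d0 = d0 + e0 := by omega
  have a1 : 2 * d1 + e1 - d1 = d1 + e1 := by omega
  have a2 : 2 * d2 + e2 - d2 = d2 + e2 := by omega
  have b0 : d0 + e0 - d0 = e0 := by omega
  have b1 : d1 + e1 - d1 = e1 := by omega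
  have b2 : d2 + e2 - d2 = e2 := by omega
  simp only [a0, a1, a2, b0, b1, b2] at hdim hrn hker hcount
  nlinarith [Nat.zero_le (d0 * d1 * d2)]

/-- A zero estimate: a nonzero polynomial of bounded partial degrees does not vanish on a large
enough box of the finitely generated group. -/
lemma exists_eval_point_ne_zero {b : ℕ} {k : ℤ} {A u : ℂ} (hA : A ≠ 0) (hu : u ≠ 0)
    (hroot : ∀ j : ℕ, 0 < j → u ^ j ≠ 1) {K L G R₁ S₁ T₁ R₂ S₂ T₂ m₀ m₁ l : ℕ}
    (hLS : L < S₁) (hGS : G ≤ S₁) (hR : 0 < R₁) (hT : 0 < T₁) (hGT : K ≤ G * T₁)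
    (hRS : K ≤ R₁ * S₁) (hRT : K ≤ R₁ * T₁)
    (hD : ∀ s t : ℤ, |s| < G → t ≠ 0 → |t| * S₁ ≤ |t * b - s * k|) (hk : (T₁ : ℤ) ≤ |k|)
    (hm₀ : 2 * K ≤ m₀) (hm₁ : 2 * K ≤ m₁) (hl : 2 * L ≤ l) (hT₂ : 0 < T₂) (hTm : T₂ ≤ m₁)
    (hSb : S₂ ≤ b) (hRS₂ : m₀ * (l + 1) < R₂ * S₂)
    (hcount : 2 * ((m₀ + 1) * K * L + (m₁ + 1) * K * L + (l + 1) * K * K)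
      < (m₀ + 1) * T₂ * (l + 1))
    {P : MvPolynomial (Fin 3) ℂ} (hP : P ≠ 0) (hP0 : degreeOf 0 P < K) (hP1 : degreeOf 1 P < K)
    (hP2 : degreeOf 2 P ≤ L) (j : ℤ × ℤ × ℤ) :
    ∃ r s t : ℕ, r < R₁ + R₂ ∧ s < S₁ + S₂ + l ∧ t < T₁ + T₂ ∧
      eval (point b k A u (j + ((r : ℤ), (s : ℤ), (t : ℤ)))) P ≠ 0 := by
  classical
  wlog hj : j = 0 generalizing j P
  · have hv := vec_ne_zero (b := b) (k := k) hA hu j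
    obtain ⟨r, s, t, hr, hs, ht, h⟩ := this (P := shift (vec b k A u j) P)
      (shift_ne_zero hv hP) (by rwa [degreeOf_shift hv]) (by rwa [degreeOf_shift hv])
      (by rwa [degreeOf_shift hv]) 0 rfl
    refine ⟨r, s, t, hr, hs, ht, ?_⟩
    rwa [eval_point_shift hA hu, zero_add, add_comm] at h
  subst hj
  wlog hX : ¬ X 2 ∣ P generalizing P
  · obtain ⟨P', hP', hX'⟩ := (FiniteMultiplicity.of_prime_left
      (X_prime (R := ℂ) (i := (2 : Fin 3))) hP).exists_eq_pow_mul_and_not_dvd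
    have hP'0 : P' ≠ 0 := by
      rintro rfl
      exact hP (by rw [hP', mul_zero])
    have hdeg := degreeOf_le_of_dvd hP (Dvd.intro_left _ hP'.symm)
    obtain ⟨r, s, t, hr, hs, ht, h⟩ := this hP'0 ((hdeg 0).trans_lt hP0) ((hdeg 1).trans_lt hP1)
      ((hdeg 2).trans hP2) hX'
    refine ⟨r, s, t, hr, hs, ht, ?_⟩
    rw [hP', map_mul]
    refine mul_ne_zero ?_ h
    rw [map_pow, eval_X]
    exact pow_ne_zero _ (mul_ne_zero (zpow_ne_zero _ hA) (zpow_ne_zero _ hu))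
  by_contra! hcon
  let ι := Fin R₁ × Fin S₁ × Fin T₁
  let w : ι → ℂ × ℂ × ℂ := fun i => vec b k A u ((i.1 : ℕ), (i.2.1 : ℕ), (i.2.2 : ℕ))
  have hw : ∀ i, (w i).2.2 ≠ 0 := fun i => vec_ne_zero hA hu _
  obtain ⟨c, hc⟩ := exists_isRelPrime_sum hP (fun i : ι => shift (w i) P) (by
    intro q hq hqP
    by_contra! hall
    refine not_forall_dvd_shift hA hu hroot hLS hGS hR hT hGT hRS hRT hD hk hP hP0 hP1 hP2 hq
      (fun h => ?_) fun r s t hr hs ht => hall ⟨⟨r, hr⟩, ⟨s, hs⟩, ⟨t, ht⟩⟩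
    exact hX (h.trans hqP))
  let n : Fin 3 →₀ ℕ := Finsupp.equivFunOnFinite.symm ![m₀, T₂ - 1, l]
  let m : Fin 3 →₀ ℕ := Finsupp.equivFunOnFinite.symm ![m₀, m₁, l]
  obtain ⟨p, ⟨r, s, t, hr, hs, ht, rfl⟩, h⟩ := exists_eval_ne_zero_of_isRelPrime hP hc
    (fun i => by
      refine (degreeOf_sum_le _ _ _).trans (Finset.sup_le fun i _ => ?_)
      refine (degreeOf_le_iff.2 fun e he => ?_)
      rw [← degreeOf_shift (hw i) P]
      exact degreeOf_le_iff.1 le_rfl e (support_smul he))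
    (m := m) (n := n)
    (by
      intro i
      fin_cases i <;> simp [m] <;> omega)
    (by
      intro i
      fin_cases i <;> simp [m, n]
      omega)
    (Ω := {p | ∃ r s t : ℕ, r < R₂ ∧ s < S₂ + l ∧ t < T₂ ∧ p = point b k A u (r, s, t)})
    (fun Q hQ h => by
      rw [mem_box] at hQ
      have h0 := hQ 0
      have h1 := hQ 1
      have h2 := hQ 2
      simp only [n, Finsupp.equivFunOnFinite_symm_apply_apply, Matrix.cons_val] at h0 h1 h2
      exact eq_zero_of_forall_eval_point hA hu hroot hSb hRS₂ h0 (T := T₂) (by omega) h2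
        fun r s t hr hs ht => h _ ⟨r, s, t, hr, hs, ht, rfl⟩)
    (by
      simp only [m, n, Finsupp.equivFunOnFinite_symm_apply_apply, Matrix.cons_val]
      have e : T₂ - 1 + 1 = T₂ := by omega
      rw [e]
      refine lt_of_le_of_lt ?_ hcount
      gcongr)
  rcases h with h | h
  · refine h ?_
    have := hcon r s t (by omega) (by omega) (by omega)
    rwa [zero_add] at this
  · refine h ?_
    rw [map_sum]
    refine Finset.sum_eq_zero fun i _ => ?_
    rw [smul_eval, eval_point_shift hA hu]
    have := hcon (r + i.1) (s + i.2.1) (t + i.2.2) (by omega) (by omega) (by omega)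
    rw [zero_add] at this
    have e : (((r : ℤ), (s : ℤ), (t : ℤ)) + (((i.1 : ℕ) : ℤ), ((i.2.1 : ℕ) : ℤ), ((i.2.2 : ℕ) : ℤ)) :
        ℤ × ℤ × ℤ) = (((r + i.1 : ℕ) : ℤ), ((s + i.2.1 : ℕ) : ℤ), ((t + i.2.2 : ℕ) : ℤ)) := by
      simp
    rw [e, this, mul_zero]

lemma exists_det_ne_zero {ι Ω : Type*} [Fintype ι] [DecidableEq ι] (f : ι → Ω → ℂ)
    (h : ∀ c : ι → ℂ, (∀ ω, ∑ i, c i * f i ω = 0) → c = 0) :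
    ∃ p : ι → Ω, (Matrix.of fun i j => f i (p j)).det ≠ 0 := by
  classical
  let v : Ω → ι → ℂ := fun ω i => f i ω
  have hspan : Submodule.span ℂ (Set.range v) = ⊤ := by
    by_contra hne
    obtain ⟨φ, hφ, hle⟩ := Submodule.exists_le_ker_of_lt_top _ (lt_top_iff_ne_top.2 hne)
    have hφv : ∀ x : ι → ℂ, φ x = ∑ i, φ (Pi.single i 1) * x i := by
      intro x
      conv_lhs => rw [pi_eq_sum_univ' x, map_sum]
      simp [mul_comm]
    have := h (fun i => φ (Pi.single i 1)) fun ω => by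
      rw [← hφv (v ω)]
      exact hle (Submodule.subset_span ⟨ω, rfl⟩)
    apply hφ
    ext i
    simpa using congrFun this i
  obtain ⟨κ, a, -, hs, hli⟩ := exists_linearIndependent' ℂ v
  rw [hspan] at hs
  let B := Module.Basis.mk hli hs.ge
  have : Finite κ := Module.Finite.finite_basis B
  have := Fintype.ofFinite κ
  have hcard : Fintype.card ι = Fintype.card κ := by
    rw [← Module.finrank_eq_card_basis B, Module.finrank_fintype_fun_eq_card]
  let e : ι ≃ κ := Fintype.equivOfCardEq hcard
  refine ⟨a ∘ e, ?_⟩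
  have hli' : LinearIndependent ℂ (Matrix.of fun j i => f i (a (e j))).row :=
    hli.comp e e.injective
  rw [Matrix.linearIndependent_rows_iff_isUnit, Matrix.isUnit_iff_isUnit_det] at hli'
  rw [← Matrix.det_transpose]
  exact hli'.ne_zero

lemma cast_choose (x : ℤ) (m : ℕ) :
    ((Ring.choose x m : ℤ) : ℂ) = (m.factorial : ℂ)⁻¹ * ∏ i ∈ Finset.range m, ((x : ℂ) - i) := by
  have h := Ring.descPochhammer_eq_factorial_smul_choose x m
  rw [← Polynomial.eval_eq_smeval, descPochhammer_eval_eq_prod_range] at h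
  have h2 : ((∏ j ∈ Finset.range m, (x - (j : ℤ)) : ℤ) : ℂ) =
      ((m.factorial • Ring.choose x m : ℤ) : ℂ) := by
    exact_mod_cast h
  rw [nsmul_eq_mul] at h2
  push_cast at h2
  rw [h2]
  rw [inv_mul_cancel_left₀ (by exact_mod_cast m.factorial_ne_zero)]

/-- The binomial polynomial in the variable `j`. -/
noncomputable def choosePoly (j : Fin 3) (m : ℕ) : MvPolynomial (Fin 3) ℂ :=
  C (m.factorial : ℂ)⁻¹ * ∏ i ∈ Finset.range m, (X j - C (i : ℂ))

lemma eval_choosePoly (j : Fin 3) (m : ℕ) (v : Fin 3 → ℂ) (x : ℤ) (h : v j = x) :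
    eval v (choosePoly j m) = ((Ring.choose x m : ℤ) : ℂ) := by
  rw [cast_choose, choosePoly]
  simp [h]

lemma degreeOf_choosePoly_le (i j : Fin 3) (m : ℕ) :
    degreeOf i (choosePoly j m) ≤ if i = j then m else 0 := by
  rw [choosePoly]
  refine (degreeOf_C_mul_le _ _ _).trans ((degreeOf_prod_le _ _ _).trans ?_)
  have : ∀ n ∈ Finset.range m, degreeOf i (X j - C (n : ℂ) : MvPolynomial (Fin 3) ℂ) ≤
      if i = j then 1 else 0 := fun n _ => by
    refine (degreeOf_sub_le _ _ _).trans ?_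
    rw [degreeOf_C, degreeOf_X]
    simp
  refine (Finset.sum_le_sum this).trans ?_
  split_ifs <;> simp

lemma eq_zero_of_forall_sum_choose {K : ℕ} (c : Fin K → ℂ)
    (h : ∀ x : ℕ, ∑ i, c i * ((x.choose i : ℕ) : ℂ) = 0) : c = 0 := by
  have : ∀ n : ℕ, ∀ i : Fin K, (i : ℕ) = n → c i = 0 := by
    intro n
    induction n using Nat.strong_induction_on with
    | _ n ih =>
      rintro i rfl
      have h1 := h i
      rw [Finset.sum_eq_single i] at h1
      · simpa using h1
      · intro j _ hj
        rcases lt_or_gt_of_ne hj with hj | hj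
        · rw [ih j hj j rfl, zero_mul]
        · rw [Nat.choose_eq_zero_of_lt hj, Nat.cast_zero, mul_zero]
      · simp
  funext i
  exact this i i rfl

/-- The functions on the group whose interpolation determinant is studied. -/
noncomputable def basisFun {K L : ℕ} (b k : ℤ) (A u : ℂ) (i : Fin K × Fin K × Fin (L + 1))
    (p : ℤ × ℤ × ℤ) : ℂ :=
  ((Ring.choose (p.2.1 - b * p.1) (i.1 : ℕ) : ℤ) : ℂ) *
    ((Ring.choose (p.2.2 - k * p.1) (i.2.1 : ℕ) : ℤ) : ℂ) * (A ^ p.1 * u ^ p.2.1) ^ (i.2.2 : ℕ)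

lemma exists_basisFun_det_ne_zero {K L : ℕ} {b k : ℤ} {A u : ℂ} (Ω : Set (ℤ × ℤ × ℤ))
    (hZ : ∀ P : MvPolynomial (Fin 3) ℂ, P ≠ 0 → degreeOf 0 P < K → degreeOf 1 P < K →
      degreeOf 2 P ≤ L → ∃ p ∈ Ω, eval (point b k A u p) P ≠ 0) :
    ∃ p : Fin K × Fin K × Fin (L + 1) → Ω,
      (Matrix.of fun i j => basisFun b k A u i (p j : ℤ × ℤ × ℤ)).det ≠ 0 := by
  refine exists_det_ne_zero (fun i (p : Ω) => basisFun b k A u i (p : ℤ × ℤ × ℤ)) fun c hc => ?_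
  let P : MvPolynomial (Fin 3) ℂ := ∑ i : Fin K × Fin K × Fin (L + 1),
    C (c i) * (choosePoly 0 i.1 * choosePoly 1 i.2.1 * X 2 ^ (i.2.2 : ℕ))
  have hdeg : ∀ (j : Fin 3) (i : Fin K × Fin K × Fin (L + 1)),
      degreeOf j (C (c i) * (choosePoly 0 i.1 * choosePoly 1 i.2.1 * X 2 ^ (i.2.2 : ℕ))) ≤
        ![(i.1 : ℕ), i.2.1, i.2.2] j := by
    intro j i
    refine (degreeOf_C_mul_le _ _ _).trans ((degreeOf_mul_le _ _ _).trans ?_)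
    refine (add_le_add ((degreeOf_mul_le _ _ _).trans (add_le_add (degreeOf_choosePoly_le _ _ _)
      (degreeOf_choosePoly_le _ _ _))) ((degreeOf_pow_le _ _ _).trans
      (Nat.mul_le_mul_left _ (degreeOf_X (R := ℂ) j 2).le))).trans ?_
    fin_cases j <;> simp
  have hP0 : P = 0 := by
    by_contra hne
    have hlt : ∀ j : Fin 3, ∀ n, 0 < n → (∀ i : Fin K × Fin K × Fin (L + 1),
        ![(i.1 : ℕ), i.2.1, i.2.2] j < n) → degreeOf j P < n := by
      intro j n hn h
      refine (degreeOf_sum_le _ _ _).trans_lt ((Finset.sup_lt_iff (by simpa using hn)).2 ?_)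
      exact fun i _ => (hdeg j i).trans_lt (h i)
    have hK : 0 < K := by
      rcases Nat.eq_zero_or_pos K with rfl | h
      · exact absurd (by simp [P]) hne
      · exact h
    obtain ⟨p, hp, h⟩ := hZ P hne (hlt 0 K hK fun i => i.1.2) (hlt 1 K hK fun i => i.2.1.2)
      (Nat.lt_succ_iff.1 (hlt 2 (L + 1) (Nat.succ_pos _) fun i => i.2.2.2))
    apply h
    rw [← hc ⟨p, hp⟩, map_sum]
    refine Finset.sum_congr rfl fun i _ => ?_
    rw [map_mul, map_mul, map_mul, map_pow, eval_X, eval_C,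
      eval_choosePoly 0 _ _ (p.2.1 - b * p.1) rfl, eval_choosePoly 1 _ _ (p.2.2 - k * p.1) rfl]
    rfl
  have hev : ∀ (x y : ℕ) (g : ℂ), ∑ l : Fin (L + 1), (∑ i : Fin K, (∑ j : Fin K,
      c (i, j, l) * ((y.choose j : ℕ) : ℂ)) * ((x.choose i : ℕ) : ℂ)) * g ^ (l : ℕ) = 0 := by
    intro x y g
    have h := congrArg (eval ![(x : ℂ), (y : ℂ), g]) hP0
    rw [map_zero, map_sum, Fintype.sum_prod_type] at h
    simp only [Fintype.sum_prod_type] at h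
    rw [← h]
    simp only [Finset.sum_mul]
    rw [Finset.sum_comm]
    refine Finset.sum_congr rfl fun i _ => ?_
    rw [Finset.sum_comm]
    refine Finset.sum_congr rfl fun j _ => Finset.sum_congr rfl fun l _ => ?_
    rw [map_mul, map_mul, map_mul, map_pow, eval_X, eval_C,
      eval_choosePoly 0 _ _ (x : ℤ) (by simp), eval_choosePoly 1 _ _ (y : ℤ) (by simp)]
    rw [Ring.choose_natCast, Ring.choose_natCast]
    simp
    ring
  have hl : ∀ (x y : ℕ) (l : Fin (L + 1)), ∑ i : Fin K, (∑ j : Fin K,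
      c (i, j, l) * ((y.choose j : ℕ) : ℂ)) * ((x.choose i : ℕ) : ℂ) = 0 := by
    intro x y
    set d : Fin (L + 1) → ℂ := fun l => ∑ i : Fin K, (∑ j : Fin K,
      c (i, j, l) * ((y.choose j : ℕ) : ℂ)) * ((x.choose i : ℕ) : ℂ) with hd
    have hdz : (∑ l : Fin (L + 1), Polynomial.C (d l) * Polynomial.X ^ (l : ℕ)) = 0 :=
      Polynomial.funext fun g => by
        rw [Polynomial.eval_finsetSum]
        simp only [Polynomial.eval_mul, Polynomial.eval_C, Polynomial.eval_pow, Polynomial.eval_X,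
          Polynomial.eval_zero]
        exact hev x y g
    intro l
    have := congrArg (fun q : Polynomial ℂ => q.coeff l) hdz
    simpa [Polynomial.finsetSum_coeff, Polynomial.coeff_X_pow, Fin.val_inj] using this
  funext ⟨i, j, l⟩
  have h1 : ∀ y : ℕ, ∑ j : Fin K, c (i, j, l) * ((y.choose j : ℕ) : ℂ) = 0 := fun y =>
    congrFun (eq_zero_of_forall_sum_choose _ fun x => hl x y l) i
  exact congrFun (eq_zero_of_forall_sum_choose (fun j => c (i, j, l)) h1) j

end ZeroEstimate

section Determinant

lemma norm_det_le {ι : Type*} [Fintype ι] [DecidableEq ι] (F : ι → ι → ℂ) (β : ι → ℝ)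
    (h : ∀ i j, ‖F i j‖ ≤ β i) :
    ‖(Matrix.of F).det‖ ≤ (Fintype.card ι).factorial * ∏ i, β i := by
  rw [← Matrix.det_transpose, Matrix.det_apply]
  refine (norm_sum_le _ _).trans ?_
  rw [← Fintype.card_perm, ← nsmul_eq_mul, ← Finset.card_univ]
  refine Finset.sum_le_card_nsmul _ _ _ fun σ _ => ?_
  have : ‖Equiv.Perm.sign σ • ∏ i, (Matrix.of F).transpose (σ i) i‖ =
      ‖∏ i, F i (σ i)‖ := by
    rcases Int.units_eq_one_or (Equiv.Perm.sign σ) with h | h <;> simp [h]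
  rw [this, norm_prod]
  exact Finset.prod_le_prod (fun _ _ => norm_nonneg _) fun i _ => h i _

lemma norm_det_sum_le {ι : Type*} [Fintype ι] [DecidableEq ι] {α : ι → Type*}
    [∀ i, Fintype (α i)] (g : ∀ i, α i → ι → ℂ) (β : ∀ i, α i → ℝ)
    (hg : ∀ i o j, ‖g i o j‖ ≤ β i o) (wt : ∀ i, α i → ℕ) {E : ℝ} (hE : 1 ≤ E) (O : ℕ)
    (hO : ∀ f : ∀ i, α i, (Matrix.of fun i => g i (f i)).det ≠ 0 → O ≤ ∑ i, wt i (f i)) :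
    ‖(Matrix.of fun i j => ∑ o, g i o j).det‖ * E ^ O ≤
      (Fintype.card ι).factorial * ∏ i, ∑ o, β i o * E ^ wt i o := by
  classical
  have hβ : ∀ (f : ∀ i, α i) (j : ι), 0 ≤ β j (f j) := fun f j =>
    (norm_nonneg _).trans (hg j (f j) j)
  have hexp : (Matrix.of fun i j => ∑ o, g i o j).det =
      ∑ f : ∀ i, α i, (Matrix.of fun i => g i (f i)).det := by
    have h1 : (Matrix.of fun i j => ∑ o, g i o j) = Matrix.of fun i => ∑ o, g i o := by
      ext i j
      simp [Finset.sum_apply]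
    rw [h1]
    exact (Matrix.detRowAlternating (R := ℂ) (n := ι)).toMultilinearMap.map_sum fun i o => g i o
  rw [hexp, Finset.prod_univ_sum, Finset.mul_sum, Fintype.piFinset_univ]
  refine (mul_le_mul_of_nonneg_right (norm_sum_le _ _) (by positivity)).trans ?_
  rw [Finset.sum_mul]
  refine Finset.sum_le_sum fun f _ => ?_
  by_cases hdet : (Matrix.of fun i => g i (f i)).det = 0
  · rw [hdet, norm_zero, zero_mul]
    exact mul_nonneg (by positivity) (Finset.prod_nonneg fun i _ =>
      mul_nonneg (hβ f i) (by positivity))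
  · rw [Finset.prod_mul_distrib, Finset.prod_pow_eq_pow_sum, ← mul_assoc]
    have h0 : 0 ≤ ∏ i, β i (f i) := Finset.prod_nonneg fun i _ => hβ f i
    refine mul_le_mul (norm_det_le _ _ fun i j => hg i (f i) j)
      (pow_le_pow_right₀ hE (hO f hdet)) (by positivity) (by positivity)

lemma le_sum_min_add {ι : Type*} [Fintype ι] (f : ι → Option (ℕ × ℕ)) (M B : ℕ)
    (hinj : ∀ i j d, f i = some d → f j = some d → i = j) (hM : ∀ i d, f i = some d → d.1 < M) :
    Fintype.card ι * B ≤ ∑ i, (f i).elim B (fun d => min d.2 B) + M * (B * (B + 1) / 2) := by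
  classical
  set wt : ι → ℕ := fun i => (f i).elim B (fun d => min d.2 B) with hwt
  have hle : ∀ i, wt i ≤ B := by
    intro i
    cases h : f i <;> simp [hwt, h]
  have hsum : ∑ i, (B - wt i) ≤ M * (B * (B + 1) / 2) := by
    have h1 : ∑ i, (B - wt i) = ∑ i with wt i < B, (B - wt i) := by
      symm
      refine Finset.sum_subset (Finset.filter_subset _ _) fun i _ hi => ?_
      simp only [Finset.mem_filter, Finset.mem_univ, true_and, not_lt] at hi
      omega
    have h2 : ∑ d ∈ Finset.range M ×ˢ Finset.range B, (B - d.2) = M * (B * (B + 1) / 2) := by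
      rw [Finset.sum_product]
      simp only [Finset.sum_const, Finset.card_range, smul_eq_mul]
      congr 1
      rw [← Finset.sum_range_reflect]
      have : ∀ j ∈ Finset.range B, B - (B - 1 - j) = j + 1 := fun j hj => by
        have := Finset.mem_range.1 hj
        omega
      rw [Finset.sum_congr rfl this]
      have := Finset.sum_range_succ' (fun i => i) B
      simp only [add_zero] at this
      rw [← this, Finset.sum_range_id, Nat.add_sub_cancel, mul_comm]
    rw [h1, ← h2]
    have hsome : ∀ i, wt i < B → ∃ d, f i = some d ∧ wt i = d.2 := by
      intro i hi
      cases h : f i with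
      | none => simp [hwt, h] at hi
      | some d =>
        refine ⟨d, rfl, ?_⟩
        simp only [hwt, h, Option.elim] at hi ⊢
        omega
    have h3 : ∀ i ∈ Finset.univ.filter fun i => wt i < B,
        B - wt i = B - ((f i).getD (0, 0)).2 := by
      intro i hi
      obtain ⟨d, hd, hw⟩ := hsome i (Finset.mem_filter.1 hi).2
      rw [hw, hd, Option.getD_some]
    rw [Finset.sum_congr rfl h3,
      ← Finset.sum_image (f := fun d : ℕ × ℕ => B - d.2) (g := fun i => (f i).getD (0, 0))]
    · refine Finset.sum_le_sum_of_subset fun d hd => ?_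
      obtain ⟨i, hi, rfl⟩ := Finset.mem_image.1 hd
      have hi := (Finset.mem_filter.1 hi).2
      obtain ⟨d, hd, hw⟩ := hsome i hi
      rw [hd, Option.getD_some, Finset.mem_product, Finset.mem_range, Finset.mem_range]
      exact ⟨hM i d hd, hw ▸ hi⟩
    · intro i hi j hj hij
      obtain ⟨d, hd, -⟩ := hsome i (Finset.mem_filter.1 hi).2
      obtain ⟨d', hd', -⟩ := hsome j (Finset.mem_filter.1 hj).2
      simp only [hd, hd', Option.getD_some] at hij
      exact hinj i j d hd (hij ▸ hd')
  have h3 : Fintype.card ι * B = ∑ i, (wt i + (B - wt i)) := by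
    rw [Finset.sum_congr rfl fun i _ => Nat.add_sub_of_le (hle i)]
    simp
  rw [h3, Finset.sum_add_distrib]
  exact Nat.add_le_add_left hsum _

/-- `f` is a polynomial function of degree at most `a` in its first variable, whose coefficients
satisfy `∑ |c| X ^ i * Y ^ j ≤ S`. -/
def Rep (X Y : ℝ) (S : ℝ) (a : ℕ) (f : ℂ → ℂ → ℂ) : Prop :=
  ∃ (τ : Type) (_ : Fintype τ) (c : τ → ℂ) (e : τ → ℕ × ℕ), (∀ t, (e t).1 ≤ a) ∧
    ∑ t, ‖c t‖ * (X ^ (e t).1 * Y ^ (e t).2) ≤ S ∧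
    ∀ x w, f x w = ∑ t, c t * (x ^ (e t).1 * w ^ (e t).2)

lemma Rep.mul {X Y S S' : ℝ} {a a' : ℕ} {f f' : ℂ → ℂ → ℂ} (hX : 0 ≤ X) (hY : 0 ≤ Y)
    (h : Rep X Y S a f) (h' : Rep X Y S' a' f') :
    Rep X Y (S * S') (a + a') fun x w => f x w * f' x w := by
  obtain ⟨τ, _, c, e, ha, hS, hf⟩ := h
  obtain ⟨τ', _, c', e', ha', hS', hf'⟩ := h'
  refine ⟨τ × τ', inferInstance, fun t => c t.1 * c' t.2, fun t => e t.1 + e' t.2,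
    fun t => add_le_add (ha _) (ha' _), ?_, fun x w => ?_⟩
  · have h0 : 0 ≤ ∑ t, ‖c t‖ * (X ^ (e t).1 * Y ^ (e t).2) :=
      Finset.sum_nonneg fun _ _ => by positivity
    have h0' : 0 ≤ ∑ t, ‖c' t‖ * (X ^ (e' t).1 * Y ^ (e' t).2) :=
      Finset.sum_nonneg fun _ _ => by positivity
    refine le_trans (le_of_eq ?_) (mul_le_mul hS hS' h0' (h0.trans hS))
    rw [Finset.sum_mul_sum, Fintype.sum_prod_type]
    refine Finset.sum_congr rfl fun t _ => Finset.sum_congr rfl fun t' _ => ?_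
    simp only [norm_mul, Prod.fst_add, Prod.snd_add, pow_add]
    ring
  · dsimp only
    rw [hf, hf', Finset.sum_mul_sum, Fintype.sum_prod_type]
    refine Finset.sum_congr rfl fun t _ => Finset.sum_congr rfl fun t' _ => ?_
    simp only [Prod.fst_add, Prod.snd_add, pow_add]
    ring

lemma Rep.mono {X Y S S' : ℝ} {a a' : ℕ} {f : ℂ → ℂ → ℂ} (h : Rep X Y S a f) (hS : S ≤ S')
    (ha : a ≤ a') : Rep X Y S' a' f := by
  obtain ⟨τ, _, c, e, h1, h2, h3⟩ := h
  exact ⟨τ, _, c, e, fun t => (h1 t).trans ha, h2.trans hS, h3⟩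

lemma Rep.const (X Y : ℝ) (γ : ℂ) : Rep X Y ‖γ‖ 0 fun _ _ => γ :=
  ⟨Unit, inferInstance, fun _ => γ, fun _ => (0, 0), by simp, by simp, by simp⟩

lemma Rep.linear (X Y : ℝ) (α β γ : ℂ) :
    Rep X Y (‖α‖ * X + ‖β‖ * Y + ‖γ‖) 1 fun x w => α * x + β * w + γ :=
  ⟨Fin 3, inferInstance, ![α, β, γ], ![(1, 0), (0, 1), (0, 0)], by
    intro t; fin_cases t <;> simp, by simp [Fin.sum_univ_three], by simp [Fin.sum_univ_three]⟩

lemma Rep.prod_range {X Y S : ℝ} (hX : 0 ≤ X) (hY : 0 ≤ Y) {a : ℕ} (f : ℕ → ℂ → ℂ → ℂ) (m : ℕ)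
    (h : ∀ i < m, Rep X Y S a (f i)) :
    Rep X Y (S ^ m) (m * a) fun x w => ∏ i ∈ Finset.range m, f i x w := by
  induction m with
  | zero => simpa using Rep.const X Y 1
  | succ m ih =>
    simp only [Finset.prod_range_succ]
    exact ((ih fun i hi => h i (Nat.lt_succ_of_lt hi)).mul hX hY (h m (Nat.lt_succ_self m))).mono
      (pow_succ _ _).ge (by rw [Nat.succ_mul])

lemma Rep.exp_sum {X Y : ℝ} (μ : ℂ) (B : ℕ) :
    Rep X Y (∑ m ∈ Finset.range B, (‖μ‖ * Y) ^ m / m.factorial) 0 fun _ w =>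
      ∑ m ∈ Finset.range B, (μ * w) ^ m / m.factorial :=
  ⟨Fin B, inferInstance, fun t => μ ^ (t : ℕ) / (t : ℕ).factorial, fun t => (0, t), by simp, by
    rw [Finset.sum_range]
    refine le_of_eq (Finset.sum_congr rfl fun t _ => ?_)
    simp [mul_pow]
    ring, fun x w => by
    dsimp only
    rw [Finset.sum_range]
    refine Finset.sum_congr rfl fun t _ => ?_
    simp [mul_pow]
    ring⟩

/-- The binomial coefficient as a polynomial function. -/
noncomputable def chooseFun (m : ℕ) (z : ℂ) : ℂ :=
  (m.factorial : ℂ)⁻¹ * ∏ i ∈ Finset.range m, (z - i)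

lemma norm_chooseFun_le {m K : ℕ} (hm : m ≤ K) {z : ℂ} {q : ℝ} (hq : ‖z‖ + K ≤ q) :
    ‖chooseFun m z‖ ≤ q ^ m / m.factorial := by
  rw [chooseFun, norm_mul, norm_inv, Complex.norm_natCast, norm_prod, inv_mul_eq_div]
  refine div_le_div_of_nonneg_right ?_ (by positivity)
  have h : ∀ i ∈ Finset.range m, ‖z - i‖ ≤ q := fun i hi => by
    have : (i : ℝ) ≤ K := by exact_mod_cast (Finset.mem_range.1 hi).le.trans hm
    refine (norm_sub_le _ _).trans ?_
    rw [Complex.norm_natCast]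
    linarith
  exact (Finset.prod_le_prod (fun _ _ => norm_nonneg _) h).trans (by simp)

lemma Rep.chooseFun {X Y q : ℝ} (hX : 0 ≤ X) (hY : 0 ≤ Y) {m K : ℕ} (hm : m ≤ K) (α β : ℂ)
    (hq : ‖α‖ * X + ‖β‖ * Y + K ≤ q) :
    Rep X Y (q ^ m / m.factorial) m fun x w => chooseFun m (α * x + β * w) := by
  have h := Rep.prod_range hX hY (S := q) (fun i x w => α * x + β * w - i) m fun i hi => by
    have : (i : ℝ) ≤ K := by exact_mod_cast hi.le.trans hm
    refine (Rep.linear X Y α β (-(i : ℂ))).mono ?_ le_rfl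
    rw [norm_neg, Complex.norm_natCast]
    linarith
  have h2 := (Rep.const X Y (m.factorial : ℂ)⁻¹).mul hX hY h
  refine h2.mono (le_of_eq ?_) (by simp)
  rw [norm_inv, Complex.norm_natCast, inv_mul_eq_div]

lemma pow_mul_exp_sub_sum_le {y Y E : ℝ} (hy : 0 ≤ y) (hyY : y ≤ Y) (hE : 1 ≤ E) (B : ℕ) :
    E ^ B * (Real.exp y - ∑ m ∈ Finset.range B, y ^ m / m.factorial) ≤
      Real.exp (E * Y) - ∑ m ∈ Finset.range B, (E * Y) ^ m / m.factorial := by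
  have hs : ∀ x : ℝ, HasSum (fun m : ℕ => x ^ (m + B) / (m + B).factorial)
      (Real.exp x - ∑ m ∈ Finset.range B, x ^ m / m.factorial) := fun x => by
    rw [Real.exp_eq_exp_ℝ]
    exact (hasSum_nat_add_iff' B).2 (NormedSpace.expSeries_div_hasSum_exp x)
  refine hasSum_le (fun m => ?_) ((hs y).mul_left (E ^ B)) (hs (E * Y))
  rw [mul_pow, ← mul_div_assoc]
  have : E ^ B ≤ E ^ (m + B) := pow_le_pow_right₀ hE (Nat.le_add_left _ _)
  gcongr

lemma norm_exp_sub_exp_sum_le {w δ W δ₀ E H : ℝ} {l : ℤ} {B : ℕ} (hE : 1 ≤ E)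
    (hl : |(l : ℝ)| ≤ H) (hw : |w| ≤ W) (hδ : |δ| ≤ δ₀) (hB : H * δ₀ * E ^ B ≤ 1) :
    ‖Complex.exp (Complex.I * (l * (w + δ))) -
      ∑ m ∈ Finset.range B, (Complex.I * l * w) ^ m / m.factorial‖ * E ^ B ≤
      1 + (Real.exp (|(l : ℝ)| * (W * E)) -
        ∑ m ∈ Finset.range B, (|(l : ℝ)| * (W * E)) ^ m / m.factorial) := by
  have hEB : 0 < E ^ B := by positivity
  have h1 : ‖Complex.exp (Complex.I * (l * (w + δ))) - Complex.exp (Complex.I * l * w)‖ ≤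
      H * δ₀ := by
    have e : Complex.exp (Complex.I * (l * (w + δ))) - Complex.exp (Complex.I * l * w) =
        Complex.exp (((l * w : ℝ) : ℂ) * Complex.I) *
          (Complex.exp (Complex.I * ((l * δ : ℝ) : ℂ)) - 1) := by
      rw [mul_sub, ← Complex.exp_add, mul_one]
      push_cast
      ring_nf
    rw [e, norm_mul, Complex.norm_exp_ofReal_mul_I, one_mul]
    refine (Real.norm_exp_I_mul_ofReal_sub_one_le).trans ?_
    rw [Real.norm_eq_abs, abs_mul]
    exact mul_le_mul hl hδ (abs_nonneg _) ((abs_nonneg _).trans hl)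
  have h2 := Complex.norm_exp_sub_sum_le_exp_norm_sub_sum (Complex.I * l * w) B
  have hn : ‖Complex.I * l * w‖ = |(l : ℝ)| * |w| := by
    rw [norm_mul, norm_mul, Complex.norm_I, one_mul, Complex.norm_intCast, Complex.norm_real,
      Real.norm_eq_abs]
  rw [hn] at h2
  have h3 := pow_mul_exp_sub_sum_le (y := |(l : ℝ)| * |w|) (Y := |(l : ℝ)| * W) (by positivity)
    (by gcongr) hE B
  have e2 : E * (|(l : ℝ)| * W) = |(l : ℝ)| * (W * E) := by ring
  rw [e2] at h3
  have h4 := norm_sub_le_norm_sub_add_norm_sub (Complex.exp (Complex.I * (l * (w + δ))))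
    (Complex.exp (Complex.I * l * w)) (∑ m ∈ Finset.range B, (Complex.I * l * w) ^ m / m.factorial)
  calc _ ≤ (H * δ₀ + (Real.exp (|(l : ℝ)| * |w|) -
        ∑ m ∈ Finset.range B, (|(l : ℝ)| * |w|) ^ m / m.factorial)) * E ^ B := by
        gcongr
        exact h4.trans (add_le_add h1 h2)
    _ ≤ _ := by
        rw [add_mul, mul_comm (_ - _) (E ^ B)]
        exact add_le_add hB h3

lemma norm_analytic_det_mul_pow_le {ι : Type*} [Fintype ι] [DecidableEq ι] {K B : ℕ}
    (m₁ m₂ : ι → ℕ) (l : ι → ℤ) (hm₁ : ∀ i, m₁ i < K) (hm₂ : ∀ i, m₂ i < K)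
    {X W E q θ δ₀ H : ℝ} (hX : 0 ≤ X) (hW : 0 ≤ W) (hE : 1 ≤ E) (hl : ∀ i, |(l i : ℝ)| ≤ H)
    (hq : X + K ≤ q) (hq' : |θ| / (2 * Real.pi) * X + 1 / (2 * Real.pi) * (W * E) + K ≤ q)
    (x y δ : ι → ℝ) (hx : ∀ j, |x j| ≤ X) (hw : ∀ j, |θ * x j + 2 * Real.pi * y j| ≤ W)
    (hδ : ∀ j, |δ j| ≤ δ₀) (hB : H * δ₀ * E ^ B ≤ 1) (O : ℕ)
    (hO : O + 2 * K * (B * (B + 1) / 2) ≤ Fintype.card ι * B) :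
    ‖(Matrix.of fun i j => chooseFun (m₁ i) (x j) * chooseFun (m₂ i) (y j) *
      Complex.exp (Complex.I * (l i * (((θ * x j + 2 * Real.pi * y j : ℝ) : ℂ) + δ j)))).det‖ *
        E ^ O ≤ (Fintype.card ι).factorial * ∏ i, (q ^ m₁ i / (m₁ i).factorial *
          (q ^ m₂ i / (m₂ i).factorial) * (2 * Real.exp (|(l i : ℝ)| * (W * E)))) := by
  have hπ := Real.pi_pos
  set Y := W * E with hY
  have hY0 : 0 ≤ Y := by positivity
  have hWY : W ≤ Y := le_mul_of_one_le_right hW hE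
  set T : ι → ℝ := fun i => ∑ m ∈ Finset.range B, (|(l i : ℝ)| * Y) ^ m / m.factorial with hT
  set w : ι → ℝ := fun j => θ * x j + 2 * Real.pi * y j with hwdef
  set α : ℂ := ((-(θ / (2 * Real.pi)) : ℝ) : ℂ) with hα
  set β : ℂ := ((1 / (2 * Real.pi) : ℝ) : ℂ) with hβ
  have hnα : ‖α‖ = |θ| / (2 * Real.pi) := by
    rw [hα, Complex.norm_real, Real.norm_eq_abs, abs_neg, abs_div,
      abs_of_pos (show (0 : ℝ) < 2 * Real.pi by positivity)]
  have hnβ : ‖β‖ = 1 / (2 * Real.pi) := by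
    rw [hβ, Complex.norm_real, Real.norm_eq_abs,
      abs_of_pos (show (0 : ℝ) < 1 / (2 * Real.pi) by positivity)]
  have hy : ∀ j, (y j : ℂ) = α * x j + β * w j := by
    intro j
    rw [hα, hβ, hwdef, ← Complex.ofReal_mul, ← Complex.ofReal_mul, ← Complex.ofReal_add]
    congr 1
    field_simp
    ring
  have hny : ∀ j, ‖(y j : ℂ)‖ + K ≤ q := by
    intro j
    refine le_trans ?_ hq'
    rw [hy]
    have h1 : ‖α * (x j : ℂ)‖ ≤ |θ| / (2 * Real.pi) * X := by
      rw [norm_mul, hnα, Complex.norm_real, Real.norm_eq_abs]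
      gcongr
      exact hx j
    have h2 : ‖β * (w j : ℂ)‖ ≤ 1 / (2 * Real.pi) * Y := by
      rw [norm_mul, hnβ, Complex.norm_real, Real.norm_eq_abs]
      gcongr
      exact (hw j).trans hWY
    linarith [norm_add_le (α * (x j : ℂ)) (β * (w j : ℂ))]
  have hnx : ∀ j, ‖(x j : ℂ)‖ + K ≤ q := by
    intro j
    rw [Complex.norm_real, Real.norm_eq_abs]
    linarith [hx j]
  have hq0 : 0 ≤ q := by
    have : (0 : ℝ) ≤ K := Nat.cast_nonneg _
    linarith
  set S : ι → ℝ := fun i => q ^ m₁ i / (m₁ i).factorial * (q ^ m₂ i / (m₂ i).factorial) with hS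
  have hS0 : ∀ i, 0 ≤ S i := fun i => by positivity
  have hrep : ∀ i, Rep X Y (S i * T i) (m₁ i + m₂ i) fun x w => chooseFun (m₁ i) x *
      chooseFun (m₂ i) (α * x + β * w) *
        ∑ m ∈ Finset.range B, (Complex.I * l i * w) ^ m / m.factorial := by
    intro i
    have h1 := Rep.chooseFun (q := q) hX hY0 (hm₁ i).le 1 0 (by simpa using hq)
    have h2 := Rep.chooseFun (q := q) hX hY0 (hm₂ i).le α β (by rw [hnα, hnβ]; exact hq')
    have h3 := Rep.exp_sum (X := X) (Y := Y) (Complex.I * l i) B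
    have h4 := (h1.mul hX hY0 h2).mul hX hY0 h3
    simp only [one_mul, zero_mul, add_zero, norm_mul, Complex.norm_I, Complex.norm_intCast] at h4
    exact h4
  choose τ hτ c e ha hc hf using hrep
  set P : ι → ι → ℂ := fun i j => chooseFun (m₁ i) (x j) * chooseFun (m₂ i) (y j) with hP
  set rem : ι → ι → ℂ := fun i j => P i j * (Complex.exp (Complex.I * (l i * ((w j : ℂ) + δ j))) -
    ∑ m ∈ Finset.range B, (Complex.I * l i * w j) ^ m / m.factorial) with hrem
  let g : ∀ i, Option (τ i) → ι → ℂ := fun i o j =>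
    o.elim (rem i j) fun t => c i t * ((x j : ℂ) ^ (e i t).1 * (w j : ℂ) ^ (e i t).2)
  let bd : ∀ i, Option (τ i) → ℝ := fun i o =>
    o.elim (S i * (1 + (Real.exp (|(l i : ℝ)| * Y) - T i)) / E ^ B) fun t =>
      ‖c i t‖ * (X ^ (e i t).1 * W ^ (e i t).2)
  let wt : ∀ i, Option (τ i) → ℕ := fun i o => o.elim B fun t => min (e i t).2 B
  have hmat : (Matrix.of fun i j => chooseFun (m₁ i) (x j) * chooseFun (m₂ i) (y j) *
      Complex.exp (Complex.I * (l i * ((w j : ℂ) + δ j)))) =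
      Matrix.of fun i j => ∑ o, g i o j := by
    ext i j
    simp only [Matrix.of_apply, Fintype.sum_option, g, Option.elim]
    have h := hf i (x j) (w j)
    dsimp only at h
    rw [← h, ← hy]
    simp only [hrem, hP]
    ring
  have hEB : 0 < E ^ B := by positivity
  have key := norm_det_sum_le g bd (by
    rintro i (_ | t) j
    · simp only [g, bd, Option.elim, hrem]
      rw [norm_mul, le_div_iff₀ hEB, mul_assoc]
      refine mul_le_mul ?_ (norm_exp_sub_exp_sum_le hE (hl i) (hw j) (hδ j) hB) (by positivity)
        (hS0 i)
      rw [hP, norm_mul]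
      exact mul_le_mul (norm_chooseFun_le (hm₁ i).le (hnx j))
        (norm_chooseFun_le (hm₂ i).le (hny j)) (norm_nonneg _) (by positivity)
    · simp only [g, bd, Option.elim]
      rw [norm_mul, norm_mul, norm_pow, norm_pow, Complex.norm_real, Complex.norm_real,
        Real.norm_eq_abs, Real.norm_eq_abs]
      have h1 := hx j
      have h2 := hw j
      gcongr) wt hE O (by
    intro f hdet
    let f' : ι → Option (ℕ × ℕ) := fun i => (f i).map (e i)
    have hfw : ∀ i, (f' i).elim B (fun d => min d.2 B) = wt i (f i) := by
      intro i
      cases h : f i <;> simp [f', wt, h]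
    have := le_sum_min_add f' (2 * K) B (by
      intro i i' d h h'
      by_contra hne
      obtain ⟨t, ht, hd⟩ := Option.map_eq_some_iff.1 h
      obtain ⟨t', ht', hd'⟩ := Option.map_eq_some_iff.1 h'
      apply hdet
      let v : ι → ℂ := fun n => (f n).elim 1 (c n)
      let V : ι → ι → ℂ := fun n j => (f n).elim (rem n j) fun t =>
        (x j : ℂ) ^ (e n t).1 * (w j : ℂ) ^ (e n t).2
      have hV : (Matrix.of fun n => g n (f n)) = Matrix.of fun n j => v n * V n j := by
        ext n j
        cases h : f n <;> simp [g, v, V, h]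
      have hc := Matrix.det_mul_column v (Matrix.of V)
      simp only [Matrix.of_apply] at hc
      rw [hV, hc, Matrix.det_zero_of_row_eq hne, mul_zero]
      funext j
      simp [V, ht, ht', hd, hd']) (by
      intro i d h
      obtain ⟨t, ht, rfl⟩ := Option.map_eq_some_iff.1 h
      have := ha i t
      have := hm₁ i
      have := hm₂ i
      omega)
    simp only [hfw] at this
    omega)
  have hTle : ∀ i, T i ≤ Real.exp (|(l i : ℝ)| * Y) := fun i =>
    Real.sum_le_exp_of_nonneg (by positivity) B
  rw [hmat]
  refine key.trans ?_
  gcongr with i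
  · intro i _
    refine Finset.sum_nonneg fun o _ => mul_nonneg ?_ (by positivity)
    cases o with
    | none =>
      have := hTle i
      have := hS0 i
      simp only [bd, Option.elim]
      exact div_nonneg (mul_nonneg (hS0 i) (by linarith [hTle i])) hEB.le
    | some t =>
      simp only [bd, Option.elim]
      positivity
  · rw [Fintype.sum_option]
    simp only [bd, wt, Option.elim]
    rw [div_mul_cancel₀ _ hEB.ne']
    have h1 : ∑ t, ‖c i t‖ * (X ^ (e i t).1 * W ^ (e i t).2) * E ^ min (e i t).2 B ≤
        S i * T i := by
      refine le_trans (Finset.sum_le_sum fun t _ => ?_) (hc i)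
      rw [hY, mul_pow, mul_assoc, mul_assoc]
      have := pow_le_pow_right₀ hE (min_le_left (e i t).2 B)
      gcongr
    have h2 : (1 : ℝ) ≤ Real.exp (|(l i : ℝ)| * Y) := Real.one_le_exp (by positivity)
    have h3 := mul_le_mul_of_nonneg_left h2 (hS0 i)
    linarith

end Determinant

section ConjugateNorm

/-- The ring of Eisenstein integers. -/
abbrev Eis : Type := QuadraticAlgebra ℤ (-1) (-1)

lemma Eis.norm_eq (z : Eis) : z.norm = z.re ^ 2 - z.re * z.im + z.im ^ 2 := by
  rw [QuadraticAlgebra.norm_def]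
  ring

lemma Eis.re_five_pow_mul (n : ℕ) (z : Eis) : (5 ^ n * z).re = 5 ^ n * z.re := by
  have h : (5 : Eis) ^ n = ((5 ^ n : ℤ) : Eis) := by push_cast; rfl
  rw [h, QuadraticAlgebra.re_mul, QuadraticAlgebra.re_intCast, QuadraticAlgebra.im_intCast,
    Int.cast_id]
  ring

lemma Eis.im_five_pow_mul (n : ℕ) (z : Eis) : (5 ^ n * z).im = 5 ^ n * z.im := by
  have h : (5 : Eis) ^ n = ((5 ^ n : ℤ) : Eis) := by push_cast; rfl
  rw [h, QuadraticAlgebra.im_mul, QuadraticAlgebra.re_intCast, QuadraticAlgebra.im_intCast,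
    Int.cast_id]
  ring

lemma Eis.exists_eq_five_mul {f h : Eis} (hf : f ^ 3 = 5 * h) : ∃ g, f = 5 * g := by
  have h1 : f.norm ^ 3 = 25 * h.norm := by
    rw [← map_pow, hf, map_mul]
    congr 1
  have h2 : (5 : ℤ) ∣ f.norm := Int.Prime.dvd_pow' (by norm_num) (k := 3)
    (by rw [h1]; exact ⟨5 * h.norm, by ring⟩)
  rw [Eis.norm_eq] at h2
  have h3 : ∀ x y : ZMod 5, x ^ 2 - x * y + y ^ 2 = 0 → x = 0 ∧ y = 0 := by decide
  have h4 := h3 f.re f.im (by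
    have := (ZMod.intCast_zmod_eq_zero_iff_dvd _ 5).2 h2
    push_cast at this
    exact this)
  obtain ⟨x, hx⟩ := (ZMod.intCast_zmod_eq_zero_iff_dvd _ 5).1 h4.1
  obtain ⟨y, hy⟩ := (ZMod.intCast_zmod_eq_zero_iff_dvd _ 5).1 h4.2
  refine ⟨⟨x, y⟩, ?_⟩
  ext
  · simpa using hx.trans (Eis.re_five_pow_mul 1 ⟨x, y⟩).symm
  · simpa using hy.trans (Eis.im_five_pow_mul 1 ⟨x, y⟩).symm

lemma Eis.five_mul_cancel {f g : Eis} (h : 5 * f = 5 * g) : f = g := by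
  rw [← pow_one (5 : Eis)] at h
  have h1 := congrArg QuadraticAlgebra.re h
  have h2 := congrArg QuadraticAlgebra.im h
  rw [Eis.re_five_pow_mul, Eis.re_five_pow_mul] at h1
  rw [Eis.im_five_pow_mul, Eis.im_five_pow_mul] at h2
  ext
  · show f.re = g.re
    omega
  · show f.im = g.im
    omega

/-- The norm form of the cubic extension of the Eisenstein field generated by a cube root of 5. -/
def cubicForm (f g h : Eis) : Eis := f ^ 3 + 5 * g ^ 3 + 25 * h ^ 3 - 15 * (f * g * h)

lemma cubicForm_descent {f g h : Eis} (hz : cubicForm f g h = 0) :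
    ∃ f', f = 5 * f' ∧ cubicForm g h f' = 0 := by
  obtain ⟨f', rfl⟩ := Eis.exists_eq_five_mul (f := f) (h := 3 * (f * g * h) - g ^ 3 - 5 * h ^ 3) (by
    rw [cubicForm] at hz
    linear_combination hz)
  refine ⟨f', rfl, Eis.five_mul_cancel ?_⟩
  rw [cubicForm] at hz ⊢
  linear_combination hz

lemma pow_dvd_of_cubicForm (n : ℕ) : ∀ {f g h : Eis}, cubicForm f g h = 0 → (5 : Eis) ^ n ∣ f := by
  induction n with
  | zero => simp
  | succ n ih =>
    intro f g h hz
    obtain ⟨f', rfl, h1⟩ := cubicForm_descent hz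
    obtain ⟨g', rfl, h2⟩ := cubicForm_descent h1
    obtain ⟨h', rfl, h3⟩ := cubicForm_descent h2
    rw [pow_succ']
    exact mul_dvd_mul_left _ (ih h3)

lemma eq_zero_of_cubicForm {f g h : Eis} (hz : cubicForm f g h = 0) : f = 0 := by
  have key : ∀ x : ℤ, (∀ n : ℕ, (5 : ℤ) ^ n ∣ x) → x = 0 := by
    intro x hx
    refine Int.eq_zero_of_abs_lt_dvd (hx x.natAbs) ?_
    rw [Int.abs_eq_natAbs]
    exact_mod_cast Nat.lt_pow_self (by norm_num)
  ext
  · refine key _ fun n => ?_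
    obtain ⟨e, he⟩ := pow_dvd_of_cubicForm n hz
    exact ⟨e.re, by rw [he, Eis.re_five_pow_mul]⟩
  · refine key _ fun n => ?_
    obtain ⟨e, he⟩ := pow_dvd_of_cubicForm n hz
    exact ⟨e.im, by rw [he, Eis.im_five_pow_mul]⟩

/-- A primitive cube root of unity. -/
noncomputable def cubeUnity : ℂ := ⟨-1 / 2, √3 / 2⟩

lemma cubeUnity_sq : cubeUnity ^ 2 = -1 - cubeUnity := by
  have h3 : √3 ^ 2 = 3 := Real.sq_sqrt (by norm_num)
  apply Complex.ext <;> simp [cubeUnity, pow_two] <;> nlinarith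

lemma cubeUnity_cube : cubeUnity ^ 3 = 1 := by
  linear_combination (cubeUnity - 1) * cubeUnity_sq

/-- The real cube root of 5. -/
noncomputable def cbrt : ℝ := (5 : ℝ) ^ ((1 : ℝ) / 3)

lemma cbrt_pos : 0 < cbrt := Real.rpow_pos_of_pos (by norm_num) _

lemma cbrt_cube : cbrt ^ 3 = 5 := by
  rw [cbrt, ← Real.rpow_natCast, ← Real.rpow_mul (by norm_num)]
  norm_num

/-- The complex cube roots of 5. -/
noncomputable def root (i : Fin 3) : ℂ := cbrt * cubeUnity ^ (i : ℕ)

lemma root_cube (i : Fin 3) : root i ^ 3 = 5 := by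
  rw [root, mul_pow, ← pow_mul, mul_comm (i : ℕ), pow_mul, cubeUnity_cube, one_pow, mul_one]
  exact_mod_cast cbrt_cube

/-- The embedding of the Eisenstein integers into the complex numbers. -/
noncomputable def eisHom : Eis →ₐ[ℤ] ℂ :=
  QuadraticAlgebra.lift ⟨cubeUnity, by
    rw [← pow_two, cubeUnity_sq]
    simp
    ring⟩

lemma eisHom_apply (z : Eis) : eisHom z = z.re + z.im * cubeUnity := by
  simp [eisHom, QuadraticAlgebra.lift]

lemma sq_norm_eisHom (z : Eis) : ‖eisHom z‖ ^ 2 = (z.norm : ℤ) := by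
  have h3 : √3 ^ 2 = 3 := Real.sq_sqrt (by norm_num)
  rw [eisHom_apply, Eis.norm_eq, ← Complex.normSq_eq_norm_sq, Complex.normSq_apply]
  simp [cubeUnity]
  nlinarith

lemma one_le_norm_eisHom {z : Eis} (hz : z ≠ 0) : 1 ≤ ‖eisHom z‖ := by
  have h1 : 0 < z.norm := by
    rw [Eis.norm_eq]
    by_contra! hle
    apply hz
    have h4 : z.im = 0 := by
      have : z.im ^ 2 = 0 := by nlinarith [sq_nonneg (2 * z.re - z.im), sq_nonneg z.im]
      exact pow_eq_zero_iff two_ne_zero |>.1 this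
    have h5 : z.re = 0 := by
      rw [h4] at hle
      have : z.re ^ 2 = 0 := by nlinarith [sq_nonneg z.re]
      exact pow_eq_zero_iff two_ne_zero |>.1 this
    ext
    · exact h5
    · exact h4
  have h2 : (1 : ℝ) ≤ ‖eisHom z‖ ^ 2 := by
    rw [sq_norm_eisHom]
    exact_mod_cast h1
  nlinarith [norm_nonneg (eisHom z)]

/-- The conjugate vectors of the integers `f + g * θ + h * θ ^ 2`, where `θ ^ 3 = 5` and `f`, `g`,
`h` are Eisenstein integers. -/
noncomputable def conjRing : Subring (Fin 3 → ℂ) where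
  carrier := {z | ∃ f g h : Eis, ∀ i,
    z i = eisHom f + eisHom g * root i + eisHom h * root i ^ 2}
  zero_mem' := ⟨0, 0, 0, by simp⟩
  one_mem' := ⟨1, 0, 0, by simp⟩
  add_mem' := by
    rintro z z' ⟨f, g, h, H⟩ ⟨f', g', h', H'⟩
    refine ⟨f + f', g + g', h + h', fun i => ?_⟩
    rw [Pi.add_apply, H, H', map_add, map_add, map_add]
    ring
  neg_mem' := by
    rintro z ⟨f, g, h, H⟩
    refine ⟨-f, -g, -h, fun i => ?_⟩
    rw [Pi.neg_apply, H, map_neg, map_neg, map_neg]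
    ring
  mul_mem' := by
    rintro z z' ⟨f, g, h, H⟩ ⟨f', g', h', H'⟩
    refine ⟨f * f' + 5 * (g * h' + h * g'), f * g' + g * f' + 5 * (h * h'),
      f * h' + g * g' + h * f', fun i => ?_⟩
    rw [Pi.mul_apply, H, H']
    simp only [map_add, map_mul, map_ofNat]
    linear_combination (eisHom g * eisHom h' + eisHom h * eisHom g' +
      eisHom h * eisHom h' * root i) * root_cube i

lemma prod_eq_eisHom_cubicForm {z : Fin 3 → ℂ} {f g h : Eis}
    (H : ∀ i, z i = eisHom f + eisHom g * root i + eisHom h * root i ^ 2) :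
    ∏ i, z i = eisHom (cubicForm f g h) := by
  have hc : (cbrt : ℂ) ^ 3 = 5 := by exact_mod_cast cbrt_cube
  have e1 := cubeUnity_sq
  rw [Fin.prod_univ_three, H, H, H, cubicForm]
  simp only [map_add, map_sub, map_mul, map_pow, map_ofNat]
  generalize eisHom f = F
  generalize eisHom g = G
  generalize eisHom h = H
  have r0 : root 0 = cbrt := by simp [root]
  have r1 : root 1 = cbrt * cubeUnity := by simp [root]
  have r2 : root 2 = cbrt * (-1 - cubeUnity) := by simp [root, e1]
  have s1 : root 1 ^ 2 = cbrt ^ 2 * (-1 - cubeUnity) := by rw [r1, mul_pow, e1]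
  have s2 : root 2 ^ 2 = cbrt ^ 2 * cubeUnity := by
    rw [r2]
    linear_combination (cbrt : ℂ) ^ 2 * e1
  rw [s1, s2, r0, r1, r2]
  linear_combination (-(F + G * cbrt + H * cbrt ^ 2) * (G * cbrt - H * cbrt ^ 2) ^ 2) * e1 +
    (G ^ 3 + H ^ 3 * (cbrt ^ 3 + 5) - 3 * F * G * H) * hc

lemma one_le_prod_norm {z : Fin 3 → ℂ} (hz : z ∈ conjRing) {j : Fin 3} (hj : z j ≠ 0) :
    1 ≤ ∏ i, ‖z i‖ := by
  obtain ⟨f, g, h, H⟩ := hz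
  rw [← norm_prod, prod_eq_eisHom_cubicForm H]
  refine one_le_norm_eisHom fun h0 => hj ?_
  obtain ⟨f', rfl, h1⟩ := cubicForm_descent h0
  obtain ⟨g', rfl, h2⟩ := cubicForm_descent h1
  rw [H, eq_zero_of_cubicForm h0, eq_zero_of_cubicForm h1, eq_zero_of_cubicForm h2]
  simp

lemma const_mem_conjRing (x : ℤ) : (fun _ => (x : ℂ)) ∈ conjRing :=
  ⟨x, 0, 0, by simp⟩

lemma root_shift_mem_conjRing (k : Fin 3) : (fun i => root (i + k)) ∈ conjRing := by
  have h : ∀ i : Fin 3, root (i + k) = cubeUnity ^ (k : ℕ) * root i := by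
    intro i
    have h3 := cubeUnity_cube
    fin_cases i <;> fin_cases k <;> simp [root] <;> try ring_nf
    · linear_combination (-(cbrt : ℂ)) * h3
    · linear_combination (-(cbrt : ℂ)) * h3
    · linear_combination (-(cbrt : ℂ) * cubeUnity) * h3
  refine ⟨0, QuadraticAlgebra.omega ^ (k : ℕ), 0, fun i => ?_⟩
  dsimp only
  rw [h, map_pow, map_zero, eisHom_apply]
  simp

end ConjugateNorm

section MainInequality

/-- The conjugates of the entries of the interpolation determinant, after clearing denominators. -/
noncomputable def entry (a a' e e' : Fin 3 → ℂ) (R S : ℕ) (b k : ℤ) (m₁ m₂ : ℕ) (l : ℤ)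
    (p : ℤ × ℤ × ℤ) : Fin 3 → ℂ :=
  ((Ring.choose (p.2.1 - b * p.1) m₁ : ℤ) : Fin 3 → ℂ) *
    ((Ring.choose (p.2.2 - k * p.1) m₂ : ℤ) : Fin 3 → ℂ) *
    (a ^ (R * |l| + p.1 * l).toNat * a' ^ (R * |l| - p.1 * l).toNat *
      (e ^ (S * |l| + p.2.1 * l).toNat * e' ^ (S * |l| - p.2.1 * l).toNat))

lemma entry_mem {a a' e e' : Fin 3 → ℂ} (ha : a ∈ conjRing) (ha' : a' ∈ conjRing)
    (he : e ∈ conjRing) (he' : e' ∈ conjRing) (R S : ℕ) (b k : ℤ) (m₁ m₂ : ℕ) (l : ℤ)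
    (p : ℤ × ℤ × ℤ) : entry a a' e e' R S b k m₁ m₂ l p ∈ conjRing :=
  mul_mem (mul_mem (intCast_mem _ _) (intCast_mem _ _)) (mul_mem (mul_mem (pow_mem ha _)
    (pow_mem ha' _)) (mul_mem (pow_mem he _) (pow_mem he' _)))

lemma abs_mul_le_of_abs_le {R : ℕ} {r l : ℤ} (hr : |r| ≤ R) : |r * l| ≤ R * |l| := by
  rw [abs_mul]
  exact mul_le_mul_of_nonneg_right hr (abs_nonneg _)

lemma pow_toNat_mul_pow_toNat {x y : ℂ} (hx : x ≠ 0) (hy : y ≠ 0) {R : ℕ} {r l : ℤ}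
    (hr : |r| ≤ R) : x ^ (R * |l| + r * l).toNat * y ^ (R * |l| - r * l).toNat =
      (x * y) ^ (R * l.natAbs) * ((x / y) ^ r) ^ l := by
  have h := abs_le.1 (abs_mul_le_of_abs_le (l := l) hr)
  rw [← zpow_natCast x, ← zpow_natCast y, ← zpow_natCast (x * y), Int.toNat_of_nonneg (by linarith),
    Int.toNat_of_nonneg (by linarith), zpow_add₀ hx, zpow_sub₀ hy, ← zpow_mul, div_zpow,
    mul_zpow, Nat.cast_mul, Int.natCast_natAbs]
  have := zpow_ne_zero (r * l) hy
  field_simp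

lemma norm_pow_toNat_mul_pow_toNat_le {x y : ℂ} {M : ℝ} (hx : ‖x‖ ≤ Real.exp M)
    (hy : ‖y‖ ≤ Real.exp M) {R : ℕ} {r l : ℤ} (hr : |r| ≤ R) :
    ‖x ^ (R * |l| + r * l).toNat * y ^ (R * |l| - r * l).toNat‖ ≤
      Real.exp (2 * R * M * |(l : ℝ)|) := by
  have h := abs_le.1 (abs_mul_le_of_abs_le (l := l) hr)
  have e : (R * |l| + r * l).toNat + (R * |l| - r * l).toNat = 2 * R * l.natAbs := by
    zify
    rw [Int.toNat_of_nonneg (by linarith), Int.toNat_of_nonneg (by linarith)]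
    ring
  calc _ ≤ Real.exp M ^ (R * |l| + r * l).toNat * Real.exp M ^ (R * |l| - r * l).toNat := by
        rw [norm_mul, norm_pow, norm_pow]
        gcongr
    _ = Real.exp (2 * R * M * |(l : ℝ)|) := by
        rw [← pow_add, e, ← Real.exp_nat_mul]
        push_cast
        rw [Nat.cast_natAbs]
        push_cast
        congr 1
        ring

lemma norm_entry_le {a a' e e' : Fin 3 → ℂ} {R S K : ℕ} {b k : ℤ} {m₁ m₂ : ℕ} {l : ℤ}
    {p : ℤ × ℤ × ℤ} {v : Fin 3} {α η q : ℝ} (hm₁ : m₁ ≤ K) (hm₂ : m₂ ≤ K)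
    (ha : ‖a v‖ ≤ Real.exp α) (ha' : ‖a' v‖ ≤ Real.exp α) (he : ‖e v‖ ≤ Real.exp η)
    (he' : ‖e' v‖ ≤ Real.exp η) (hr : |p.1| ≤ R) (hs : |p.2.1| ≤ S)
    (hx : |((p.2.1 - b * p.1 : ℤ) : ℝ)| + K ≤ q) (hy : |((p.2.2 - k * p.1 : ℤ) : ℝ)| + K ≤ q) :
    ‖entry a a' e e' R S b k m₁ m₂ l p v‖ ≤ q ^ m₁ / m₁.factorial * (q ^ m₂ / m₂.factorial) *
      Real.exp (|(l : ℝ)| * (2 * R * α + 2 * S * η)) := by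
  have h1 := norm_chooseFun_le hm₁ (q := q) (z := ((p.2.1 - b * p.1 : ℤ) : ℂ))
    (by rwa [Complex.norm_intCast])
  have h2 := norm_chooseFun_le hm₂ (q := q) (z := ((p.2.2 - k * p.1 : ℤ) : ℂ))
    (by rwa [Complex.norm_intCast])
  have h3 := norm_pow_toNat_mul_pow_toNat_le ha ha' (l := l) hr
  have h4 := norm_pow_toNat_mul_pow_toNat_le he he' (l := l) hs
  rw [chooseFun, ← cast_choose] at h1 h2
  simp only [entry, Pi.mul_apply, Pi.pow_apply, Pi.intCast_apply]
  rw [norm_mul, norm_mul, norm_mul (_ * _) (_ * _)]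
  have e : Real.exp (|(l : ℝ)| * (2 * R * α + 2 * S * η)) =
      Real.exp (2 * R * α * |(l : ℝ)|) * Real.exp (2 * S * η * |(l : ℝ)|) := by
    rw [← Real.exp_add]
    ring_nf
  rw [e]
  have h5 := (norm_nonneg _).trans h1
  have h6 := mul_nonneg h5 ((norm_nonneg _).trans h2)
  gcongr

lemma one_le_prod_norm_det {ι : Type*} [Fintype ι] [DecidableEq ι] (F : ι → ι → Fin 3 → ℂ)
    (hF : ∀ i j, F i j ∈ conjRing) {v : Fin 3} (hv : (Matrix.of fun i j => F i j v).det ≠ 0) :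
    1 ≤ ∏ w, ‖(Matrix.of fun i j => F i j w).det‖ := by
  have h1 : ∀ w, (Matrix.of F).det w = (Matrix.of fun i j => F i j w).det := fun w =>
    RingHom.map_det (Pi.evalRingHom (fun _ : Fin 3 => ℂ) w) (Matrix.of F)
  simp only [← h1] at hv ⊢
  refine one_le_prod_norm ?_ hv
  rw [Matrix.det_apply]
  exact sum_mem fun σ _ => by
    rcases Int.units_eq_one_or (Equiv.Perm.sign σ) with h | h
    · rw [h, one_smul]
      exact prod_mem fun i _ => hF _ _
    · rw [h, Units.neg_smul, one_smul]
      exact neg_mem (prod_mem fun i _ => hF _ _)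

lemma entry_eq_mul_basisFun {a a' e e' : Fin 3 → ℂ} {R S K H : ℕ} (b k : ℤ)
    (i : Fin K × Fin K × Fin (2 * H + 1)) {p : ℤ × ℤ × ℤ} {v : Fin 3} (ha : a v ≠ 0)
    (ha' : a' v ≠ 0) (he : e v ≠ 0) (he' : e' v ≠ 0) (hr : |p.1| ≤ R) (hs : |p.2.1| ≤ S) :
    entry a a' e e' R S b k i.1 i.2.1 ((i.2.2 : ℕ) - H : ℤ) p v =
      ((a v * a' v) ^ (R * ((i.2.2 : ℕ) - H : ℤ).natAbs) *
        (e v * e' v) ^ (S * ((i.2.2 : ℕ) - H : ℤ).natAbs)) *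
      ((((a v / a' v) ^ p.1 * (e v / e' v) ^ p.2.1) ^ H)⁻¹ *
        basisFun b k (a v / a' v) (e v / e' v) i p) := by
  have hg : (a v / a' v) ^ p.1 * (e v / e' v) ^ p.2.1 ≠ 0 :=
    mul_ne_zero (zpow_ne_zero _ (div_ne_zero ha ha')) (zpow_ne_zero _ (div_ne_zero he he'))
  simp only [entry, Pi.mul_apply, Pi.pow_apply, Pi.intCast_apply, basisFun]
  rw [pow_toNat_mul_pow_toNat ha ha' hr, pow_toNat_mul_pow_toNat he he' hs]
  have h1 : ((a v / a' v) ^ p.1 * (e v / e' v) ^ p.2.1) ^ ((i.2.2 : ℕ) - H : ℤ) =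
      (((a v / a' v) ^ p.1 * (e v / e' v) ^ p.2.1) ^ H)⁻¹ *
        ((a v / a' v) ^ p.1 * (e v / e' v) ^ p.2.1) ^ (i.2.2 : ℕ) := by
    rw [zpow_sub₀ hg, zpow_natCast, zpow_natCast, div_eq_inv_mul]
  rw [mul_zpow] at h1
  linear_combination ((Ring.choose (p.2.1 - b * p.1) (i.1 : ℕ) : ℤ) : ℂ) *
    ((Ring.choose (p.2.2 - k * p.1) (i.2.1 : ℕ) : ℤ) : ℂ) *
    (a v * a' v) ^ (R * ((i.2.2 : ℕ) - H : ℤ).natAbs) *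
        (e v * e' v) ^ (S * ((i.2.2 : ℕ) - H : ℤ).natAbs) * h1

lemma det_entry_ne_zero {a a' e e' : Fin 3 → ℂ} {R S K H : ℕ} {b k : ℤ} {v : Fin 3}
    (ha : a v ≠ 0) (ha' : a' v ≠ 0) (he : e v ≠ 0) (he' : e' v ≠ 0)
    (p : Fin K × Fin K × Fin (2 * H + 1) → ℤ × ℤ × ℤ) (hr : ∀ j, |(p j).1| ≤ R)
    (hs : ∀ j, |(p j).2.1| ≤ S)
    (hdet : (Matrix.of fun i j =>
      basisFun (K := K) (L := 2 * H) b k (a v / a' v) (e v / e' v) i (p j)).det ≠ 0) :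
    (Matrix.of fun i j : Fin K × Fin K × Fin (2 * H + 1) =>
      entry a a' e e' R S b k i.1 i.2.1 ((i.2.2 : ℕ) - H : ℤ) (p j) v).det ≠ 0 := by
  have h1 := fun (i : Fin K × Fin K × Fin (2 * H + 1)) j =>
    entry_eq_mul_basisFun (R := R) (S := S) b k i ha ha' he he' (hr j) (hs j)
  simp only [h1]
  have h2 := Matrix.det_mul_column (fun i : Fin K × Fin K × Fin (2 * H + 1) =>
    (a v * a' v) ^ (R * ((i.2.2 : ℕ) - H : ℤ).natAbs) *
      (e v * e' v) ^ (S * ((i.2.2 : ℕ) - H : ℤ).natAbs))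
    (Matrix.of fun i j => (((a v / a' v) ^ (p j).1 * (e v / e' v) ^ (p j).2.1) ^ H)⁻¹ *
        basisFun b k (a v / a' v) (e v / e' v) i (p j))
  have h3 := Matrix.det_mul_row (fun j => (((a v / a' v) ^ (p j).1 * (e v / e' v) ^ (p j).2.1) ^ H)⁻¹)
    (Matrix.of fun i j => basisFun b k (a v / a' v) (e v / e' v) i (p j))
  simp only [Matrix.of_apply] at h2 h3
  rw [h2, h3]
  have hg : ∀ j, (a v / a' v) ^ (p j).1 * (e v / e' v) ^ (p j).2.1 ≠ 0 := fun j =>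
    mul_ne_zero (zpow_ne_zero _ (div_ne_zero ha ha')) (zpow_ne_zero _ (div_ne_zero he he'))
  refine mul_ne_zero (Finset.prod_ne_zero_iff.2 fun i _ => mul_ne_zero
    (pow_ne_zero _ (mul_ne_zero ha ha')) (pow_ne_zero _ (mul_ne_zero he he')))
    (mul_ne_zero (Finset.prod_ne_zero_iff.2 fun j _ => inv_ne_zero (pow_ne_zero _ (hg j))) hdet)

lemma entry_eq_analytic {a a' e e' : Fin 3 → ℂ} {R S m₁ m₂ : ℕ} {b k : ℤ} {l : ℤ}
    {p : ℤ × ℤ × ℤ} {v : Fin 3} {φ θ lam : ℝ} (ha : a v ≠ 0) (ha' : a' v ≠ 0) (he : e v ≠ 0)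
    (he' : e' v ≠ 0) (hA : a v / a' v = Complex.exp (φ * Complex.I))
    (hu : e v / e' v = Complex.exp (θ * Complex.I)) (hlam : φ + b * θ + 2 * Real.pi * k = lam)
    (hr : |p.1| ≤ R) (hs : |p.2.1| ≤ S) :
    entry a a' e e' R S b k m₁ m₂ l p v =
      ((a v * a' v) ^ (R * l.natAbs) * (e v * e' v) ^ (S * l.natAbs)) *
      (chooseFun m₁ ((p.2.1 - b * p.1 : ℤ) : ℝ) * chooseFun m₂ ((p.2.2 - k * p.1 : ℤ) : ℝ) *
        Complex.exp (Complex.I * (l * (((θ * (p.2.1 - b * p.1 : ℤ) +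
          2 * Real.pi * (p.2.2 - k * p.1 : ℤ) : ℝ) : ℂ) + (p.1 * lam : ℝ))))) := by
  have h1 : Complex.exp (Complex.I * (l * (((θ * (p.2.1 - b * p.1 : ℤ) +
      2 * Real.pi * (p.2.2 - k * p.1 : ℤ) : ℝ) : ℂ) + (p.1 * lam : ℝ)))) =
      ((a v / a' v) ^ p.1) ^ l * ((e v / e' v) ^ p.2.1) ^ l := by
    rw [hA, hu, ← Complex.exp_int_mul, ← Complex.exp_int_mul, ← Complex.exp_int_mul,
      ← Complex.exp_int_mul, ← Complex.exp_add, Complex.exp_eq_exp_iff_exists_int]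
    refine ⟨l * p.2.2, ?_⟩
    rw [← hlam]
    push_cast
    ring
  rw [h1]
  simp only [entry, Pi.mul_apply, Pi.pow_apply, Pi.intCast_apply]
  rw [pow_toNat_mul_pow_toNat ha ha' hr, pow_toNat_mul_pow_toNat he he' hs, cast_choose,
    cast_choose, chooseFun, chooseFun, Complex.ofReal_intCast, Complex.ofReal_intCast]
  ring

lemma pow_le_prod_of_interpolation {a a' e e' : Fin 3 → ℂ} (hac : a ∈ conjRing)
    (hac' : a' ∈ conjRing) (hec : e ∈ conjRing) (hec' : e' ∈ conjRing) {R S K H B O : ℕ} {b k : ℤ}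
    {φ θ lam α η q X W E : ℝ} (ha : a 0 ≠ 0) (ha' : a' 0 ≠ 0) (he : e 0 ≠ 0) (he' : e' 0 ≠ 0)
    (hA : a 0 / a' 0 = Complex.exp (φ * Complex.I))
    (hu : e 0 / e' 0 = Complex.exp (θ * Complex.I)) (hlam : φ + b * θ + 2 * Real.pi * k = lam)
    (hna : ∀ v, ‖a v‖ ≤ Real.exp α) (hna' : ∀ v, ‖a' v‖ ≤ Real.exp α)
    (hne : ∀ v, ‖e v‖ ≤ Real.exp η) (hne' : ∀ v, ‖e' v‖ ≤ Real.exp η)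
    (p : Fin K × Fin K × Fin (2 * H + 1) → ℤ × ℤ × ℤ) (hr : ∀ j, |(p j).1| ≤ R)
    (hs : ∀ j, |(p j).2.1| ≤ S)
    (hdet : (Matrix.of fun i j =>
      basisFun (K := K) (L := 2 * H) b k (a 0 / a' 0) (e 0 / e' 0) i (p j)).det ≠ 0)
    (hX : 0 ≤ X) (hW : 0 ≤ W) (hE : 1 ≤ E)
    (hx : ∀ j, |(((p j).2.1 - b * (p j).1 : ℤ) : ℝ)| ≤ X) (hq : X + K ≤ q)
    (hy : ∀ j, |(((p j).2.2 - k * (p j).1 : ℤ) : ℝ)| + K ≤ q)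
    (hq' : |θ| / (2 * Real.pi) * X + 1 / (2 * Real.pi) * (W * E) + K ≤ q)
    (hw : ∀ j, |θ * ((p j).2.1 - b * (p j).1 : ℤ) + 2 * Real.pi * ((p j).2.2 - k * (p j).1 : ℤ)| ≤ W)
    (hB : H * (R * |lam|) * E ^ B ≤ 1)
    (hO : O + 2 * K * (B * (B + 1) / 2) ≤ K * (K * (2 * H + 1)) * B) :
    E ^ O ≤ (((K * (K * (2 * H + 1))).factorial : ℕ) : ℝ) ^ 3 *
      ∏ i : Fin K × Fin K × Fin (2 * H + 1),
        ((q ^ (i.1 : ℕ) / (i.1 : ℕ).factorial * (q ^ (i.2.1 : ℕ) / (i.2.1 : ℕ).factorial)) ^ 3 *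
          (2 * Real.exp (|((i.2.2 : ℕ) - H : ℝ)| * (W * E + 3 * (2 * R * α + 2 * S * η))))) := by
  set l : Fin K × Fin K × Fin (2 * H + 1) → ℤ := fun i => ((i.2.2 : ℕ) - H : ℤ) with hl
  have hcard : Fintype.card (Fin K × Fin K × Fin (2 * H + 1)) = K * (K * (2 * H + 1)) := by
    simp
  set F : Fin K × Fin K × Fin (2 * H + 1) → Fin K × Fin K × Fin (2 * H + 1) → Fin 3 → ℂ :=
    fun i j => entry a a' e e' R S b k i.1 i.2.1 (l i) (p j) with hF
  set Q : Fin K × Fin K × Fin (2 * H + 1) → ℝ := fun i =>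
    q ^ (i.1 : ℕ) / (i.1 : ℕ).factorial * (q ^ (i.2.1 : ℕ) / (i.2.1 : ℕ).factorial) with hQ
  set Z := 2 * R * α + 2 * S * η with hZ
  have hlH : ∀ i, |(l i : ℝ)| ≤ H := by
    intro i
    have := i.2.2.2
    rw [hl]
    push_cast
    rw [abs_le]
    have h1 : ((i.2.2 : ℕ) : ℝ) ≤ 2 * H := by exact_mod_cast Nat.lt_succ_iff.1 this
    have h2 : (0 : ℝ) ≤ ((i.2.2 : ℕ) : ℝ) := Nat.cast_nonneg _
    constructor <;> linarith
  have hcast : ∀ i, ((l i : ℤ) : ℝ) = (i.2.2 : ℕ) - H := fun i => by rw [hl]; push_cast; ring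
  have h1 := one_le_prod_norm_det F (fun i j => entry_mem hac hac' hec hec' _ _ _ _ _ _ _ _)
    (v := 0) (det_entry_ne_zero ha ha' he he' p hr hs hdet)
  have hq0 : 0 ≤ q := le_trans (by positivity) hq
  have hQ0 : ∀ i, 0 ≤ Q i := fun i => by positivity
  have h2 : ∀ v, ‖(Matrix.of fun i j => F i j v).det‖ ≤
      (K * (K * (2 * H + 1))).factorial * ∏ i, (Q i * Real.exp (|(l i : ℝ)| * Z)) := by
    intro v
    rw [← hcard]
    refine norm_det_le _ _ fun i j => ?_
    exact norm_entry_le i.1.2.le i.2.1.2.le (hna v) (hna' v) (hne v) (hne' v) (hr j) (hs j)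
      ((add_le_add_left (hx j) _).trans hq) (hy j)
  have h3 : ‖(Matrix.of fun i j => F i j 0).det‖ * E ^ O ≤ (∏ i, Real.exp (|(l i : ℝ)| * Z)) *
      ((K * (K * (2 * H + 1))).factorial *
        ∏ i, (Q i * (2 * Real.exp (|(l i : ℝ)| * (W * E))))) := by
    have e1 : (Matrix.of fun i j => F i j 0) = Matrix.of fun i j =>
        ((a 0 * a' 0) ^ (R * (l i).natAbs) * (e 0 * e' 0) ^ (S * (l i).natAbs)) *
        (Matrix.of fun i j => (chooseFun i.1 (((p j).2.1 - b * (p j).1 : ℤ) : ℝ) *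
          chooseFun i.2.1 (((p j).2.2 - k * (p j).1 : ℤ) : ℝ) *
          Complex.exp (Complex.I * (l i * (((θ * ((p j).2.1 - b * (p j).1 : ℤ) +
          2 * Real.pi * ((p j).2.2 - k * (p j).1 : ℤ) : ℝ) : ℂ) +
            (((p j).1 * lam : ℝ) : ℂ)))))) i j := by
      ext i j
      exact entry_eq_analytic ha ha' he he' hA hu hlam (hr j) (hs j)
    rw [e1, Matrix.det_mul_column, norm_mul, mul_assoc, ← hcard]
    refine mul_le_mul ?_ ?_ (by positivity) (by positivity)
    · rw [norm_prod]
      refine Finset.prod_le_prod (fun _ _ => norm_nonneg _) fun i _ => ?_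
      have g1 := norm_pow_toNat_mul_pow_toNat_le (hna 0) (hna' 0) (R := R) (r := 0) (l := l i)
        (by simp)
      have g2 := norm_pow_toNat_mul_pow_toNat_le (hne 0) (hne' 0) (R := S) (r := 0) (l := l i)
        (by simp)
      rw [pow_toNat_mul_pow_toNat ha ha' (by simp), zpow_zero, one_zpow, mul_one] at g1
      rw [pow_toNat_mul_pow_toNat he he' (by simp), zpow_zero, one_zpow, mul_one] at g2
      rw [norm_mul]
      refine (mul_le_mul g1 g2 (norm_nonneg _) (Real.exp_nonneg _)).trans (le_of_eq ?_)
      rw [← Real.exp_add, hZ]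
      ring_nf
    · refine norm_analytic_det_mul_pow_le (fun i => (i.1 : ℕ)) (fun i => (i.2.1 : ℕ)) l
        (fun i => i.1.2) (fun i => i.2.1.2) hX hW hE hlH hq hq'
        (fun j => (((p j).2.1 - b * (p j).1 : ℤ) : ℝ)) (fun j => (((p j).2.2 - k * (p j).1 : ℤ) : ℝ))
        (fun j => (p j).1 * lam) hx hw (δ₀ := R * |lam|) (fun j => ?_) hB O (by rw [hcard]; exact hO)
      rw [abs_mul]
      have : |((p j).1 : ℝ)| ≤ R := by exact_mod_cast hr j
      gcongr
  have hE0 : 0 ≤ E ^ O := by positivity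
  have hN0 : ∀ v, 0 ≤ ‖(Matrix.of fun i j => F i j v).det‖ := fun v => norm_nonneg _
  rw [Fin.prod_univ_three] at h1
  calc E ^ O ≤ (‖(Matrix.of fun i j => F i j 0).det‖ * ‖(Matrix.of fun i j => F i j 1).det‖ *
        ‖(Matrix.of fun i j => F i j 2).det‖) * E ^ O := le_mul_of_one_le_left hE0 h1
    _ = (‖(Matrix.of fun i j => F i j 0).det‖ * E ^ O) * ‖(Matrix.of fun i j => F i j 1).det‖ *
        ‖(Matrix.of fun i j => F i j 2).det‖ := by ring
    _ ≤ ((∏ i, Real.exp (|(l i : ℝ)| * Z)) * ((K * (K * (2 * H + 1))).factorial *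
        ∏ i, (Q i * (2 * Real.exp (|(l i : ℝ)| * (W * E)))))) *
        ((K * (K * (2 * H + 1))).factorial * ∏ i, (Q i * Real.exp (|(l i : ℝ)| * Z))) *
        ((K * (K * (2 * H + 1))).factorial * ∏ i, (Q i * Real.exp (|(l i : ℝ)| * Z))) := by
        have := (mul_nonneg (hN0 0) hE0).trans h3
        refine mul_le_mul (mul_le_mul h3 (h2 1) (hN0 _) this) (h2 2) (hN0 _) ?_
        exact mul_nonneg this ((hN0 1).trans (h2 1))
    _ = (((K * (K * (2 * H + 1))).factorial : ℕ) : ℝ) ^ 3 * ((∏ i, Real.exp (|(l i : ℝ)| * Z)) *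
        (∏ i, (Q i * (2 * Real.exp (|(l i : ℝ)| * (W * E))))) *
        (∏ i, (Q i * Real.exp (|(l i : ℝ)| * Z))) *
        ∏ i, (Q i * Real.exp (|(l i : ℝ)| * Z))) := by ring
    _ = _ := by
        rw [← Finset.prod_mul_distrib, ← Finset.prod_mul_distrib, ← Finset.prod_mul_distrib]
        congr 1
        refine Finset.prod_congr rfl fun i _ => ?_
        have e2 : Real.exp (|(l i : ℝ)| * (W * E + 3 * Z)) = Real.exp (|(l i : ℝ)| * (W * E)) *
            Real.exp (|(l i : ℝ)| * Z) ^ 3 := by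
          rw [← Real.exp_nat_mul, ← Real.exp_add]
          push_cast
          ring_nf
        rw [← hcast, e2]
        ring

end MainInequality

section Parameters

lemma sum_fin_cast (K : ℕ) : ∑ m : Fin K, ((m : ℕ) : ℝ) ≤ K * K / 2 := by
  have h : ∀ K : ℕ, ∑ m ∈ Finset.range K, (m : ℝ) = K * (K - 1) / 2 := by
    intro K
    induction K with
    | zero => simp
    | succ K ih =>
      rw [Finset.sum_range_succ, ih]
      push_cast
      ring
  rw [Fin.sum_univ_eq_sum_range (fun m => (m : ℝ)) K, h]
  have : (0 : ℝ) ≤ K := Nat.cast_nonneg _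
  nlinarith

lemma sum_fin_abs_sub : ∑ m : Fin (2 * 350 + 1), |((m : ℕ) : ℝ) - (350 : ℕ)| = 122850 := by
  have h : ∀ m : ℕ, |(m : ℝ) - (350 : ℕ)| = (((m : ℤ) - 350).natAbs : ℕ) := by
    intro m
    rw [Nat.cast_natAbs]
    push_cast
    rfl
  simp only [h]
  rw [Fin.sum_univ_eq_sum_range (fun m => ((((m : ℤ) - 350).natAbs : ℕ) : ℝ)), ← Nat.cast_sum]
  have : ∑ m ∈ Finset.range (2 * 350 + 1), ((m : ℤ) - 350).natAbs = 122850 := by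
    decide +kernel
  rw [this]
  norm_num

lemma factorial_le_exp {K : ℕ} (hK : 10 ^ 13 ≤ K) :
    ((K * (K * (2 * 350 + 1))).factorial : ℝ) ≤
      Real.exp (701 * (K : ℝ) ^ 2 * (K / 1000)) := by
  have hK' : (10 : ℝ) ^ 13 ≤ K := by exact_mod_cast hK
  have h1 := Real.pow_div_factorial_le_exp (K / 1000 : ℝ) (by positivity) 3
  have h2 : (K * (K * (2 * 350 + 1)) : ℝ) ≤ Real.exp (K / 1000) := by
    refine le_trans ?_ h1
    norm_num [Nat.factorial]
    nlinarith [sq_nonneg (K : ℝ)]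
  have h3 : ((K * (K * (2 * 350 + 1))).factorial : ℝ) ≤
      ((K * (K * (2 * 350 + 1)) : ℕ) : ℝ) ^ (K * (K * (2 * 350 + 1))) := by
    exact_mod_cast Nat.factorial_le_pow _
  refine h3.trans ?_
  refine (pow_le_pow_left₀ (by positivity) (show _ ≤ Real.exp (K / 1000) by
    push_cast; linarith) _).trans (le_of_eq ?_)
  rw [← Real.exp_nat_mul]
  push_cast
  ring_nf

lemma interpolation_contradiction {K : ℕ} (hK : 10 ^ 13 ≤ K) {q Y : ℝ}
    (hq : q = K * Real.exp 26.7) (hY : Y ≤ 1.35 * K)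
    (h : Real.exp 2 ^ (122849 * K ^ 3) ≤ (((K * (K * (2 * 350 + 1))).factorial : ℕ) : ℝ) ^ 3 *
      ∏ i : Fin K × Fin K × Fin (2 * 350 + 1),
        ((q ^ (i.1 : ℕ) / (i.1 : ℕ).factorial * (q ^ (i.2.1 : ℕ) / (i.2.1 : ℕ).factorial)) ^ 3 *
          (2 * Real.exp (|((i.2.2 : ℕ) - (350 : ℕ) : ℝ)| * Y)))) : False := by
  have hK' : (10 : ℝ) ^ 13 ≤ K := by exact_mod_cast hK
  have hq1 : ∀ m : ℕ, q ^ m / m.factorial ≤ Real.exp (26.7 * m + K) := by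
    intro m
    rw [hq, mul_pow, mul_div_right_comm, Real.exp_add, mul_comm (26.7 : ℝ), Real.exp_nat_mul,
      mul_comm]
    gcongr
    exact Real.pow_div_factorial_le_exp _ (by positivity) m
  have hq0 : 0 ≤ q := by rw [hq]; positivity
  have h2 : (2 : ℝ) ≤ Real.exp 1 := by linarith [Real.add_one_le_exp (1 : ℝ)]
  have h3 : ∏ i : Fin K × Fin K × Fin (2 * 350 + 1),
        ((q ^ (i.1 : ℕ) / (i.1 : ℕ).factorial * (q ^ (i.2.1 : ℕ) / (i.2.1 : ℕ).factorial)) ^ 3 *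
          (2 * Real.exp (|((i.2.2 : ℕ) - (350 : ℕ) : ℝ)| * Y))) ≤
      Real.exp (∑ i : Fin K × Fin K × Fin (2 * 350 + 1), (80.1 * ((i.1 : ℕ) : ℝ) +
        80.1 * ((i.2.1 : ℕ) : ℝ) + (6 * K + 1) + |((i.2.2 : ℕ) - (350 : ℕ) : ℝ)| * Y)) := by
    rw [Real.exp_sum]
    refine Finset.prod_le_prod (fun i _ => by positivity) fun i _ => ?_
    calc _ ≤ (Real.exp (26.7 * (i.1 : ℕ) + K) * Real.exp (26.7 * (i.2.1 : ℕ) + K)) ^ 3 *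
          (Real.exp 1 * Real.exp (|((i.2.2 : ℕ) - (350 : ℕ) : ℝ)| * Y)) := by
          gcongr
          · exact hq1 _
          · exact hq1 _
      _ = _ := by
          rw [← Real.exp_add, ← Real.exp_add, ← Real.exp_nat_mul, ← Real.exp_add]
          congr 1
          push_cast
          ring
  have h4 : ∑ i : Fin K × Fin K × Fin (2 * 350 + 1), (80.1 * ((i.1 : ℕ) : ℝ) +
        80.1 * ((i.2.1 : ℕ) : ℝ) + (6 * K + 1) + |((i.2.2 : ℕ) - (350 : ℕ) : ℝ)| * Y) =
      80.1 * (701 * K * ∑ m : Fin K, ((m : ℕ) : ℝ)) + 80.1 * (701 * K * ∑ m : Fin K, ((m : ℕ) : ℝ))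
        + 701 * K ^ 2 * (6 * K + 1) + K ^ 2 * 122850 * Y := by
    rw [← sum_fin_abs_sub]
    simp only [Fintype.sum_prod_type, Finset.sum_add_distrib, Finset.sum_const, Finset.card_univ,
      Fintype.card_fin, Fintype.card_prod, nsmul_eq_mul, ← Finset.mul_sum, ← Finset.sum_mul]
    push_cast
    ring
  have h5 := sum_fin_cast K
  have h6 : ∑ i : Fin K × Fin K × Fin (2 * 350 + 1), (80.1 * ((i.1 : ℕ) : ℝ) +
        80.1 * ((i.2.1 : ℕ) : ℝ) + (6 * K + 1) + |((i.2.2 : ℕ) - (350 : ℕ) : ℝ)| * Y) ≤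
      226300 * (K : ℝ) ^ 3 := by
    rw [h4]
    have g1 : 701 * (K : ℝ) * ∑ m : Fin K, ((m : ℕ) : ℝ) ≤ 701 * K * (K * K / 2) := by gcongr
    have g2 : (K : ℝ) ^ 2 * 122850 * Y ≤ K ^ 2 * 122850 * (1.35 * K) := by gcongr
    have g3 : (K : ℝ) ^ 2 * 10 ^ 13 ≤ K ^ 2 * K := by gcongr
    nlinarith
  have h7 := factorial_le_exp hK
  have h8 := h.trans (mul_le_mul (pow_le_pow_left₀ (by positivity) h7 3)
    (h3.trans (Real.exp_le_exp.2 h6)) (Finset.prod_nonneg fun i _ => by positivity)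
    (by positivity))
  rw [← Real.exp_nat_mul, ← Real.exp_nat_mul, ← Real.exp_add, Real.exp_le_exp] at h8
  push_cast at h8
  have h9 : (0 : ℝ) < (K : ℝ) ^ 3 := by positivity
  nlinarith

lemma abs_le_two_mul_norm_exp_sub_one {ψ : ℝ} (hψ : |ψ| ≤ Real.pi) :
    |ψ| ≤ 2 * ‖Complex.exp (Complex.I * ψ) - 1‖ := by
  have hπ := Real.pi_pos
  have hπ4 := Real.pi_le_four
  rw [Complex.norm_exp_I_mul_ofReal_sub_one, Real.norm_eq_abs, abs_mul, abs_two]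
  have h1 : Real.sin (|ψ| / 2) ≤ |Real.sin (ψ / 2)| := by
    rcases abs_cases ψ with ⟨h, -⟩ | ⟨h, -⟩
    · rw [h]
      exact le_abs_self _
    · rw [h, neg_div, Real.sin_neg]
      exact neg_le_abs _
  have h2 := Real.mul_le_sin (x := |ψ| / 2) (by positivity) (by linarith)
  have h3 : |ψ| / 4 ≤ 2 / Real.pi * (|ψ| / 2) := by
    rw [div_mul_div_comm, div_le_div_iff₀ (by norm_num) (by positivity)]
    nlinarith [abs_nonneg ψ]
  linarith

lemma exists_eq_exp_of_norm_eq {x y : ℂ} (hy : y ≠ 0) (h : ‖x‖ = ‖y‖) :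
    ∃ φ : ℝ, |φ| ≤ Real.pi ∧ x / y = Complex.exp (φ * Complex.I) := by
  refine ⟨(x / y).arg, Complex.abs_arg_le_pi _, ?_⟩
  have h1 : ‖x / y‖ = 1 := by rw [norm_div, h, div_self (norm_ne_zero_iff.2 hy)]
  conv_lhs => rw [← Complex.norm_mul_exp_arg_mul_I (x / y), h1]
  simp

lemma exists_int_abs_add_le {ψ ε : ℝ} (h : ‖Complex.exp (ψ * Complex.I) - 1‖ ≤ ε) :
    ∃ k : ℤ, |ψ + 2 * Real.pi * k| ≤ 2 * ε := by
  set z := Complex.exp (ψ * Complex.I) with hz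
  have h1 : z = Complex.exp (z.arg * Complex.I) := by
    have hnorm : ‖z‖ = 1 := by rw [hz, Complex.norm_exp_ofReal_mul_I]
    conv_lhs => rw [← Complex.norm_mul_exp_arg_mul_I z, hnorm]
    simp
  have h2 := abs_le_two_mul_norm_exp_sub_one (Complex.abs_arg_le_pi z)
  rw [mul_comm Complex.I, ← h1] at h2
  rw [hz] at h1
  obtain ⟨k, hk⟩ := Complex.exp_eq_exp_iff_exists_int.1 h1
  have hk' : (ψ : ℂ) = z.arg + k * (2 * Real.pi) := by
    apply mul_right_cancel₀ Complex.I_ne_zero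
    rw [hk]
    ring
  have hk2 : ψ = z.arg + k * (2 * Real.pi) := by exact_mod_cast hk'
  refine ⟨-k, ?_⟩
  have : ψ + 2 * Real.pi * (-k : ℤ) = z.arg := by
    rw [hk2]
    push_cast
    ring
  rw [this]
  linarith

lemma norm_zpow_sub_one_le {u : ℂ} {θ : ℝ} (hu : u = Complex.exp (θ * Complex.I)) (s t : ℤ) :
    ‖u ^ s - 1‖ ≤ |2 * Real.pi * t + s * θ| := by
  have h1 : u ^ s = Complex.exp (Complex.I * ((2 * Real.pi * t + s * θ : ℝ) : ℂ)) := by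
    rw [hu, ← Complex.exp_int_mul, Complex.exp_eq_exp_iff_exists_int]
    refine ⟨-t, ?_⟩
    push_cast
    ring
  rw [h1, ← Real.norm_eq_abs]
  exact Real.norm_exp_I_mul_ofReal_sub_one_le

lemma norm_zpow_neg_sub_one {u : ℂ} (hu : ‖u‖ = 1) (s : ℤ) : ‖u ^ (-s) - 1‖ = ‖u ^ s - 1‖ := by
  have h0 : u ≠ 0 := norm_ne_zero_iff.1 (by rw [hu]; norm_num)
  have h1 : u ^ (-s) - 1 = -(u ^ (-s) * (u ^ s - 1)) := by
    rw [mul_sub, ← zpow_add₀ h0, neg_add_cancel, zpow_zero]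
    ring
  rw [h1, norm_neg, norm_mul, norm_zpow, hu, one_zpow, one_mul]

lemma mul_abs_le_abs_two_pi_mul_add {u : ℂ} {θ : ℝ} (hu : u = Complex.exp (θ * Complex.I))
    (hθ : |θ| ≤ Real.pi) (hs : ∀ s : ℕ, 1 ≤ s → s ≤ 250 → 0.02 ≤ ‖u ^ s - 1‖) {s t : ℤ}
    (hs1 : |s| < 251) (ht : t ≠ 0) : 0.00008 * |(t : ℝ)| ≤ |2 * Real.pi * t + s * θ| := by
  have hπ := Real.pi_gt_three
  have hu1 : ‖u‖ = 1 := by rw [hu, Complex.norm_exp_ofReal_mul_I]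
  have ht1 : (1 : ℝ) ≤ |(t : ℝ)| := by exact_mod_cast Int.one_le_abs ht
  by_cases hbig : (250 : ℝ) ≤ |(t : ℝ)|
  · have h1 : |(s : ℝ) * θ| ≤ 250 * Real.pi := by
      rw [abs_mul]
      have : |(s : ℝ)| ≤ 250 := by exact_mod_cast Int.lt_add_one_iff.1 hs1
      gcongr
    have h2 := abs_sub_abs_le_abs_add (2 * Real.pi * t) (s * θ)
    rw [abs_mul, abs_of_pos (by positivity : (0 : ℝ) < 2 * Real.pi)] at h2
    nlinarith
  · rcases eq_or_ne s 0 with rfl | hs0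
    · rw [Int.cast_zero, zero_mul, add_zero, abs_mul,
        abs_of_pos (show (0 : ℝ) < 2 * Real.pi by positivity)]
      nlinarith
    · have h1 := norm_zpow_sub_one_le hu s t
      have hs2 := abs_lt.1 hs1
      have h2 : 0.02 ≤ ‖u ^ s - 1‖ := by
        have h3 := hs s.natAbs (Int.natAbs_pos.2 hs0) (by omega)
        rcases Int.natAbs_eq s with h | h
        · rw [h, zpow_natCast]
          exact h3
        · rw [h, norm_zpow_neg_sub_one hu1, zpow_natCast]
          exact h3
      linarith

lemma le_exp_twentySix : (370000000000 : ℝ) ≤ Real.exp 26.7 := by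
  have h1 := Real.exp_one_gt_d9
  have h2 : (1.945 : ℝ) ≤ Real.exp 0.7 := by
    have := Real.quadratic_le_exp_of_nonneg (show (0 : ℝ) ≤ 0.7 by norm_num)
    norm_num at this ⊢
    linarith
  have h3 : Real.exp 26.7 = Real.exp 1 ^ 26 * Real.exp 0.7 := by
    rw [← Real.exp_nat_mul, ← Real.exp_add]
    norm_num
  have h4 : (2.718 : ℝ) ^ 26 ≤ Real.exp 1 ^ 26 := by gcongr; linarith
  rw [h3]
  calc (370000000000 : ℝ) ≤ 2.718 ^ 26 * 1.945 := by norm_num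
    _ ≤ _ := by gcongr

lemma exp_two_lt : Real.exp 2 < 7.3891 := by
  have h1 := Real.exp_one_lt_d9
  have h3 : Real.exp 2 = Real.exp 1 ^ 2 := by
    rw [← Real.exp_nat_mul]
    norm_num
  rw [h3]
  calc Real.exp 1 ^ 2 ≤ 2.7182818286 ^ 2 := by gcongr
    _ < _ := by norm_num

lemma exp_neg_le_inv {x : ℝ} (hx : 0 < x) : Real.exp (-x) ≤ 1 / x := by
  rw [Real.exp_neg, ← one_div]
  exact one_div_le_one_div_of_le hx (by linarith [Real.add_one_le_exp x])

lemma mul_le_abs_sub {b n : ℕ} {k s t : ℤ} {φ θ lam : ℝ} (hn : 1000 ≤ n)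
    (hb : 6 * 10 ^ 12 * n ≤ b) (hφ : |φ| ≤ Real.pi) (hlam1 : |lam| ≤ 1)
    (hlam : φ + b * θ + 2 * Real.pi * k = lam) (hs : |s| < 251) (ht : t ≠ 0)
    (hlin : 0.00008 * |(t : ℝ)| ≤ |2 * Real.pi * t + s * θ|) :
    |t| * ((10 ^ 6 * n : ℕ) : ℤ) ≤ |t * b - s * k| := by
  have hπ := Real.pi_gt_three
  have hπ4 := Real.pi_le_four
  have hn' : (1000 : ℝ) ≤ n := by exact_mod_cast hn
  have hb' : 6 * 10 ^ 12 * (n : ℝ) ≤ b := by exact_mod_cast hb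
  have ht1 : (1 : ℝ) ≤ |(t : ℝ)| := by exact_mod_cast Int.one_le_abs ht
  have hs1 : |(s : ℝ)| ≤ 250 := by exact_mod_cast Int.lt_add_one_iff.1 hs
  have h1 : 2 * Real.pi * (t * b - s * k) =
      b * (2 * Real.pi * t + s * θ) + s * (φ - lam) := by
    rw [← hlam]
    ring
  have h2 : |(s : ℝ) * (φ - lam)| ≤ 250 * (4 + 1) := by
    rw [abs_mul]
    have := abs_sub φ lam
    gcongr
    linarith
  have h3 := abs_sub_abs_le_abs_add (b * (2 * Real.pi * t + s * θ)) (s * (φ - lam))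
  rw [← h1, abs_mul, abs_mul (2 * Real.pi), abs_of_nonneg (Nat.cast_nonneg (α := ℝ) b),
    abs_of_pos (show (0 : ℝ) < 2 * Real.pi by positivity)] at h3
  have h4 : 6 * 10 ^ 12 * (n : ℝ) * (0.00008 * |(t : ℝ)|) ≤
      b * |2 * Real.pi * t + s * θ| := by gcongr
  have h5 : 2 * Real.pi * |(t * b - s * k : ℝ)| ≤ 2 * 4 * |(t * b - s * k : ℝ)| := by gcongr
  have h6 : (1000 : ℝ) * 1 ≤ n * |(t : ℝ)| := by gcongr
  have h7 : |(t : ℝ)| * ((10 ^ 6 * n : ℕ) : ℝ) ≤ |(t * b - s * k : ℝ)| := by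
    push_cast
    linarith
  exact_mod_cast h7

theorem false_of_small_linear_form {b n : ℕ} (hn : 1000 ≤ n) (hb : 6 * 10 ^ 12 * n ≤ b)
    (hb' : b ≤ 7 * 10 ^ 12 * n) {a a' e e' : Fin 3 → ℂ} (hac : a ∈ conjRing)
    (hac' : a' ∈ conjRing) (hec : e ∈ conjRing) (hec' : e' ∈ conjRing)
    (ha : a 0 ≠ 0) (he : e 0 ≠ 0) (haa : ‖a 0‖ = ‖a' 0‖) (hee : ‖e 0‖ = ‖e' 0‖)
    (hna : ∀ v, ‖a v‖ ≤ Real.exp n) (hna' : ∀ v, ‖a' v‖ ≤ Real.exp n)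
    (hne : ∀ v, ‖e v‖ ≤ Real.exp 2.41) (hne' : ∀ v, ‖e' v‖ ≤ Real.exp 2.41)
    (hroot : ∀ j : ℕ, 0 < j → (e 0 / e' 0) ^ j ≠ 1)
    (hsep : ∀ s : ℕ, 1 ≤ s → s ≤ 250 → 0.02 ≤ ‖(e 0 / e' 0) ^ s - 1‖)
    (hsmall : ‖a 0 / a' 0 * (e 0 / e' 0) ^ b - 1‖ ≤ Real.exp (-2 * b)) : False := by
  have hπ := Real.pi_gt_three
  have hπ4 := Real.pi_lt_d4
  have ha' : a' 0 ≠ 0 := norm_ne_zero_iff.1 (haa ▸ norm_ne_zero_iff.2 ha)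
  have he' : e' 0 ≠ 0 := norm_ne_zero_iff.1 (hee ▸ norm_ne_zero_iff.2 he)
  obtain ⟨φ, hφ, hA⟩ := exists_eq_exp_of_norm_eq ha' haa
  obtain ⟨θ, hθ, hu⟩ := exists_eq_exp_of_norm_eq he' hee
  have hn0 : (1000 : ℝ) ≤ n := by exact_mod_cast hn
  have hb0 : 6 * 10 ^ 12 * (n : ℝ) ≤ b := by exact_mod_cast hb
  have hb1 : (b : ℝ) ≤ 7 * 10 ^ 12 * n := by exact_mod_cast hb'
  obtain ⟨k, hk⟩ : ∃ k : ℤ, |(φ + b * θ) + 2 * Real.pi * k| ≤ 2 * Real.exp (-2 * b) := by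
    apply exists_int_abs_add_le
    convert hsmall using 3
    rw [hA, hu, ← Complex.exp_nat_mul, ← Complex.exp_add]
    congr 1
    push_cast
    ring
  set lam := (φ + b * θ) + 2 * Real.pi * k with hlam
  have hlam1 : |lam| ≤ 1 / 10 ^ 9 := by
    have := exp_neg_le_inv (x := 2 * b) (by linarith)
    have h2 : 1 / (2 * (b : ℝ)) ≤ 1 / 10 ^ 10 :=
      one_div_le_one_div_of_le (by norm_num) (by linarith)
    rw [neg_mul] at hk
    norm_num at h2 this hk ⊢
    linarith
  have hθ0 : 0.02 ≤ |θ| := by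
    have h1 := hsep 1 le_rfl (by norm_num)
    have h2 := norm_zpow_sub_one_le hu 1 0
    rw [pow_one] at h1
    simp only [zpow_one, Int.cast_zero, Int.cast_one, mul_zero, zero_add, one_mul] at h2
    linarith
  have hk2 : 2 * Real.pi * k = lam - φ - b * θ := by rw [hlam]; ring
  have hk3 : 2 * Real.pi * |(k : ℝ)| = |lam - φ - b * θ| := by
    rw [← hk2, abs_mul, abs_of_pos (show (0 : ℝ) < 2 * Real.pi by positivity)]
  have hbθ : |b * θ| = b * |θ| := by rw [abs_mul, abs_of_nonneg (Nat.cast_nonneg (α := ℝ) b)]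
  have hlamφ := abs_sub lam φ
  have hkle : |(k : ℝ)| ≤ b / 2 + 1 := by
    have h1 := abs_sub (lam - φ) (b * θ)
    have h2 : (b : ℝ) * |θ| ≤ b * Real.pi := by gcongr
    have h3 : 2 * Real.pi * |(k : ℝ)| ≤ 2 * Real.pi * (b / 2 + 1) := by linarith
    exact le_of_mul_le_mul_left h3 (by positivity)
  have hkge : 4 * 10 ^ 7 * (n : ℝ) ≤ |(k : ℝ)| := by
    have h1 := abs_sub_abs_le_abs_sub (b * θ) (lam - φ)
    rw [abs_sub_comm (b * θ)] at h1
    have h2 : (b : ℝ) * 0.02 ≤ b * |θ| := by gcongr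
    have h3 : 2 * Real.pi * |(k : ℝ)| ≤ 2 * 4 * |(k : ℝ)| := by gcongr; linarith
    linarith
  obtain ⟨K, hK⟩ : ∃ K, K = 10 ^ 10 * n := ⟨_, rfl⟩
  have hKr : (K : ℝ) = 10 ^ 10 * n := by rw [hK]; push_cast; ring
  set Ω : Set (ℤ × ℤ × ℤ) := {x | |x.1| ≤ (500100000 : ℕ) ∧ |x.2.1| ≤ ((8 * 10 ^ 7 * n : ℕ) : ℤ) ∧
    |x.2.2| ≤ ((16 * 10 ^ 7 * n : ℕ) : ℤ)} with hΩ
  obtain ⟨p, hp⟩ := exists_basisFun_det_ne_zero (K := K) (L := 2 * 350) (b := b) (k := k)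
    (A := a 0 / a' 0) (u := e 0 / e' 0) Ω (by
      intro P hP hP0 hP1 hP2
      obtain ⟨r, s, t, hr, hs, ht, h⟩ := exists_eval_point_ne_zero (b := b) (k := k)
        (div_ne_zero ha ha') (div_ne_zero he he') hroot (K := K) (L := 2 * 350) (G := 251)
        (R₁ := 10 ^ 5) (S₁ := 10 ^ 6 * n) (T₁ := 4 * 10 ^ 7 * n) (R₂ := 10 ^ 9)
        (S₂ := 158 * 10 ^ 6 * n) (T₂ := 28 * 10 ^ 7 * n) (m₀ := 150 * K) (m₁ := 2 * K)
        (l := 105000) (by omega) (by omega) (by norm_num) (by omega) (by omega) (by omega)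
        (by omega)
        (fun s t hs ht => mul_le_abs_sub hn hb hφ (hlam1.trans (by norm_num)) rfl hs ht
          (mul_abs_le_abs_two_pi_mul_add hu hθ hsep hs ht))
        (by exact_mod_cast hkge) (by omega) (by omega) (by omega) (by omega) (by omega)
        (by omega) (by omega) (by rw [hK]; nlinarith) hP hP0 hP1 hP2
        (-(500100000 : ℕ), -((8 * 10 ^ 7 * n : ℕ) : ℤ), -((16 * 10 ^ 7 * n : ℕ) : ℤ))
      refine ⟨_, ⟨?_, ?_, ?_⟩, h⟩ <;> simp only [Prod.fst_add, Prod.snd_add] <;> rw [abs_le] <;>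
        constructor <;> omega)
  have hr : ∀ j, |(((p j : ℤ × ℤ × ℤ).1 : ℤ) : ℝ)| ≤ 500100000 := fun j => by
    exact_mod_cast (p j).2.1
  have hs : ∀ j, |(((p j : ℤ × ℤ × ℤ).2.1 : ℤ) : ℝ)| ≤ 8 * 10 ^ 7 * n := fun j => by
    exact_mod_cast (p j).2.2.1
  have ht : ∀ j, |(((p j : ℤ × ℤ × ℤ).2.2 : ℤ) : ℝ)| ≤ 16 * 10 ^ 7 * n := fun j => by
    exact_mod_cast (p j).2.2.2
  have hq := le_exp_twentySix
  have hq1 : (37 * 10 ^ 20) * (n : ℝ) ≤ K * Real.exp 26.7 := by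
    rw [hKr]
    calc ((37 * 10 ^ 20) : ℝ) * n = 10 ^ 10 * n * 370000000000 := by ring
      _ ≤ _ := by gcongr
  have hE := exp_two_lt
  have hE1 : 1 ≤ Real.exp 2 := Real.one_le_exp (by norm_num)
  have hWE : 1258300000 * (n : ℝ) * Real.exp 2 ≤ 1258300000 * n * 7.3891 := by gcongr
  refine interpolation_contradiction (K := K) (q := K * Real.exp 26.7)
    (Y := 1258300000 * n * Real.exp 2 + 3 * (2 * (500100000 : ℕ) * n +
      2 * ((8 * 10 ^ 7 * n : ℕ) : ℝ) * 2.41)) (by omega) rfl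
    (by rw [hKr]; push_cast; linarith) ?_
  refine pow_le_prod_of_interpolation (b := b) (k := k) (X := 8 * 10 ^ 7 * n + b * 500100000)
    (B := 350 * K) hac hac' hec hec' ha ha' he he' hA hu (lam := lam) (by rw [hlam]; push_cast; rfl)
    hna hna' hne hne'
    (fun j => (p j : ℤ × ℤ × ℤ)) (fun j => (p j).2.1) (fun j => (p j).2.2.1) hp (by positivity)
    (by positivity) hE1 ?_ ?_ ?_ ?_ ?_ ?_ ?_
  · intro j
    push_cast
    refine (abs_sub _ _).trans ?_
    rw [abs_mul, abs_of_nonneg (Nat.cast_nonneg (α := ℝ) b)]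
    gcongr
    · exact hs j
    · exact hr j
  · linarith
  · intro j
    push_cast
    have h1 := abs_sub (((p j : ℤ × ℤ × ℤ).2.2 : ℤ) : ℝ) (k * ((p j : ℤ × ℤ × ℤ).1 : ℤ))
    have h2 : |(k * ((p j : ℤ × ℤ × ℤ).1 : ℤ) : ℝ)| ≤ (b / 2 + 1) * 500100000 := by
      rw [abs_mul]
      gcongr
      exact hr j
    have h3 := ht j
    linarith
  · have h1 : |θ| / (2 * Real.pi) * (8 * 10 ^ 7 * n + b * 500100000 : ℝ) ≤
        1 / 2 * (8 * 10 ^ 7 * n + b * 500100000) := by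
      have : |θ| / (2 * Real.pi) ≤ 1 / 2 := by
        rw [div_le_iff₀ (by positivity)]
        linarith
      gcongr ?_ * _
    have h2 : 1 / (2 * Real.pi) * (1258300000 * n * Real.exp 2 : ℝ) ≤
        1 * (1258300000 * n * Real.exp 2) := by
      have : 1 / (2 * Real.pi) ≤ 1 := by
        rw [div_le_iff₀ (by positivity)]
        linarith
      gcongr ?_ * _
    linarith
  · intro j
    have h0 : θ * (((p j : ℤ × ℤ × ℤ).2.1 - b * (p j : ℤ × ℤ × ℤ).1 : ℤ) : ℝ) +
        2 * Real.pi * (((p j : ℤ × ℤ × ℤ).2.2 - k * (p j : ℤ × ℤ × ℤ).1 : ℤ) : ℝ) =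
        θ * ((p j : ℤ × ℤ × ℤ).2.1 : ℤ) + 2 * Real.pi * ((p j : ℤ × ℤ × ℤ).2.2 : ℤ) -
        ((p j : ℤ × ℤ × ℤ).1 : ℤ) * (lam - φ) := by
      rw [hlam]
      push_cast
      ring
    rw [h0]
    refine (abs_sub _ _).trans ((add_le_add_left (abs_add_le _ _) _).trans ?_)
    rw [abs_mul θ, abs_mul (2 * Real.pi), abs_mul (((p j : ℤ × ℤ × ℤ).1 : ℤ) : ℝ),
      abs_of_pos (show (0 : ℝ) < 2 * Real.pi by positivity)]
    have h1 : |θ| * |(((p j : ℤ × ℤ × ℤ).2.1 : ℤ) : ℝ)| ≤ 3.1416 * (8 * 10 ^ 7 * n) := by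
      gcongr
      · linarith
      · exact hs j
    have h2 : 2 * Real.pi * |(((p j : ℤ × ℤ × ℤ).2.2 : ℤ) : ℝ)| ≤
        2 * 3.1416 * (16 * 10 ^ 7 * n) := by
      gcongr
      exact ht j
    have h3 : |(((p j : ℤ × ℤ × ℤ).1 : ℤ) : ℝ)| * |lam - φ| ≤ 500100000 * 3.15 := by
      gcongr
      · exact hr j
      · linarith
    linarith
  · have h1 : (350 : ℝ) * (500100000 * |lam|) * Real.exp 2 ^ (350 * K) ≤
        350 * (500100000 * (2 * Real.exp (-2 * b))) * Real.exp 2 ^ (350 * K) := by gcongr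
    refine le_trans (by push_cast; exact h1) ?_
    have h2 : Real.exp (-2 * b) * Real.exp 2 ^ (350 * K) ≤ Real.exp (-(10 ^ 12 * n)) := by
      rw [← Real.exp_nat_mul, ← Real.exp_add]
      apply Real.exp_le_exp.2
      push_cast
      rw [hKr]
      linarith
    have h3 := exp_neg_le_inv (x := 10 ^ 12 * (n : ℝ)) (by positivity)
    have h4 : 1 / (10 ^ 12 * (n : ℝ)) ≤ 1 / 10 ^ 15 :=
      one_div_le_one_div_of_le (by norm_num) (by linarith)
    calc _ = 350070000000 * (Real.exp (-2 * b) * Real.exp 2 ^ (350 * K)) := by ring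
      _ ≤ 350070000000 * (1 / 10 ^ 15) := by
        gcongr
        exact h2.trans (h3.trans h4)
      _ ≤ 1 := by norm_num
  · have h1 := Nat.mul_div_le (350 * K * (350 * K + 1)) 2
    have h2 : 350 * K ^ 2 ≤ K ^ 3 := by
      rw [pow_succ K 2, mul_comm]
      gcongr
      omega
    nlinarith [Nat.mul_le_mul_left K h1]

end Parameters

section Units

/-- The coordinates of `(1 - 4 * θ + 2 * θ ^ 2) ^ s` with respect to `1, θ, θ ^ 2`, where
`θ ^ 3 = 5`. -/
def unitCoords : ℕ → ℤ × ℤ × ℤ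
  | 0 => (1, 0, 0)
  | s + 1 =>
    let v := unitCoords s
    (v.1 + 5 * (2 * v.2.1 - 4 * v.2.2), v.2.1 - 4 * v.1 + 10 * v.2.2,
      v.2.2 - 4 * v.2.1 + 2 * v.1)

/-- A lower bound for `10 ^ 6 * |y - z * θ|`, where `y` and `z` are the last two coordinates of
`(1 - 4 * θ + 2 * θ ^ 2) ^ s`. -/
def unitGap (s : ℕ) : ℤ :=
  |10 ^ 6 * (unitCoords s).2.1 - 1709976 * (unitCoords s).2.2| - |(unitCoords s).2.2|

lemma unitGap_large : ∀ s ≤ 250, 1 ≤ s →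
    0 ≤ unitGap s ∧ 4 * 10 ^ 10 * 123 ^ s ≤ 877 * unitGap s ^ 2 := by
  decide +kernel

lemma lt_cbrt : 1.709975 < cbrt := by
  refine lt_of_pow_lt_pow_left₀ 3 cbrt_pos.le ?_
  rw [cbrt_cube]
  norm_num

lemma cbrt_lt : cbrt < 1.709977 := by
  refine lt_of_pow_lt_pow_left₀ 3 (by norm_num) ?_
  rw [cbrt_cube]
  norm_num

lemma abs_cbrt_sub_le : |cbrt - 1.709976| ≤ 0.000001 := by
  have h1 := lt_cbrt
  have h2 := cbrt_lt
  rw [abs_le]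
  constructor <;> norm_num at h1 h2 ⊢ <;> linarith

lemma root_zero : root 0 = cbrt := by simp [root]

lemma root_one : root 1 = cbrt * cubeUnity := by simp [root]

lemma root_two : root 2 = cbrt * (-1 - cubeUnity) := by simp [root, cubeUnity_sq]

lemma conj_cubeUnity : (starRingEnd ℂ) cubeUnity = -1 - cubeUnity := by
  apply Complex.ext <;> simp [cubeUnity]
  norm_num

lemma conj_root_one : (starRingEnd ℂ) (root 1) = root 2 := by
  rw [root_one, root_two, map_mul, conj_cubeUnity, Complex.conj_ofReal]

lemma root_sum_eq_zero : root 0 + root 1 + root 2 = 0 := by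
  rw [root_zero, root_one, root_two]
  ring

lemma norm_root (i : Fin 3) : ‖root i‖ = cbrt := by
  have h : ‖root i‖ ^ 3 = cbrt ^ 3 := by
    rw [← norm_pow, root_cube, cbrt_cube]
    norm_num
  exact (pow_left_inj₀ (norm_nonneg _) cbrt_pos.le (by norm_num)).1 h

lemma sq_norm_root_sub {i j : Fin 3} (hij : i ≠ j) : ‖root i - root j‖ ^ 2 = 3 * cbrt ^ 2 := by
  have h3 : √3 ^ 2 = 3 := Real.sq_sqrt (by norm_num)
  rw [← Complex.normSq_eq_norm_sq, Complex.normSq_apply]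
  fin_cases i <;> fin_cases j
  all_goals first
    | exact absurd rfl hij
    | simp [root_zero, root_one, root_two, cubeUnity]
      ring_nf
      rw [h3]
      try ring

lemma norm_root_sub_le (i j : Fin 3) : ‖root i - root j‖ ≤ 3 := by
  rcases eq_or_ne i j with rfl | hij
  · simp
  · have h1 := sq_norm_root_sub hij
    have h2 := cbrt_lt
    have h3 := cbrt_pos
    refine (sq_le_sq₀ (norm_nonneg _) (by norm_num)).1 ?_
    rw [h1]
    nlinarith

lemma root_ne {i j : Fin 3} (hij : i ≠ j) : root i ≠ root j := by
  intro h
  have h1 := sq_norm_root_sub hij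
  rw [h, sub_self, norm_zero] at h1
  nlinarith [cbrt_pos]

/-- The conjugates of the fundamental unit of the cubic field generated by a cube root of 5. -/
noncomputable def cubicUnit (i : Fin 3) : ℂ := 1 - 4 * root i + 2 * root i ^ 2

/-- The conjugates of the inverse of the fundamental unit. -/
noncomputable def cubicUnitInv (i : Fin 3) : ℂ := 41 + 24 * root i + 14 * root i ^ 2

lemma cubicUnit_mul_inv (i : Fin 3) : cubicUnit i * cubicUnitInv i = 1 := by
  rw [cubicUnit, cubicUnitInv]
  linear_combination (28 * root i - 8) * root_cube i

lemma cubicUnit_ne_zero (i : Fin 3) : cubicUnit i ≠ 0 :=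
  left_ne_zero_of_mul (cubicUnit_mul_inv i ▸ one_ne_zero)

lemma conj_cubicUnit_one : (starRingEnd ℂ) (cubicUnit 1) = cubicUnit 2 := by
  simp only [cubicUnit, map_add, map_sub, map_mul, map_pow, map_one, map_ofNat, conj_root_one]

lemma norm_cubicUnit_one : ‖cubicUnit 1‖ = ‖cubicUnit 2‖ := by
  rw [← conj_cubicUnit_one, Complex.norm_conj]

lemma norm_cubicUnit_zero_mem : ‖cubicUnit 0‖ * 122.97 < 1 ∧ 1 < ‖cubicUnit 0‖ * 123 := by
  have h1 := lt_cbrt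
  have h2 := cbrt_lt
  have h3 : ‖cubicUnitInv 0‖ = 41 + 24 * cbrt + 14 * cbrt ^ 2 := by
    have : cubicUnitInv 0 = ((41 + 24 * cbrt + 14 * cbrt ^ 2 : ℝ) : ℂ) := by
      rw [cubicUnitInv, root_zero]
      push_cast
      rfl
    rw [this, Complex.norm_real, Real.norm_of_nonneg (by positivity)]
  have h4 : ‖cubicUnit 0‖ * ‖cubicUnitInv 0‖ = 1 := by
    rw [← norm_mul, cubicUnit_mul_inv, norm_one]
  have h0 : 0 < ‖cubicUnit 0‖ := norm_pos_iff.2 (cubicUnit_ne_zero 0)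
  rw [← h4, h3]
  constructor <;> gcongr <;> nlinarith

lemma root_one_mul_root_two : root 1 * root 2 = root 0 ^ 2 := by
  rw [root_zero, root_one, root_two]
  linear_combination (-(cbrt : ℂ) ^ 2) * cubeUnity_sq

lemma cubicUnit_one_mul_two : cubicUnit 1 * cubicUnit 2 = cubicUnitInv 0 := by
  rw [cubicUnit, cubicUnit, cubicUnitInv]
  linear_combination (-4 + 2 * (root 1 + root 2 - root 0) - 8 * (root 1 * root 2)) *
    root_sum_eq_zero + (12 + 8 * root 0 + 4 * (root 1 * root 2 + root 0 ^ 2)) *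
    root_one_mul_root_two + (8 + 4 * root 0) * root_cube 0

lemma norm_cubicUnit_zero_mul : ‖cubicUnit 0‖ * ‖cubicUnit 2‖ ^ 2 = 1 := by
  rw [pow_two]
  nth_rewrite 1 [← norm_cubicUnit_one]
  rw [← norm_mul, cubicUnit_one_mul_two, ← norm_mul, cubicUnit_mul_inv, norm_one]

lemma cubicUnit_pow (s : ℕ) (i : Fin 3) : cubicUnit i ^ s =
    ((unitCoords s).1 : ℂ) + (unitCoords s).2.1 * root i + (unitCoords s).2.2 * root i ^ 2 := by
  induction s with
  | zero => simp [unitCoords]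
  | succ s ih =>
    rw [pow_succ, ih, cubicUnit, unitCoords]
    push_cast
    linear_combination (-4 * ((unitCoords s).2.2 : ℂ) + 2 * (unitCoords s).2.1 +
      2 * (unitCoords s).2.2 * root i) * root_cube i

lemma norm_cubicUnit_two_pos : 0 < ‖cubicUnit 2‖ := norm_pos_iff.2 (cubicUnit_ne_zero 2)

lemma one_lt_norm_cubicUnit_two : 1 < ‖cubicUnit 2‖ := by
  have h1 := norm_cubicUnit_zero_mul
  have h2 := norm_cubicUnit_zero_mem.1
  by_contra! h
  have h3 : ‖cubicUnit 2‖ ^ 2 ≤ 1 := pow_le_one₀ (norm_nonneg _) h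
  nlinarith [norm_nonneg (cubicUnit 0)]

lemma sq_norm_cubicUnit_two_le : ‖cubicUnit 2‖ ^ 2 ≤ 123 := by
  have h1 := norm_cubicUnit_zero_mul
  have h2 := norm_cubicUnit_zero_mem.2
  have h3 : 0 < ‖cubicUnit 0‖ := norm_pos_iff.2 (cubicUnit_ne_zero 0)
  by_contra! h
  nlinarith

lemma norm_cubicUnit_le (i : Fin 3) : ‖cubicUnit i‖ ≤ Real.exp 2.41 := by
  have h1 := sq_norm_cubicUnit_two_le
  have h2 : (11.1 : ℝ) ≤ Real.exp 2.41 := by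
    have h3 := Real.exp_one_gt_d9
    have h4 := Real.quadratic_le_exp_of_nonneg (show (0 : ℝ) ≤ 0.205 by norm_num)
    have h5 : Real.exp 2.41 = Real.exp 1 ^ 2 * Real.exp 0.205 ^ 2 := by
      rw [← Real.exp_nat_mul, ← Real.exp_nat_mul, ← Real.exp_add]
      norm_num
    rw [h5]
    calc (11.1 : ℝ) ≤ 2.7182818283 ^ 2 * 1.2260125 ^ 2 := by norm_num
      _ ≤ _ := by
        gcongr
        refine le_trans ?_ h4
        norm_num
  have h3 : ‖cubicUnit 2‖ ≤ 11.1 := by nlinarith [norm_nonneg (cubicUnit 2)]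
  have h4 : ‖cubicUnit 0‖ ≤ 11.1 := by
    linarith [norm_cubicUnit_zero_mem.1, norm_nonneg (cubicUnit 0)]
  refine le_trans ?_ h2
  fin_cases i
  · exact h4
  · exact norm_cubicUnit_one.trans_le h3
  · exact h3

lemma cubicUnit_shift_mem (k : Fin 3) : (fun i => cubicUnit (i + k)) ∈ conjRing := by
  have h := root_shift_mem_conjRing k
  convert conjRing.add_mem (conjRing.sub_mem (const_mem_conjRing 1)
    (conjRing.mul_mem (const_mem_conjRing 4) h))
    (conjRing.mul_mem (const_mem_conjRing 2) (conjRing.pow_mem h 2)) using 1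
  ext i
  simp [cubicUnit]

lemma cubicUnitInv_shift_mem (k : Fin 3) : (fun i => cubicUnitInv (i + k)) ∈ conjRing := by
  have h := root_shift_mem_conjRing k
  convert conjRing.add_mem (conjRing.add_mem (const_mem_conjRing 41)
    (conjRing.mul_mem (const_mem_conjRing 24) h))
    (conjRing.mul_mem (const_mem_conjRing 14) (conjRing.pow_mem h 2)) using 1
  ext i
  simp [cubicUnitInv]

lemma cubicUnit_div_pow_ne_one (s : ℕ) (hs : 0 < s) : (cubicUnit 1 / cubicUnit 2) ^ s ≠ 1 := by
  intro h
  rw [div_pow, div_eq_one_iff_eq (pow_ne_zero _ (cubicUnit_ne_zero 2))] at h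
  have h1 := conjRing.sub_mem (conjRing.pow_mem (cubicUnit_shift_mem 1) s)
    (conjRing.pow_mem (cubicUnit_shift_mem 2) s)
  have h2 : cubicUnit 2 ^ s = cubicUnit 0 ^ s := by
    by_contra hne
    have h3 := one_le_prod_norm h1 (j := 1) (by simpa [sub_eq_zero] using hne)
    simp [Fin.prod_univ_three, h] at h3
    norm_num at h3
  have h4 := congrArg norm h2
  rw [norm_pow, norm_pow] at h4
  have h5 := one_lt_pow₀ one_lt_norm_cubicUnit_two hs.ne'
  have h6 : ‖cubicUnit 0‖ ^ s ≤ 1 := pow_le_one₀ (norm_nonneg _) (by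
    linarith [norm_cubicUnit_zero_mem.1, norm_nonneg (cubicUnit 0)])
  linarith

lemma le_norm_cubicUnit_div_pow_sub_one (s : ℕ) (h1 : 1 ≤ s) (h2 : s ≤ 250) :
    0.02 ≤ ‖(cubicUnit 1 / cubicUnit 2) ^ s - 1‖ := by
  obtain ⟨hv0, hv⟩ := unitGap_large s h2 h1
  set y := (unitCoords s).2.1 with hy
  set z := (unitCoords s).2.2 with hz
  have hvr : (0 : ℝ) ≤ unitGap s := by exact_mod_cast hv0
  have hv' : 4 * 10 ^ 10 * 123 ^ s ≤ 877 * (unitGap s : ℝ) ^ 2 := by exact_mod_cast hv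
  have h3 : (unitGap s : ℝ) ≤ 10 ^ 6 * |y - z * cbrt| := by
    have e1 : (unitGap s : ℝ) = |10 ^ 6 * (y : ℝ) - 1709976 * z| - |(z : ℝ)| := by
      rw [unitGap, ← hy, ← hz]
      norm_num
    have e2 : 10 ^ 6 * (y : ℝ) - 1709976 * z =
        10 ^ 6 * (y - z * cbrt) + 10 ^ 6 * (z * (cbrt - 1.709976)) := by ring
    have e3 := abs_add_le (10 ^ 6 * (y - z * cbrt)) (10 ^ 6 * (z * (cbrt - 1.709976)))
    rw [← e2, abs_mul, abs_mul (10 ^ 6), abs_mul (z : ℝ)] at e3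
    have e4 : |(z : ℝ)| * |cbrt - 1.709976| ≤ |(z : ℝ)| * 0.000001 := by
      gcongr
      exact abs_cbrt_sub_le
    rw [e1]
    norm_num at e3 e4 ⊢
    linarith
  have h4 : cubicUnit 1 ^ s - cubicUnit 2 ^ s =
      (root 1 - root 2) * ((y - z * cbrt : ℝ) : ℂ) := by
    rw [cubicUnit_pow, cubicUnit_pow]
    push_cast
    rw [← root_zero]
    linear_combination (z : ℂ) * (root 1 - root 2) * root_sum_eq_zero
  have h5 : (cubicUnit 1 / cubicUnit 2) ^ s - 1 =
      (root 1 - root 2) * ((y - z * cbrt : ℝ) : ℂ) / cubicUnit 2 ^ s := by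
    rw [← h4, div_pow, sub_div, div_self (pow_ne_zero _ (cubicUnit_ne_zero 2))]
  refine (sq_le_sq₀ (by norm_num) (norm_nonneg _)).1 ?_
  have h6 : (‖cubicUnit 2‖ ^ s) ^ 2 ≤ 123 ^ s := by
    rw [← pow_mul, mul_comm, pow_mul]
    gcongr
    exact sq_norm_cubicUnit_two_le
  have h7 : (unitGap s : ℝ) ^ 2 ≤ (10 ^ 6 * |y - z * cbrt|) ^ 2 := by gcongr
  have h8 : (8.77 : ℝ) ≤ 3 * cbrt ^ 2 := by nlinarith [lt_cbrt]
  rw [h5, norm_div, norm_mul, norm_pow, Complex.norm_real, Real.norm_eq_abs, div_pow, mul_pow,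
    sq_norm_root_sub (by decide), le_div_iff₀ (pow_pos (pow_pos norm_cubicUnit_two_pos _) _)]
  calc (0.02 : ℝ) ^ 2 * (‖cubicUnit 2‖ ^ s) ^ 2 ≤ 0.02 ^ 2 * 123 ^ s := by gcongr
    _ ≤ 8.77 * |y - z * cbrt| ^ 2 := by
      rw [mul_pow] at h7
      norm_num at h7 hv' ⊢
      linarith
    _ ≤ _ := by gcongr

end Units

section Reduction

lemma cubicUnitInv_eq (i : Fin 3) : cubicUnitInv i = (cubicUnit i)⁻¹ :=
  eq_inv_of_mul_eq_one_right (cubicUnit_mul_inv i)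

/-- The conjugates of `p - q * θ`, where `θ ^ 3 = 5`. -/
noncomputable def linForm (p q : ℤ) (i : Fin 3) : ℂ := p - q * root i

lemma linForm_shift_mem (p q : ℤ) (k : Fin 3) : (fun i => linForm p q (i + k)) ∈ conjRing := by
  convert conjRing.sub_mem (const_mem_conjRing p)
    (conjRing.mul_mem (const_mem_conjRing q) (root_shift_mem_conjRing k)) using 1
  rfl

lemma conj_linForm_one (p q : ℤ) : (starRingEnd ℂ) (linForm p q 1) = linForm p q 2 := by
  simp [linForm, conj_root_one]

lemma norm_linForm_one (p q : ℤ) : ‖linForm p q 1‖ = ‖linForm p q 2‖ := by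
  rw [← conj_linForm_one, Complex.norm_conj]

lemma linForm_one_ne_zero (p : ℤ) {q : ℤ} (hq : 1 ≤ q) : linForm p q 1 ≠ 0 := by
  intro h
  have h2 : linForm p q 2 = 0 := by rw [← conj_linForm_one, h, map_zero]
  have h3 : (q : ℂ) * (root 1 - root 2) = 0 := by
    rw [linForm] at h h2
    linear_combination h2 - h
  rcases mul_eq_zero.1 h3 with h4 | h4
  · have : q = 0 := by exact_mod_cast h4
    omega
  · exact root_ne (by decide) (sub_eq_zero.1 h4)

lemma one_le_norm_linForm (p : ℤ) {q : ℤ} (hq : 1 ≤ q) :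
    1 ≤ ‖linForm p q 0‖ * ‖linForm p q 2‖ ^ 2 := by
  have h := one_le_prod_norm (linForm_shift_mem p q 0) (j := 1)
    (by simpa using linForm_one_ne_zero p hq)
  simp only [Fin.prod_univ_three, add_zero, norm_linForm_one] at h
  linarith

lemma norm_linForm_two_le (p : ℤ) {q : ℤ} (hq : 1 ≤ q) (h : ‖linForm p q 0‖ ≤ 1) :
    ‖linForm p q 2‖ ≤ 4 * q := by
  have hq' : (1 : ℝ) ≤ q := by exact_mod_cast hq
  have h1 : linForm p q 2 = linForm p q 0 + q * (root 0 - root 2) := by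
    rw [linForm, linForm]
    ring
  rw [h1]
  refine (norm_add_le _ _).trans ?_
  have h2 : ‖(q : ℂ) * (root 0 - root 2)‖ ≤ q * 3 := by
    rw [norm_mul, Complex.norm_intCast, abs_of_nonneg (by linarith)]
    gcongr
    exact norm_root_sub_le _ _
  linarith

/-- The conjugates of `p - q * θ`, divided by the `b`-th power of the fundamental unit. -/
noncomputable def reducedForm (p q : ℤ) (b : ℕ) (i : Fin 3) : ℂ :=
  linForm p q i * cubicUnitInv i ^ b

lemma reducedForm_shift_mem (p q : ℤ) (b : ℕ) (k : Fin 3) :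
    (fun i => reducedForm p q b (i + k)) ∈ conjRing :=
  conjRing.mul_mem (linForm_shift_mem p q k) (conjRing.pow_mem (cubicUnitInv_shift_mem k) b)

lemma norm_reducedForm (p q : ℤ) (b : ℕ) (i : Fin 3) :
    ‖reducedForm p q b i‖ = ‖linForm p q i‖ / ‖cubicUnit i‖ ^ b := by
  rw [reducedForm, norm_mul, norm_pow, cubicUnitInv_eq, norm_inv, inv_pow, div_eq_mul_inv]

lemma norm_reducedForm_mul_sub_le {p q : ℤ} {b : ℕ} {B : ℝ}
    (h : ∀ i, ‖reducedForm p q b i‖ ≤ Real.exp B) {n : ℕ} (hn : B + 2 ≤ n) (i j k : Fin 3) :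
    ‖reducedForm p q b i * (root j - root k)‖ ≤ Real.exp n := by
  have h2 : (3 : ℝ) ≤ Real.exp 2 := by linarith [Real.add_one_le_exp (2 : ℝ)]
  rw [norm_mul]
  calc _ ≤ Real.exp B * Real.exp 2 := by
        gcongr
        · exact h i
        · exact (norm_root_sub_le j k).trans h2
    _ ≤ Real.exp n := by
      rw [← Real.exp_add]
      exact Real.exp_le_exp.2 hn

lemma norm_ratio_sub_one {p q : ℤ} (b : ℕ) (h1 : linForm p q 2 ≠ 0) :
    ‖reducedForm p q b 1 * (root 2 - root 0) / (reducedForm p q b 2 * (root 1 - root 0)) *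
      (cubicUnit 1 / cubicUnit 2) ^ b - 1‖ = ‖linForm p q 0‖ / ‖linForm p q 2‖ := by
  have e1 := pow_ne_zero b (cubicUnit_ne_zero 1)
  have e2 := pow_ne_zero b (cubicUnit_ne_zero 2)
  have e3 : root 1 - root 0 ≠ 0 := sub_ne_zero.2 (root_ne (by decide))
  have h2 : reducedForm p q b 1 * (root 2 - root 0) / (reducedForm p q b 2 * (root 1 - root 0)) *
      (cubicUnit 1 / cubicUnit 2) ^ b - 1 =
      linForm p q 0 * (root 2 - root 1) / (linForm p q 2 * (root 1 - root 0)) := by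
    rw [reducedForm, reducedForm, cubicUnitInv_eq, cubicUnitInv_eq, inv_pow, inv_pow, div_pow]
    field_simp
    simp only [linForm]
    ring
  have h3 : ‖root 2 - root 1‖ = ‖root 1 - root 0‖ := by
    refine (pow_left_inj₀ (norm_nonneg _) (norm_nonneg _) two_ne_zero).1 ?_
    rw [sq_norm_root_sub (by decide), sq_norm_root_sub (by decide)]
  rw [h2, norm_div, norm_mul, norm_mul, h3, mul_div_mul_right _ _ (norm_ne_zero_iff.2 e3)]

lemma log_norm_linForm_zero_le {p q : ℤ} (hq : 1 ≤ q)
    (h : |cbrt - p / q| ≤ 10 ^ (-(12900 : ℤ)) / (q : ℝ) ^ (2.9999999999998 : ℝ)) :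
    Real.log ‖linForm p q 0‖ ≤ -25800 - 1.9999999999998 * Real.log q := by
  have hq' : (0 : ℝ) < q := by exact_mod_cast hq
  have h0 : 0 < ‖linForm p q 0‖ := by
    by_contra! hle
    have := one_le_norm_linForm p hq
    nlinarith [sq_nonneg ‖linForm p q 2‖, norm_nonneg (linForm p q 0)]
  have h1 : ‖linForm p q 0‖ = q * |cbrt - p / q| := by
    have : linForm p q 0 = ((-(q * (cbrt - p / q)) : ℝ) : ℂ) := by
      have hqc : (q : ℂ) ≠ 0 := by exact_mod_cast hq'.ne'
      rw [linForm, root_zero]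
      push_cast
      field_simp
      ring
    rw [this, Complex.norm_real, norm_neg, norm_mul, Real.norm_of_nonneg hq'.le, Real.norm_eq_abs]
  have h2 : ‖linForm p q 0‖ ≤
      q * (10 ^ (-(12900 : ℤ)) / (q : ℝ) ^ (2.9999999999998 : ℝ)) := by
    rw [h1]
    gcongr
  have h3 := Real.log_le_log h0 h2
  have h10 : 2 ≤ Real.log 10 := by
    rw [Real.le_log_iff_exp_le (by norm_num)]
    linarith [exp_two_lt]
  rw [Real.log_mul hq'.ne' (by positivity), Real.log_div (by positivity) (by positivity),
    Real.log_zpow, Real.log_rpow hq'] at h3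
  push_cast at h3
  linarith

lemma not_abs_cbrt_sub_le {p q : ℤ} (hq : 1 ≤ q) :
    ¬ |cbrt - p / q| ≤ 10 ^ (-(12900 : ℤ)) / (q : ℝ) ^ (2.9999999999998 : ℝ) := by
  intro h
  have hL0 := log_norm_linForm_zero_le hq h
  have hq' : (1 : ℝ) ≤ q := by exact_mod_cast hq
  have hl : 0 ≤ Real.log q := Real.log_nonneg hq'
  have hN := one_le_norm_linForm p hq
  have hβ2 : linForm p q 2 ≠ 0 := by
    intro h0
    rw [h0] at hN
    norm_num at hN
  have hβ1 : linForm p q 1 ≠ 0 := linForm_one_ne_zero p hq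
  have hβ0 : linForm p q 0 ≠ 0 := by
    intro h0
    rw [h0] at hN
    norm_num at hN
  have p0 := norm_pos_iff.2 hβ0
  have p2 := norm_pos_iff.2 hβ2
  have u0 := norm_pos_iff.2 (cubicUnit_ne_zero 0)
  have u2 := norm_pos_iff.2 (cubicUnit_ne_zero 2)
  set L0 := Real.log ‖linForm p q 0‖ with hL0'
  set L2 := Real.log ‖linForm p q 2‖ with hL2'
  set w := Real.log ‖cubicUnit 2‖ with hw
  have hw2 : w ≤ 2.41 := by
    rw [hw, Real.log_le_iff_le_exp u2]
    exact norm_cubicUnit_le 2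
  have hv : Real.log ‖cubicUnit 0‖ = -2 * w := by
    have := congrArg Real.log norm_cubicUnit_zero_mul
    rw [Real.log_mul u0.ne' (pow_ne_zero _ u2.ne'), Real.log_pow, Real.log_one] at this
    push_cast at this
    linarith
  have hw1 : 1 ≤ w := by
    have h1 : Real.log ‖cubicUnit 0‖ ≤ -2 := by
      rw [Real.log_le_iff_le_exp u0, Real.exp_neg, ← one_div, le_div_iff₀ (Real.exp_pos 2)]
      have h2 := norm_cubicUnit_zero_mem.1
      nlinarith [exp_two_lt]
    linarith
  have hM0 : 0 ≤ L0 + 2 * L2 := by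
    have := Real.log_nonneg hN
    rw [Real.log_mul p0.ne' (pow_ne_zero _ p2.ne'), Real.log_pow] at this
    push_cast at this
    exact this
  have hL2 : L2 ≤ 2 + Real.log q := by
    have h1 : ‖linForm p q 0‖ ≤ 1 := by
      rw [← Real.log_nonpos_iff p0.le]
      linarith
    have h2 := Real.log_le_log p2 (norm_linForm_two_le p hq h1)
    rw [Real.log_mul (by norm_num) (by linarith)] at h2
    have h4 : Real.log 4 ≤ 2 := by
      rw [Real.log_le_iff_le_exp (by norm_num)]
      linarith [Real.quadratic_le_exp_of_nonneg (show (0 : ℝ) ≤ 2 by norm_num)]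
    linarith
  obtain ⟨b, hb⟩ : ∃ b, b = ⌊((L0 + 2 * L2) / 3 - L0) / (2 * w)⌋₊ := ⟨_, rfl⟩
  have hb1 : (b : ℝ) * (2 * w) ≤ (L0 + 2 * L2) / 3 - L0 := by
    rw [← le_div_iff₀ (by linarith), hb]
    exact Nat.floor_le (div_nonneg (by linarith) (by linarith))
  have hb2 : (L0 + 2 * L2) / 3 - L0 < (b + 1) * (2 * w) := by
    rw [← div_lt_iff₀ (by linarith), hb]
    exact Nat.lt_floor_add_one _
  have hb0 : (0 : ℝ) ≤ b := Nat.cast_nonneg b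
  have hbl : 1.9999999999998 * Real.log q ≤ 4.82 * b := by nlinarith
  obtain ⟨n, hn⟩ : ∃ n, n = b / (6 * 10 ^ 12) := ⟨_, rfl⟩
  have hn1 : 6 * 10 ^ 12 * n ≤ b := by omega
  have hn2 : b < 6 * 10 ^ 12 * (n + 1) := by omega
  have hn2' : (b : ℝ) < 6 * 10 ^ 12 * (n + 1) := by exact_mod_cast hn2
  have hn3 : 1000 ≤ n := by
    have : (1000 : ℝ) ≤ n := by linarith
    exact_mod_cast this
  have hg : ∀ i, ‖reducedForm p q b i‖ ≤ Real.exp ((L0 + 2 * L2) / 3 + 2.41) := by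
    have g2 : ‖reducedForm p q b 2‖ ≤ Real.exp ((L0 + 2 * L2) / 3 + 2.41) := by
      rw [norm_reducedForm, ← Real.log_le_iff_le_exp (by positivity),
        Real.log_div p2.ne' (by positivity), Real.log_pow]
      linarith
    intro i
    fin_cases i
    · rw [Fin.zero_eta, norm_reducedForm, ← Real.log_le_iff_le_exp (by positivity),
        Real.log_div p0.ne' (by positivity), Real.log_pow, hv]
      linarith
    · refine le_trans (le_of_eq ?_) g2
      rw [Fin.mk_one, norm_reducedForm, norm_reducedForm, norm_linForm_one, norm_cubicUnit_one]
    · exact g2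
  have hgn : (L0 + 2 * L2) / 3 + 2.41 + 2 ≤ n := by linarith
  have hr : ∀ i j, (fun v => root (v + i) - root (v + j)) ∈ conjRing := fun i j =>
    conjRing.sub_mem (root_shift_mem_conjRing i) (root_shift_mem_conjRing j)
  refine false_of_small_linear_form hn3 hn1 (by omega)
    (conjRing.mul_mem (reducedForm_shift_mem p q b 1) (hr 2 0))
    (conjRing.mul_mem (reducedForm_shift_mem p q b 2) (hr 1 0))
    (cubicUnit_shift_mem 1) (cubicUnit_shift_mem 2) ?_ (cubicUnit_ne_zero _) ?_ ?_
    (fun v => norm_reducedForm_mul_sub_le hg hgn _ _ _)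
    (fun v => norm_reducedForm_mul_sub_le hg hgn _ _ _) (fun v => norm_cubicUnit_le _)
    (fun v => norm_cubicUnit_le _) ?_ ?_ ?_ <;> simp only [Pi.mul_apply, zero_add]
  · refine mul_ne_zero (mul_ne_zero hβ1 (pow_ne_zero _ ?_)) (sub_ne_zero.2 (root_ne (by decide)))
    rw [cubicUnitInv_eq]
    exact inv_ne_zero (cubicUnit_ne_zero 1)
  · have h3 : ‖root 2 - root 0‖ = ‖root 1 - root 0‖ := by
      refine (pow_left_inj₀ (norm_nonneg _) (norm_nonneg _) two_ne_zero).1 ?_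
      rw [sq_norm_root_sub (by decide), sq_norm_root_sub (by decide)]
    rw [norm_mul, norm_mul, norm_reducedForm, norm_reducedForm, norm_linForm_one,
      norm_cubicUnit_one, h3]
  · exact norm_cubicUnit_one
  · exact cubicUnit_div_pow_ne_one
  · exact le_norm_cubicUnit_div_pow_sub_one
  · rw [norm_ratio_sub_one b hβ2, ← Real.log_le_iff_le_exp (by positivity),
      Real.log_div p0.ne' p2.ne']
    nlinarith

end Reduction

end CbrtFive

/-- **The Baker–Stewart effective irrationality measure for the cube root of 5 (1988).**
For every integer `p` and every integer `q ≥ 1`,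
`|5^(1/3) − p/q| > 10⁻¹²⁹⁰⁰ / q^2.9999999999998`. -/
theorem baker_stewart_cbrt_five (p q : ℤ) (hq : 1 ≤ q) :
    |(5 : ℝ) ^ ((1 : ℝ) / 3) - (p : ℝ) / (q : ℝ)| >
      10 ^ (-(12900 : ℤ)) / (q : ℝ) ^ (2.9999999999998 : ℝ) := by
  exact lt_of_not_ge (CbrtFive.not_abs_cbrt_sub_le hq)
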